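/- Let Ω be a bounded Lipschitz domain in ℝ^N (N ≥ 2), x₀ ∈ Ω, a > 0 and V ∈ 𝒱(Ω,a). If μ is a positive finite measure on ∂Ω, then for μ-almost all y in the set Sing_V(Ω) of finely irregular points, the ratio K_μ^V(x)/K_μ(x) tends to +∞ as x → y nontangentially in Ω, where K_μ^V(x) = ∫ K_y^V(x) dμ(y) and K_μ(x) = ∫ K_y(x) dμ(y). -/

import Mathlib

open MeasureTheory Metric Set Filter Topology
open scoped ENNReal NNReal

noncomputable section

namespace Anc

abbrev ES (N : ℕ) := EuclideanSpace ℝ (Fin N)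

/-- `δ_Ω(x)`: the distance from `x` to the complement of `Ω`. -/
def dista {N : ℕ} (Ω : Set (ES N)) (x : ES N) : ℝ := infDist x Ωᶜ

/-- Pointwise Laplacian (junk values where the derivatives do not exist). -/
def lap {N : ℕ} (u : ES N → ℝ) (x : ES N) : ℝ :=
  ∑ i : Fin N,
    fderiv ℝ (fun y => fderiv ℝ u y (EuclideanSpace.single i 1)) x (EuclideanSpace.single i 1)

/-- Smooth compactly supported test functions in `Ω`. -/
def IsTestFun {N : ℕ} (Ω : Set (ES N)) (φ : ES N → ℝ) : Prop :=
  ContDiff ℝ (⊤ : ℕ∞) φ ∧ IsCompact (tsupport φ) ∧ tsupport φ ⊆ Ω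

/-- `u` is a continuous weak solution of `Δu - V·u = 0` in `Ω` (i.e. `L_V`-harmonic). -/
def LVHarmonic {N : ℕ} (Ω : Set (ES N)) (V u : ES N → ℝ) : Prop :=
  ContinuousOn u Ω ∧ LocallyIntegrableOn u Ω ∧
    LocallyIntegrableOn (fun x => V x * u x) Ω ∧
    ∀ φ, IsTestFun Ω φ → ∫ x in Ω, u x * lap φ x = ∫ x in Ω, V x * u x * φ x

/-- `s` is `L_V`-superharmonic in `Ω` (weakly, `Δs - V·s ≤ 0`, `s` l.s.c.). -/
def LVSuperharmonic {N : ℕ} (Ω : Set (ES N)) (V s : ES N → ℝ) : Prop :=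
  LowerSemicontinuousOn s Ω ∧ LocallyIntegrableOn s Ω ∧
    LocallyIntegrableOn (fun x => V x * s x) Ω ∧
    ∀ φ, IsTestFun Ω φ → (∀ x, 0 ≤ φ x) →
      ∫ x in Ω, s x * lap φ x ≤ ∫ x in Ω, V x * s x * φ x

/-- The class `𝒱(Ω,a)` of nonnegative Borel potentials with `V(x) ≤ a/δ_Ω(x)²`. -/
def VClass {N : ℕ} (Ω : Set (ES N)) (a : ℝ) (V : ES N → ℝ) : Prop :=
  Measurable V ∧ ∀ x ∈ Ω, 0 ≤ V x ∧ V x * dista Ω x ^ 2 ≤ a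

/-- Lipschitz domain: open, connected, and near every boundary point, after an
orthogonal change of coordinates, the domain is the region above the graph of a
Lipschitz function. -/
def IsLipschitzDomain {N : ℕ} (Ω : Set (ES N)) : Prop :=
  IsOpen Ω ∧ IsConnected Ω ∧
    ∀ z ∈ frontier Ω, ∃ (g : ES N ≃ₗᵢ[ℝ] ES N) (i : Fin N) (f : ES N → ℝ)
      (L : ℝ≥0) (ε : ℝ), 0 < ε ∧ LipschitzWith L f ∧
      (∀ x w : ES N, (∀ j, j ≠ i → x j = w j) → f x = f w) ∧
      ∀ x ∈ ball z ε, (x ∈ Ω ↔ f (g x) < g x i)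

/-- `Ω` has a `C^{1,α}` boundary near `y`. -/
def IsC1AlphaNear {N : ℕ} (Ω : Set (ES N)) (α : ℝ) (y : ES N) : Prop :=
  ∃ (g : ES N ≃ₗᵢ[ℝ] ES N) (i : Fin N) (f : ES N → ℝ) (C : ℝ≥0) (ε : ℝ),
    0 < ε ∧ ContDiff ℝ 1 f ∧ HolderWith C α.toNNReal (fderiv ℝ f) ∧
    (∀ x w : ES N, (∀ j, j ≠ i → x j = w j) → f x = f w) ∧
    ∀ x ∈ ball y ε, (x ∈ Ω ↔ f (g x) < g x i)

/-- `K` is the `L_V`-Martin kernel of `Ω` with pole `y ∈ ∂Ω`, normalized at `x₀`: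
the unique positive `L_V`-harmonic function vanishing on `∂Ω ∖ {y}` with `K x₀ = 1`. -/
def IsMartinKernel {N : ℕ} (Ω : Set (ES N)) (V : ES N → ℝ) (x₀ y : ES N)
    (K : ES N → ℝ) : Prop :=
  LVHarmonic Ω V K ∧ (∀ x ∈ Ω, 0 < K x) ∧ K x₀ = 1 ∧
    ∀ z ∈ frontier Ω, z ≠ y → Tendsto K (𝓝[Ω] z) (𝓝 0)

/-- `G` is the `L_V`-Green function of `Ω` with pole `y ∈ Ω`:
positive, vanishing at the boundary, and `L_V G = -δ_y` weakly. -/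
def IsGreenFunction {N : ℕ} (Ω : Set (ES N)) (V : ES N → ℝ) (y : ES N)
    (G : ES N → ℝ) : Prop :=
  ContinuousOn G (Ω \ {y}) ∧ (∀ x ∈ Ω \ {y}, 0 < G x) ∧ LocallyIntegrableOn G Ω ∧
    (∀ z ∈ frontier Ω, Tendsto G (𝓝[Ω \ {y}] z) (𝓝 0)) ∧
    ∀ φ, IsTestFun Ω φ → ∫ x in Ω, G x * (lap φ x - V x * φ x) = -φ y

/-- `y ∈ ∂Ω` is finely regular w.r.t. `V`, `Ky` being the classical Martin kernel at
`y`: the greatest `L_V`-harmonic minorant of `Ky` is positive, equivalently `Ky`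
admits a positive `L_V`-harmonic minorant. -/
def FinelyRegular {N : ℕ} (Ω : Set (ES N)) (V Ky : ES N → ℝ) : Prop :=
  ∃ h, LVHarmonic Ω V h ∧ (∀ x ∈ Ω, 0 < h x) ∧ ∀ x ∈ Ω, h x ≤ Ky x

/-- `h` is the greatest nonnegative `L_V`-harmonic minorant of `w` in `Ω`. -/
def IsGreatestLVHarmMinorant {N : ℕ} (Ω : Set (ES N)) (V w h : ES N → ℝ) : Prop :=
  LVHarmonic Ω V h ∧ (∀ x ∈ Ω, 0 ≤ h x ∧ h x ≤ w x) ∧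
    ∀ g, LVHarmonic Ω V g → (∀ x ∈ Ω, 0 ≤ g x ∧ g x ≤ w x) → ∀ x ∈ Ω, g x ≤ h x

/-- Classical superharmonicity via the sub-mean value property. -/
def IsSuperharmonicOn {N : ℕ} (W : Set (ES N)) (s : ES N → ℝ) : Prop :=
  LowerSemicontinuousOn s W ∧ LocallyIntegrableOn s W ∧
    ∀ x ∈ W, ∀ t > (0:ℝ), closedBall x t ⊆ W → ⨍ z in ball x t, s z ≤ s x

/-- The réduite of `w` over `A` in `W`: infimum of the nonnegative superharmonic
functions in `W` dominating `w` on `A`. -/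
def reduite {N : ℕ} (W : Set (ES N)) (w : ES N → ℝ) (A : Set (ES N)) (x : ES N) : ℝ :=
  sInf {v | ∃ s : ES N → ℝ, IsSuperharmonicOn W s ∧ (∀ z ∈ W, 0 ≤ s z) ∧
    (∀ z ∈ A, w z ≤ s z) ∧ v = s x}

/-- The lower semicontinuous regularization `R̂` of the réduite. -/
def reduiteReg {N : ℕ} (W : Set (ES N)) (w : ES N → ℝ) (A : Set (ES N)) (x : ES N) : ℝ :=
  liminf (reduite W w A) (𝓝[W] x)

/-- Nontangential approach region at `y` with aperture `κ`. -/
def ntRegion {N : ℕ} (Ω : Set (ES N)) (y : ES N) (κ : ℝ) : Set (ES N) :=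
  {x | x ∈ Ω ∧ dist x y ≤ κ * dista Ω x}

/-- `g` tends to `l` nontangentially at `y`. -/
def TendstoNT {N : ℕ} (Ω : Set (ES N)) (g : ES N → ℝ) (y : ES N) (l : Filter ℝ) : Prop :=
  ∀ κ > (0:ℝ), Tendsto g (𝓝[ntRegion Ω y κ] y) l

/-- Truncated cone `{y + t(ν+v) : 0 < t ≤ η, ‖v‖ ≤ η}` with vertex `y`. -/
def truncCone {N : ℕ} (y ν : ES N) (η : ℝ) : Set (ES N) :=
  {x | ∃ (t : ℝ) (v : ES N), 0 < t ∧ t ≤ η ∧ ‖v‖ ≤ η ∧ x = y + t • (ν + v)}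

/-- Last coordinate of a point of `ℝ^{n+1}`. -/
def lastC {n : ℕ} (x : ES (n + 1)) : ℝ := x (Fin.last n)

/-- First `n` coordinates of a point of `ℝ^{n+1}`. -/
def firstC {n : ℕ} (x : ES (n + 1)) : ES n :=
  (EuclideanSpace.equiv (Fin n) ℝ).symm fun i => x i.castSucc

/-- The region `U_f(r,ρ) = {(x',x_N) : |x'| < r, f(x') < x_N < ρ}`. -/
def Ucyl {n : ℕ} (f : ES n → ℝ) (r ρ : ℝ) : Set (ES (n + 1)) :=
  {x | ‖firstC x‖ < r ∧ f (firstC x) < lastC x ∧ lastC x < ρ}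

/-- The cylinder `T(t) = B_{N-1}(0,tr) × (-tρ, tρ)`. -/
def Tcyl (n : ℕ) (r ρ t : ℝ) : Set (ES (n + 1)) :=
  {x | ‖firstC x‖ < t * r ∧ |lastC x| < t * ρ}

/-- The graph part `∂_#U` of the boundary of `U_f(r,ρ)`. -/
def graphBdry {n : ℕ} (f : ES n → ℝ) (r ρ : ℝ) : Set (ES (n + 1)) :=
  frontier (Ucyl f r ρ) ∩ {x | ‖firstC x‖ < r ∧ lastC x = f (firstC x)}

section


def gA (t : ℝ) : ℝ := expNegInvGlue t
def gB (t : ℝ) : ℝ := (t⁻¹) ^ 2 * expNegInvGlue t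
def gC (t : ℝ) : ℝ := ((t⁻¹) ^ 4 - 2 * (t⁻¹) ^ 3) * expNegInvGlue t

lemma gA_deriv (t : ℝ) : HasDerivAt gA (gB t) t := by
  have h := expNegInvGlue.hasDerivAt_polynomial_eval_inv_mul (1 : Polynomial ℝ) t
  have e1 : gA = fun x => Polynomial.eval x⁻¹ (1 : Polynomial ℝ) * expNegInvGlue x := by
    ext x; simp [gA]
  rw [e1]
  convert h using 1
  simp [gB]

lemma gB_deriv (t : ℝ) : HasDerivAt gB (gC t) t := by
  have h := expNegInvGlue.hasDerivAt_polynomial_eval_inv_mul (Polynomial.X ^ 2 : Polynomial ℝ) t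
  have e1 : gB = fun x => Polynomial.eval x⁻¹ (Polynomial.X ^ 2 : Polynomial ℝ) * expNegInvGlue x := by
    ext x; simp [gB]
  rw [e1]
  convert h using 1
  simp only [gC, Polynomial.eval_mul, Polynomial.eval_sub, Polynomial.eval_pow, Polynomial.eval_X,
    Polynomial.derivative_X_pow, Polynomial.eval_C]
  push_cast
  ring

lemma gA_contDiff {n : ℕ∞} : ContDiff ℝ n gA := expNegInvGlue.contDiff

lemma gB_cont : Continuous gB := continuous_iff_continuousAt.2 fun t => (gB_deriv t).continuousAt

lemma gC_cont : Continuous gC := by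
  have h := expNegInvGlue.contDiff_polynomial_eval_inv_mul (n := 0)
    (Polynomial.X ^ 4 - 2 * Polynomial.X ^ 3 : Polynomial ℝ)
  have h2 := h.continuous
  convert h2 using 1
  ext x; simp [gC]

lemma gA_nonpos {t : ℝ} (h : t ≤ 0) : gA t = 0 := expNegInvGlue.zero_of_nonpos h
lemma gB_nonpos {t : ℝ} (h : t ≤ 0) : gB t = 0 := by
  simp [gB, expNegInvGlue.zero_of_nonpos h]
lemma gC_nonpos {t : ℝ} (h : t ≤ 0) : gC t = 0 := by
  simp [gC, expNegInvGlue.zero_of_nonpos h]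
lemma gA_nonneg (t : ℝ) : 0 ≤ gA t := expNegInvGlue.nonneg t
lemma gB_nonneg (t : ℝ) : 0 ≤ gB t := mul_nonneg (by positivity) (expNegInvGlue.nonneg t)
lemma gB_pos {t : ℝ} (h : 0 < t) : 0 < gB t :=
  mul_pos (by positivity) (expNegInvGlue.pos_of_pos h)

variable {N : ℕ}

def psi (ξ : ES N) : ℝ := gA (1 - ‖ξ‖ ^ 2)
def eta (ξ : ES N) : ℝ := 2 * gB (1 - ‖ξ‖ ^ 2)
def tau (ξ : ES N) : ℝ := (1 - ‖ξ‖ ^ 2) ^ 2 / 2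

lemma psi_eq (ξ : ES N) : psi ξ = tau ξ * eta ξ := by
  unfold psi eta tau
  rcases eq_or_ne (1 - ‖ξ‖ ^ 2) 0 with h | h
  · rw [h, gA_nonpos le_rfl]; simp
  · simp only [gA, gB]; field_simp

lemma eta_cont : Continuous (eta : ES N → ℝ) :=
  continuous_const.mul (gB_cont.comp (by fun_prop))
lemma psi_cont : Continuous (psi : ES N → ℝ) :=
  (gA_contDiff (n := 0)).continuous.comp (by fun_prop)
lemma tau_cont : Continuous (tau : ES N → ℝ) := by unfold tau; fun_prop
lemma eta_nonneg (ξ : ES N) : 0 ≤ eta ξ := mul_nonneg (by norm_num) (gB_nonneg _)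
lemma psi_nonneg (ξ : ES N) : 0 ≤ psi ξ := gA_nonneg _
lemma eta_zero {ξ : ES N} (h : 1 ≤ ‖ξ‖) : eta ξ = 0 := by
  unfold eta; rw [gB_nonpos (by nlinarith)]; simp
lemma psi_zero {ξ : ES N} (h : 1 ≤ ‖ξ‖) : psi ξ = 0 := by
  unfold psi; rw [gA_nonpos (by nlinarith)]
lemma eta_pos {ξ : ES N} (h : ‖ξ‖ < 1) : 0 < eta ξ := by
  have : 0 < 1 - ‖ξ‖ ^ 2 := by nlinarith [norm_nonneg ξ]
  have := gB_pos this
  unfold eta; linarith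
lemma eta_neg (ξ : ES N) : eta (-ξ) = eta ξ := by simp [eta]

lemma eta_supp : HasCompactSupport (eta : ES N → ℝ) :=
  HasCompactSupport.intro (isCompact_closedBall (0 : ES N) 1) (fun x hx => eta_zero (by
    simp at hx; exact hx.le))
lemma psi_supp : HasCompactSupport (psi : ES N → ℝ) :=
  HasCompactSupport.intro (isCompact_closedBall (0 : ES N) 1) (fun x hx => psi_zero (by
    simp at hx; exact hx.le))

lemma eta_integrable : Integrable (eta : ES N → ℝ) volume :=
  eta_cont.integrable_of_hasCompactSupport eta_supp
lemma psi_integrable : Integrable (psi : ES N → ℝ) volume :=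
  psi_cont.integrable_of_hasCompactSupport psi_supp

def ceta (N : ℕ) : ℝ := ∫ ξ : ES N, eta ξ

lemma ceta_pos : 0 < ceta N := by
  unfold ceta
  have := eta_cont (N := N)
  refine this.integral_pos_of_hasCompactSupport_nonneg_nonzero eta_supp (fun x => eta_nonneg x)
    (x := 0) ?_
  exact (eta_pos (by simp)).ne'

/-- the test function -/
def phiS (z : ES N) (s : ℝ) (x : ES N) : ℝ := gA (1 - ‖x - z‖ ^ 2 / s ^ 2)

lemma phiS_eq (z : ES N) {s : ℝ} (hs : 0 < s) (x : ES N) : phiS z s x = psi (s⁻¹ • (x - z)) := by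
  unfold phiS psi
  rw [norm_smul, mul_pow]; congr 2; simp; field_simp

def lapS (z : ES N) (s : ℝ) (x : ES N) : ℝ :=
  4 * ‖x - z‖ ^ 2 / s ^ 4 * gC (1 - ‖x - z‖ ^ 2 / s ^ 2)
    - 2 * N / s ^ 2 * gB (1 - ‖x - z‖ ^ 2 / s ^ 2)

lemma phiS_fderiv (z : ES N) (s : ℝ) (x v : ES N) :
    fderiv ℝ (phiS z s) x v = gB (1 - ‖x - z‖ ^ 2 / s ^ 2) * (-(2 * inner ℝ (x - z) v) / s ^ 2) := by
  have h1 : HasFDerivAt (fun x : ES N => ‖x - z‖ ^ 2) (2 • (innerSL ℝ (x - z))) x := by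
    have := ((hasFDerivAt_id x).sub_const z).norm_sq
    simpa using this
  have h2 : HasFDerivAt (fun x : ES N => 1 - ‖x - z‖ ^ 2 / s ^ 2)
      (-((s ^ 2)⁻¹ • (2 • (innerSL ℝ (x - z))))) x := by
    have := (h1.mul_const ((s ^ 2)⁻¹)).const_sub 1
    simpa only [div_eq_mul_inv] using this
  have h3 := (gA_deriv (1 - ‖x - z‖ ^ 2 / s ^ 2)).comp_hasFDerivAt x h2
  have h4 : HasFDerivAt (phiS z s) _ x := h3
  rw [h4.fderiv]
  simp only [smul_apply, neg_apply, innerSL_apply_apply,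
    smul_eq_mul, nsmul_eq_mul]
  push_cast
  ring

lemma phiS_lap (z : ES N) (s : ℝ) (x : ES N) : lap (phiS z s) x = lapS z s x := by
  unfold lap lapS
  have key : ∀ i : Fin N, fderiv ℝ (fun y => fderiv ℝ (phiS z s) y (EuclideanSpace.single i 1)) x
      (EuclideanSpace.single i 1) = 4 * ((x - z) i) ^ 2 / s ^ 4 * gC (1 - ‖x - z‖ ^ 2 / s ^ 2)
    - 2 / s ^ 2 * gB (1 - ‖x - z‖ ^ 2 / s ^ 2) := by
    intro i
    simp_rw [phiS_fderiv]
    have h1 : HasFDerivAt (fun x : ES N => ‖x - z‖ ^ 2) (2 • (innerSL ℝ (x - z))) x := by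
      have := ((hasFDerivAt_id x).sub_const z).norm_sq
      simpa using this
    have h2 : HasFDerivAt (fun x : ES N => 1 - ‖x - z‖ ^ 2 / s ^ 2)
        (-((s ^ 2)⁻¹ • (2 • (innerSL ℝ (x - z))))) x := by
      have := (h1.mul_const ((s ^ 2)⁻¹)).const_sub 1
      simpa only [div_eq_mul_inv] using this
    have h3' := (gB_deriv (1 - ‖x - z‖ ^ 2 / s ^ 2)).comp_hasFDerivAt x h2
    have h3 : HasFDerivAt (fun x : ES N => gB (1 - ‖x - z‖ ^ 2 / s ^ 2)) _ x := h3'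
    have h5 : HasFDerivAt (fun y : ES N => inner ℝ (y - z) (EuclideanSpace.single i (1:ℝ)))
        (innerSL ℝ (EuclideanSpace.single i (1:ℝ))) x := by
      have := (((hasFDerivAt_id x).sub_const z).inner ℝ
        (hasFDerivAt_const (EuclideanSpace.single i (1:ℝ)) x))
      refine HasFDerivAt.congr_fderiv this ?_
      ext v
      simp [fderivInnerCLM_apply, EuclideanSpace.inner_single_right,
        EuclideanSpace.inner_single_left]
    have h6 : HasFDerivAt (fun y : ES N => -(2 * inner ℝ (y - z) (EuclideanSpace.single i (1:ℝ)))
        * (s ^ 2)⁻¹) _ x := ((h5.const_mul (2:ℝ)).neg).mul_const ((s ^ 2)⁻¹)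
    have h7 := h3.mul h6
    have h8 : HasFDerivAt (fun y : ES N => gB (1 - ‖y - z‖ ^ 2 / s ^ 2) *
      (-(2 * inner ℝ (y - z) (EuclideanSpace.single i (1:ℝ))) / s ^ 2)) _ x := h7
    rw [h8.fderiv]
    simp [innerSL_apply_apply, EuclideanSpace.inner_single_right]
    ring
  simp_rw [key]
  rw [Finset.sum_sub_distrib, ← Finset.sum_mul, ← Finset.sum_div, ← Finset.mul_sum,
    EuclideanSpace.norm_sq_eq]
  simp
  ring

lemma phiS_test (Ω : Set (ES N)) (z : ES N) {s : ℝ} (hs : 0 < s) (h : closedBall z s ⊆ Ω) :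
    IsTestFun Ω (phiS z s) := by
  have hsub : tsupport (phiS z s) ⊆ closedBall z s := by
    refine closure_minimal (fun x hx => ?_) isClosed_closedBall
    by_contra hc
    apply hx
    simp [dist_eq_norm] at hc
    apply gA_nonpos
    rw [sub_nonpos, le_div_iff₀ (by positivity)]
    nlinarith
  refine ⟨?_, ?_, hsub.trans h⟩
  · have : ContDiff ℝ (⊤ : ℕ∞) (fun x : ES N => 1 - ‖x - z‖ ^ 2 / s ^ 2) :=
      contDiff_const.sub (((contDiff_id.sub contDiff_const).norm_sq ℝ).div_const _)
    exact gA_contDiff.comp this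
  · exact (isCompact_closedBall z s).of_isClosed_subset (isClosed_tsupport _) hsub

end


section


variable {N : ℕ}

lemma lapS_zero (z : ES N) {s : ℝ} (hs : 0 < s) {x : ES N} (hx : s ≤ ‖x - z‖) : lapS z s x = 0 := by
  have : 1 - ‖x - z‖ ^ 2 / s ^ 2 ≤ 0 := by
    rw [sub_nonpos, le_div_iff₀ (by positivity)]; nlinarith
  simp [lapS, gB_nonpos this, gC_nonpos this]

lemma phiS_zero (z : ES N) {s : ℝ} (hs : 0 < s) {x : ES N} (hx : s ≤ ‖x - z‖) : phiS z s x = 0 := by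
  have : 1 - ‖x - z‖ ^ 2 / s ^ 2 ≤ 0 := by
    rw [sub_nonpos, le_div_iff₀ (by positivity)]; nlinarith
  simp [phiS, gA_nonpos this]

lemma chg_var (f : ES N → ℝ) (z : ES N) {s : ℝ} (hs : 0 < s) :
    ∫ ξ : ES N, f (z + s • ξ) = (s ^ N)⁻¹ * ∫ x, f x := by
  have h1 := Measure.integral_comp_smul (volume : Measure (ES N)) (fun y => f (z + y)) s
  rw [h1]
  simp only [finrank_euclideanSpace, Fintype.card_fin, smul_eq_mul]
  rw [abs_of_pos (by positivity), integral_add_left_eq_self]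

def mS (u : ES N → ℝ) (z : ES N) (s : ℝ) : ℝ := ∫ ξ, u (z + s • ξ) * eta ξ
def eS (V u : ES N → ℝ) (z : ES N) (s : ℝ) : ℝ := ∫ ξ, V (z + s • ξ) * u (z + s • ξ) * psi ξ

lemma mS_eq (u : ES N → ℝ) (z : ES N) {s : ℝ} (hs : 0 < s) :
    mS u z s = ∫ x, u x * ((s ^ N)⁻¹ * (2 * gB (1 - ‖x - z‖ ^ 2 / s ^ 2))) := by
  have h := chg_var (fun x => u x * (2 * gB (1 - ‖x - z‖ ^ 2 / s ^ 2))) z hs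
  unfold mS
  calc _ = _ := by
        refine Eq.trans ?_ h
        refine integral_congr_ae (ae_of_all _ fun ξ => ?_)
        simp only [eta, add_sub_cancel_left, norm_smul, mul_pow]
        congr 4
        simp; field_simp
    _ = _ := by
        rw [← integral_const_mul]
        refine integral_congr_ae (ae_of_all _ fun ξ => ?_)
        simp only; ring

lemma eS_eq (V u : ES N → ℝ) (z : ES N) {s : ℝ} (hs : 0 < s) :
    eS V u z s = (s ^ N)⁻¹ * ∫ x, V x * u x * phiS z s x := by
  have h := chg_var (fun x => V x * u x * phiS z s x) z hs
  rw [← h]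
  unfold eS
  refine integral_congr_ae (ae_of_all _ fun ξ => ?_)
  simp only [psi, phiS, add_sub_cancel_left, norm_smul, mul_pow]
  congr 2
  simp; field_simp

lemma kernel_deriv (z x : ES N) {s : ℝ} (hs : 0 < s) :
    HasDerivAt (fun s : ℝ => (s ^ N)⁻¹ * (2 * gB (1 - ‖x - z‖ ^ 2 / s ^ 2)))
      ((s ^ N)⁻¹ * s * lapS z s x) s := by
  have h1 : HasDerivAt (fun s : ℝ => (s ^ N)⁻¹) (-(N * (s ^ N)⁻¹ / s)) s := by
    have := (hasDerivAt_pow N s).inv (by positivity)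
    refine this.congr_deriv ?_
    rcases N with _ | n
    · simp
    · simp only [Nat.add_sub_cancel]
      field_simp
      ring
  have h2 : HasDerivAt (fun s : ℝ => 1 - ‖x - z‖ ^ 2 / s ^ 2) (2 * ‖x - z‖ ^ 2 / s ^ 3) s := by
    have := (((hasDerivAt_pow 2 s).inv (by positivity)).const_mul (‖x - z‖ ^ 2)).const_sub 1
    simp only [div_eq_mul_inv]
    refine this.congr_deriv ?_
    simp only [Nat.cast_ofNat]
    field_simp
    norm_num
  have h3 := (gB_deriv (1 - ‖x - z‖ ^ 2 / s ^ 2)).comp s h2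
  have h4 := h1.mul (h3.const_mul 2)
  have h5 : HasDerivAt (fun s : ℝ => (s ^ N)⁻¹ * (2 * gB (1 - ‖x - z‖ ^ 2 / s ^ 2))) _ s := h4
  refine h5.congr_deriv ?_
  simp only [lapS, Function.comp]
  field_simp
  ring

lemma mS_deriv {Ω : Set (ES N)} {V u : ES N → ℝ} (hu : LVHarmonic Ω V u) {z : ES N} {s s1 : ℝ}
    (hs : 0 < s) (hs1 : s < s1) (hb : closedBall z s1 ⊆ Ω) :
    HasDerivAt (mS u z) (s * eS V u z s) s := by
  obtain ⟨hc, -, -, hw⟩ := hu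
  set u1 := (closedBall z s1).indicator u with hu1
  have hcb : ContinuousOn u (closedBall z s1) := hc.mono hb
  have hui : Integrable u1 volume := by
    rw [hu1, integrable_indicator_iff isClosed_closedBall.measurableSet]
    exact hcb.integrableOn_compact (isCompact_closedBall z s1)
  have hco : ContinuousOn (fun p : ℝ × ES N => (p.1 ^ N)⁻¹ * p.1 * lapS z p.1 p.2)
      (Icc (s / 2) s1 ×ˢ closedBall z s1) := by
    unfold lapS
    have hne : ∀ p ∈ Icc (s / 2) s1 ×ˢ closedBall z s1, p.1 ≠ 0 := by
      rintro p ⟨hp, -⟩; have := hp.1; intro h; linarith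
    have c1 : ContinuousOn (fun p : ℝ × ES N => 1 - ‖p.2 - z‖ ^ 2 / p.1 ^ 2)
      (Icc (s / 2) s1 ×ˢ closedBall z s1) := by
      refine continuousOn_const.sub (ContinuousOn.div (by fun_prop) (by fun_prop) ?_)
      intro p hp; exact pow_ne_zero _ (hne p hp)
    refine ContinuousOn.mul (ContinuousOn.mul (ContinuousOn.inv₀ (by fun_prop) ?_) (by fun_prop))
      (ContinuousOn.sub (ContinuousOn.mul (ContinuousOn.div (by fun_prop) (by fun_prop) ?_)
        (gC_cont.comp_continuousOn c1)) (ContinuousOn.mul (ContinuousOn.div (by fun_prop) (by fun_prop) ?_)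
        (gB_cont.comp_continuousOn c1)))
    all_goals intro p hp; exact pow_ne_zero _ (hne p hp)
  obtain ⟨C, hC⟩ := (isCompact_Icc.prod (isCompact_closedBall z s1)).exists_bound_of_continuousOn hco
  have hdom := hasDerivAt_integral_of_dominated_loc_of_deriv_le (μ := (volume : Measure (ES N)))
    (F := fun s x => u1 x * ((s ^ N)⁻¹ * (2 * gB (1 - ‖x - z‖ ^ 2 / s ^ 2))))
    (F' := fun s x => u1 x * ((s ^ N)⁻¹ * s * lapS z s x))
    (bound := fun x => ‖u1 x‖ * C) (s := Ioo (s / 2) s1) (x₀ := s)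
    (Ioo_mem_nhds (by linarith) hs1) ?_ ?_ ?_ ?_ (hui.norm.mul_const C) ?_
  · have hd := hdom.2
    have e1 : (fun s : ℝ => ∫ x, u1 x * ((s ^ N)⁻¹ * (2 * gB (1 - ‖x - z‖ ^ 2 / s ^ 2)))) =ᶠ[𝓝 s]
        mS u z := by
      filter_upwards [Ioo_mem_nhds hs hs1] with t ht
      rw [mS_eq u z ht.1]
      refine integral_congr_ae (ae_of_all _ fun x => ?_)
      by_cases hx : x ∈ closedBall z s1
      · simp [hu1, hx]
      · have : 1 - ‖x - z‖ ^ 2 / t ^ 2 ≤ 0 := by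
          simp [dist_eq_norm] at hx
          have := ht.1; have := ht.2
          rw [sub_nonpos, le_div_iff₀ (by positivity)]; nlinarith
        simp [gB_nonpos this]
    have hd2 := hd.congr_of_eventuallyEq e1.symm
    refine hd2.congr_deriv ?_
    have hbs : closedBall z s ⊆ Ω := (closedBall_subset_closedBall hs1.le).trans hb
    have hw' := hw _ (phiS_test Ω z hs hbs)
    rw [eS_eq V u z hs]
    have e2 : ∫ x, u1 x * ((s ^ N)⁻¹ * s * lapS z s x) =
        (s ^ N)⁻¹ * s * ∫ x in Ω, u x * lap (phiS z s) x := by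
      rw [← integral_const_mul, setIntegral_eq_integral_of_forall_compl_eq_zero]
      · refine integral_congr_ae (ae_of_all _ fun x => ?_)
        simp only [phiS_lap]
        by_cases hx : x ∈ closedBall z s1
        · simp [hu1, hx]; ring
        · have : lapS z s x = 0 := lapS_zero z hs (by simp [dist_eq_norm] at hx; linarith)
          simp [this]
      · intro x hx
        have : lapS z s x = 0 := lapS_zero z hs (by
          by_contra hcon; apply hx; apply hbs; simp [dist_eq_norm]; linarith)
        simp [phiS_lap, this]
    rw [e2, hw', setIntegral_eq_integral_of_forall_compl_eq_zero]
    · ring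
    · intro x hx
      have : phiS z s x = 0 := phiS_zero z hs (by
          by_contra hcon; apply hx; apply hbs; simp [dist_eq_norm]; linarith)
      simp [this]
  · refine Eventually.of_forall fun t => hui.aestronglyMeasurable.mul ?_
    refine Continuous.aestronglyMeasurable ?_
    exact continuous_const.mul (continuous_const.mul (gB_cont.comp (by fun_prop)))
  · have hcont : Continuous (fun x : ES N => (s ^ N)⁻¹ * (2 * gB (1 - ‖x - z‖ ^ 2 / s ^ 2))) :=
      continuous_const.mul (continuous_const.mul (gB_cont.comp (by fun_prop)))
    obtain ⟨C', hC'⟩ := (isCompact_closedBall z s1).exists_bound_of_continuousOn hcont.continuousOn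
    refine (hui.norm.mul_const C').mono' (hui.aestronglyMeasurable.mul hcont.aestronglyMeasurable) ?_
    refine ae_of_all _ fun x => ?_
    rw [norm_mul]
    by_cases hx : x ∈ closedBall z s1
    · exact mul_le_mul_of_nonneg_left (hC' x hx) (norm_nonneg _)
    · simp [hu1, hx]
  · refine hui.aestronglyMeasurable.mul (Continuous.aestronglyMeasurable ?_)
    unfold lapS
    exact continuous_const.mul (Continuous.sub (Continuous.mul (by fun_prop) (gC_cont.comp (by fun_prop)))
      (Continuous.mul (by fun_prop) (gB_cont.comp (by fun_prop))))
  · refine ae_of_all _ fun x t ht => ?_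
    rw [norm_mul]
    by_cases hx : x ∈ closedBall z s1
    · exact mul_le_mul_of_nonneg_left (hC (t, x) ⟨⟨ht.1.le, ht.2.le⟩, hx⟩) (norm_nonneg _)
    · simp [hu1, hx]
  · refine ae_of_all _ fun x t ht => ?_
    exact (kernel_deriv z x (by linarith [ht.1])).const_mul _

end


section


variable {N : ℕ}

def nuE (N : ℕ) : Measure (ES N) := volume.withDensity (fun ξ => ENNReal.ofReal (eta ξ / ceta N))

lemma etac_meas : Measurable (fun ξ : ES N => eta ξ / ceta N) :=
  (eta_cont.div_const _).measurable

instance : IsProbabilityMeasure (nuE N) := by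
  constructor
  unfold nuE
  rw [withDensity_apply _ MeasurableSet.univ, Measure.restrict_univ,
    ← ofReal_integral_eq_lintegral_ofReal (eta_integrable.div_const _)
      (ae_of_all _ fun x => div_nonneg (eta_nonneg x) ceta_pos.le)]
  rw [integral_div]
  have : (∫ ξ : ES N, eta ξ) / ceta N = 1 := div_self ceta_pos.ne'
  rw [this]; simp

def mm (N : ℕ) : Measure (ℝ × ES N) := (volume.restrict (Ioc (0:ℝ) 1)).prod (nuE N)

instance : IsProbabilityMeasure (volume.restrict (Ioc (0:ℝ) 1)) := ⟨by simp⟩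

instance : IsProbabilityMeasure (mm N) := by unfold mm; infer_instance

lemma nuE_integral (f : ES N → ℝ) : ∫ ξ, f ξ ∂(nuE N) = (ceta N)⁻¹ * ∫ ξ, f ξ * eta ξ := by
  unfold nuE
  have : (fun ξ : ES N => ENNReal.ofReal (eta ξ / ceta N)) =
      fun ξ => ((Real.toNNReal (eta ξ / ceta N) : ℝ≥0) : ℝ≥0∞) := rfl
  rw [this, integral_withDensity_eq_integral_smul (etac_meas.real_toNNReal), ← integral_const_mul]
  refine integral_congr_ae (ae_of_all _ fun ξ => ?_)
  simp only [NNReal.smul_def, smul_eq_mul]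
  rw [Real.coe_toNNReal _ (div_nonneg (eta_nonneg ξ) ceta_pos.le)]
  ring

lemma nuE_ae : ∀ᵐ ξ ∂(nuE N), ‖ξ‖ < 1 := by
  unfold nuE
  rw [ae_withDensity_iff etac_meas.ennreal_ofReal]
  refine ae_of_all _ fun ξ h => ?_
  by_contra hc
  push Not at hc
  rw [eta_zero hc] at h
  simp at h

lemma mm_ae : ∀ᵐ ω ∂(mm N), (0 < ω.1 ∧ ω.1 ≤ 1) ∧ ‖ω.2‖ < 1 := by
  unfold mm
  have h1 : ∀ᵐ ω ∂((volume.restrict (Ioc (0:ℝ) 1)).prod (nuE N)), ω.1 ∈ Ioc (0:ℝ) 1 :=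
    Measure.quasiMeasurePreserving_fst.ae (ae_restrict_mem measurableSet_Ioc)
  have h2 : ∀ᵐ ω ∂((volume.restrict (Ioc (0:ℝ) 1)).prod (nuE N)), ‖ω.2‖ < 1 :=
    Measure.quasiMeasurePreserving_snd.ae nuE_ae
  filter_upwards [h1, h2] with ω a b
  exact ⟨a, b⟩

lemma mm_integral {f : ℝ × ES N → ℝ} (hf : Integrable f (mm N)) :
    ∫ ω, f ω ∂(mm N) = ∫ σ in Ioc (0:ℝ) 1, (ceta N)⁻¹ * ∫ ξ, f (σ, ξ) * eta ξ := by
  unfold mm at hf ⊢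
  rw [integral_prod _ hf]
  simp_rw [nuE_integral]

lemma mS_zero (u : ES N → ℝ) (z : ES N) : mS u z 0 = ceta N * u z := by
  simp [mS, integral_const_mul, ceta, mul_comm]

lemma mS_cont0 {Ω : Set (ES N)} {u : ES N → ℝ} (hc : ContinuousOn u Ω) (hum : Measurable u)
    {z : ES N} {s1 : ℝ} (hs : 0 < s1) (hb : closedBall z s1 ⊆ Ω) :
    ContinuousWithinAt (mS u z) (Ici 0) 0 := by
  obtain ⟨C, hC⟩ := (isCompact_closedBall z s1).exists_bound_of_continuousOn (hc.mono hb)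
  unfold ContinuousWithinAt mS
  have hC0 : 0 ≤ C := (norm_nonneg _).trans (hC z (mem_closedBall_self hs.le))
  refine tendsto_integral_filter_of_dominated_convergence (fun ξ => C * eta ξ) ?_ ?_
    (eta_integrable.const_mul C) ?_
  · refine Eventually.of_forall fun s => Measurable.aestronglyMeasurable ?_
    exact (hum.comp (by fun_prop)).mul eta_cont.measurable
  · have : ∀ᶠ s in 𝓝[Ici 0] (0:ℝ), s ∈ Icc 0 s1 := by
      exact Icc_mem_nhdsGE hs
    filter_upwards [this] with s hs'
    refine ae_of_all _ fun ξ => ?_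
    rw [norm_mul, Real.norm_of_nonneg (eta_nonneg ξ)]
    rcases le_or_gt 1 ‖ξ‖ with h | h
    · simp [eta_zero h]
    · refine mul_le_mul_of_nonneg_right (hC _ ?_) (eta_nonneg _)
      simp only [mem_closedBall, dist_eq_norm, add_sub_cancel_left, norm_smul,
        Real.norm_of_nonneg hs'.1]
      nlinarith [hs'.1, hs'.2, norm_nonneg ξ]
  · refine ae_of_all _ fun ξ => ?_
    refine Tendsto.mul_const _ ?_
    have hcz : ContinuousAt u z :=
      hc.continuousAt (mem_of_superset (closedBall_mem_nhds z hs) hb)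
    have : Tendsto (fun s : ℝ => z + s • ξ) (𝓝[Ici 0] 0) (𝓝 (z + (0:ℝ) • ξ)) := by
      have : Continuous (fun s : ℝ => z + s • ξ) := by fun_prop
      exact (this.tendsto 0).mono_left nhdsWithin_le_nhds
    simp only [zero_smul, add_zero] at this ⊢
    exact hcz.tendsto.comp this

end


section


variable {N : ℕ}

lemma tau_bd {ξ : ES N} (h : ‖ξ‖ < 1) : 0 ≤ tau ξ ∧ tau ξ ≤ 1 / 2 := by
  unfold tau
  have h1 : 0 ≤ 1 - ‖ξ‖ ^ 2 := by nlinarith [norm_nonneg ξ]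
  have h2 : 1 - ‖ξ‖ ^ 2 ≤ 1 := by nlinarith [norm_nonneg ξ]
  constructor
  · positivity
  · have : (1 - ‖ξ‖ ^ 2) ^ 2 ≤ 1 := by nlinarith
    linarith

lemma zmem {z ξ : ES N} {R σ : ℝ} (hR : 0 ≤ R) (h0 : 0 < σ) (h1 : σ ≤ 1) (h : ‖ξ‖ < 1) :
    z + R • σ • ξ ∈ closedBall z R := by
  simp only [mem_closedBall, dist_eq_norm, add_sub_cancel_left, norm_smul,
    Real.norm_of_nonneg hR, Real.norm_of_nonneg h0.le]
  have : σ * ‖ξ‖ ≤ 1 := by nlinarith [norm_nonneg ξ]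
  nlinarith

lemma mean_formula {Ω : Set (ES N)} {V u : ES N → ℝ} (hu : LVHarmonic Ω V u) (hum : Measurable u)
    (hVm : Measurable V) {z : ES N} {R s1 B : ℝ} (hR : 0 < R) (hs1 : R < s1)
    (hb : closedBall z s1 ⊆ Ω) (hB : ∀ x ∈ closedBall z R, |V x| ≤ B) :
    u z = ∫ ω, u (z + R • ω.1 • ω.2) *
      (1 - (1 - ω.1) * ω.1 * R ^ 2 * V (z + R • ω.1 • ω.2) * tau ω.2) ∂(mm N) := by
  have hc := hu.1
  have hbR : closedBall z R ⊆ Ω := (closedBall_subset_closedBall hs1.le).trans hb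
  obtain ⟨C, hC⟩ := (isCompact_closedBall z R).exists_bound_of_continuousOn (hc.mono hbR)
  have hzR : z ∈ closedBall z R := mem_closedBall_self hR.le
  have hC0 : 0 ≤ C := (norm_nonneg _).trans (hC z hzR)
  have hB0 : 0 ≤ B := (abs_nonneg _).trans (hB z hzR)
  set f : ℝ × ES N → ℝ := fun ω => u (z + R • ω.1 • ω.2) *
      (1 - (1 - ω.1) * ω.1 * R ^ 2 * V (z + R • ω.1 • ω.2) * tau ω.2) with hf
  have hfm : Measurable f := by
    have m1 : Measurable (fun ω : ℝ × ES N => z + R • ω.1 • ω.2) := by fun_prop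
    have m2 : Measurable (fun ω : ℝ × ES N => tau ω.2) := tau_cont.measurable.comp measurable_snd
    have m3 := hum.comp m1
    have m4 := hVm.comp m1
    exact m3.mul (measurable_const.sub (((by fun_prop : Measurable (fun ω : ℝ × ES N =>
      (1 - ω.1) * ω.1 * R ^ 2)).mul m4).mul m2))
  have hfi : Integrable f (mm N) := by
    refine Integrable.mono' (integrable_const (C * (1 + R ^ 2 * B))) hfm.aestronglyMeasurable ?_
    filter_upwards [mm_ae] with ω hω
    have hz := zmem (z := z) hR.le hω.1.1 hω.1.2 hω.2
    rw [hf]; simp only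
    rw [norm_mul]
    refine mul_le_mul (hC _ hz) ?_ (norm_nonneg _) hC0
    have hV := hB _ hz
    obtain ⟨t0, t1⟩ := tau_bd hω.2
    have a0 : 0 ≤ (1 - ω.1) * ω.1 := mul_nonneg (by linarith [hω.1.2]) hω.1.1.le
    have a1 : (1 - ω.1) * ω.1 ≤ 1 := by nlinarith [hω.1.1, hω.1.2]
    calc _ ≤ ‖(1:ℝ)‖ + ‖(1 - ω.1) * ω.1 * R ^ 2 * V (z + R • ω.1 • ω.2) * tau ω.2‖ := norm_sub_le _ _
      _ ≤ 1 + R ^ 2 * B := by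
        rw [norm_one, norm_mul, norm_mul, norm_mul, Real.norm_of_nonneg a0, Real.norm_of_nonneg t0,
          Real.norm_of_nonneg (by positivity : 0 ≤ R ^ 2)]
        have hV' : ‖V (z + R • ω.1 • ω.2)‖ ≤ B := hV
        have b1 : (1 - ω.1) * ω.1 * R ^ 2 * ‖V (z + R • ω.1 • ω.2)‖ ≤ 1 * R ^ 2 * B :=
          mul_le_mul (mul_le_mul_of_nonneg_right a1 (by positivity)) hV' (norm_nonneg _) (by positivity)
        have b2 := mul_le_mul b1 (t1.trans (by norm_num : (1:ℝ) / 2 ≤ 1)) t0 (by positivity)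
        linarith
  rw [mm_integral hfi]
  have hinn : ∀ σ ∈ Ioc (0:ℝ) 1, ∫ ξ, f (σ, ξ) * eta ξ =
      mS u z (R * σ) - (1 - σ) * (R * (R * σ * eS V u z (R * σ))) := by
    intro σ hσ
    have e : ∀ ξ, f (σ, ξ) * eta ξ = u (z + (R * σ) • ξ) * eta ξ - ((1 - σ) * (R * (R * σ))) *
        (V (z + (R * σ) • ξ) * u (z + (R * σ) • ξ) * psi ξ) := by
      intro ξ
      simp only [hf, psi_eq, smul_smul]; ring
    simp_rw [e]
    have mz : Measurable (fun ξ : ES N => z + (R * σ) • ξ) := by fun_prop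
    have hin : ∀ ξ : ES N, ‖ξ‖ < 1 → z + (R * σ) • ξ ∈ closedBall z R := by
      intro ξ h
      have := zmem (z := z) hR.le hσ.1 hσ.2 h
      rwa [smul_smul] at this
    rw [integral_sub, integral_const_mul]
    · simp only [mS, eS]; ring
    · refine (eta_integrable.const_mul C).mono' ((hum.comp mz).mul eta_cont.measurable).aestronglyMeasurable
        (ae_of_all _ fun ξ => ?_)
      rw [norm_mul, Real.norm_of_nonneg (eta_nonneg ξ)]
      rcases le_or_gt 1 ‖ξ‖ with h | h
      · simp [eta_zero h]
      · exact mul_le_mul_of_nonneg_right (hC _ (hin ξ h)) (eta_nonneg _)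
    · refine Integrable.const_mul ?_ _
      refine (psi_integrable.const_mul (B * C)).mono'
        (((hVm.comp mz).mul (hum.comp mz)).mul psi_cont.measurable).aestronglyMeasurable
        (ae_of_all _ fun ξ => ?_)
      rw [norm_mul, Real.norm_of_nonneg (psi_nonneg ξ), norm_mul]
      rcases le_or_gt 1 ‖ξ‖ with h | h
      · simp [psi_zero h]
      · refine mul_le_mul_of_nonneg_right ?_ (psi_nonneg _)
        exact mul_le_mul (hB _ (hin ξ h)) (hC _ (hin ξ h)) (norm_nonneg _) hB0
  have hintg : IntegrableOn (fun σ => mS u z (R * σ) - (1 - σ) * (R * (R * σ * eS V u z (R * σ))))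
      (Ioc (0:ℝ) 1) := by
    have h1 : Integrable (fun σ => ∫ ξ, f (σ, ξ) ∂(nuE N)) (volume.restrict (Ioc (0:ℝ) 1)) :=
      Integrable.integral_prod_left hfi
    have h2 := h1.const_mul (ceta N)
    refine h2.congr ?_
    filter_upwards [ae_restrict_mem measurableSet_Ioc] with σ hσ
    rw [nuE_integral, hinn σ hσ]
    field_simp [(ceta_pos (N := N)).ne']
  have hftc := intervalIntegral.integral_eq_sub_of_hasDerivAt_of_le (a := (0:ℝ)) (b := 1)
    (f := fun σ => (1 - σ) * mS u z (R * σ))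
    (f' := fun σ => -(mS u z (R * σ) - (1 - σ) * (R * (R * σ * eS V u z (R * σ))))) zero_le_one ?_ ?_ ?_
  · rw [intervalIntegral.integral_of_le zero_le_one, integral_neg] at hftc
    rw [integral_const_mul, setIntegral_congr_fun measurableSet_Ioc (fun σ hσ => hinn σ hσ)]
    simp only [sub_self, zero_mul, sub_zero, mul_zero, one_mul, mS_zero, zero_sub, neg_inj] at hftc
    rw [hftc]
    field_simp [(ceta_pos (N := N)).ne']
  · intro σ hσ
    rcases eq_or_lt_of_le hσ.1 with h | h
    · subst h
      refine ContinuousWithinAt.mul (by fun_prop) ?_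
      have := mS_cont0 hc hum (hR.trans hs1) hb
      refine ContinuousWithinAt.comp (t := Ici 0) (g := mS u z) (f := fun σ => R * σ) ?_ (by fun_prop) ?_
      · simpa using this
      · intro t ht; exact mul_nonneg hR.le ht.1
    · have hd := mS_deriv hu (mul_pos hR h) (by nlinarith [hσ.2] : R * σ < s1) hb
      have : ContinuousAt (fun σ => mS u z (R * σ)) σ :=
        ContinuousAt.comp (f := fun σ => R * σ) (g := mS u z) hd.continuousAt (by fun_prop)
      exact ContinuousAt.continuousWithinAt (by fun_prop)
  · intro σ hσ
    have hd := mS_deriv hu (mul_pos hR hσ.1) (by nlinarith [hσ.2] : R * σ < s1) hb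
    have h1 : HasDerivAt (fun σ : ℝ => R * σ) R σ := by
      simpa using (hasDerivAt_id σ).const_mul R
    have h2 : HasDerivAt (fun σ => mS u z (R * σ)) _ σ :=
      HasDerivAt.comp (h₂ := mS u z) (h := fun σ => R * σ) σ hd h1
    have h3 := ((hasDerivAt_id σ).const_sub 1).mul h2
    refine h3.congr_deriv ?_
    simp only [id]; ring
  · rw [intervalIntegrable_iff_integrableOn_Ioc_of_le zero_le_one]
    exact hintg.neg

/-- local bound by means -/
lemma exists_H2 (N : ℕ) : ∃ C2 : ℝ, 0 < C2 ∧ ∀ (Ω : Set (ES N)) (V u : ES N → ℝ),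
    LVHarmonic Ω V u → Measurable u → (∀ x ∈ Ω, 0 ≤ V x) → ∀ (z : ES N) (s s1 : ℝ), 0 < s →
    s < s1 → closedBall z s1 ⊆ Ω → (∀ x ∈ ball z s, 0 ≤ u x) →
    u z ≤ C2 * ((s ^ N)⁻¹ * ∫ x in ball z s, u x) := by
  obtain ⟨C, hC⟩ := (isCompact_closedBall (0 : ES N) 1).exists_bound_of_continuousOn
    (eta_cont (N := N)).continuousOn
  have hCall : ∀ ξ : ES N, eta ξ ≤ C := by
    intro ξ
    have hC0 : 0 ≤ C := (norm_nonneg _).trans (hC 0 (by simp))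
    rcases le_or_gt 1 ‖ξ‖ with h | h
    · rw [eta_zero h]; exact hC0
    · exact (le_abs_self _).trans (hC ξ (by simp [h.le]))
  have hCp : 0 < C := lt_of_lt_of_le (eta_pos (ξ := (0 : ES N)) (by simp)) (hCall 0)
  refine ⟨C / ceta N, div_pos hCp ceta_pos, ?_⟩
  intro Ω V u hu hum hV z s s1 hs hs1 hb hpos
  have hmono : mS u z 0 ≤ mS u z s := by
    have hcont : ContinuousOn (mS u z) (Icc 0 s) := by
      intro t ht
      rcases eq_or_lt_of_le ht.1 with h | h
      · subst h
        exact (mS_cont0 hu.1 hum (hs.trans hs1) hb).mono (fun x hx => hx.1)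
      · exact (mS_deriv hu h (lt_of_le_of_lt ht.2 hs1) hb).continuousAt.continuousWithinAt
    refine monotoneOn_of_deriv_nonneg (convex_Icc 0 s) hcont ?_ ?_ (left_mem_Icc.2 hs.le)
      (right_mem_Icc.2 hs.le) hs.le
    · intro t ht
      rw [interior_Icc] at ht
      exact (mS_deriv hu ht.1 (ht.2.trans hs1) hb).differentiableAt.differentiableWithinAt
    · intro t ht
      rw [interior_Icc] at ht
      rw [(mS_deriv hu ht.1 (ht.2.trans hs1) hb).deriv]
      refine mul_nonneg ht.1.le (integral_nonneg fun ξ => ?_)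
      simp only [Pi.zero_apply]
      rcases le_or_gt 1 ‖ξ‖ with h | h
      · simp [psi_zero h]
      · have hin : z + t • ξ ∈ ball z s := by
          simp only [mem_ball, dist_eq_norm, add_sub_cancel_left, norm_smul,
            Real.norm_of_nonneg ht.1.le]
          nlinarith [ht.1, ht.2, norm_nonneg ξ]
        refine mul_nonneg (mul_nonneg (hV _ (hb ?_)) (hpos _ hin)) (psi_nonneg _)
        exact ball_subset_closedBall (ball_subset_ball hs1.le hin)
  rw [mS_zero, mS_eq u z hs] at hmono
  have hui : IntegrableOn u (ball z s) := by
    have : IntegrableOn u (closedBall z s) := (hu.1.mono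
      ((closedBall_subset_closedBall hs1.le).trans hb)).integrableOn_compact (isCompact_closedBall z s)
    exact this.mono_set ball_subset_closedBall
  have h2 : ∫ x, u x * ((s ^ N)⁻¹ * (2 * gB (1 - ‖x - z‖ ^ 2 / s ^ 2))) ≤
      C * ((s ^ N)⁻¹ * ∫ x in ball z s, u x) := by
    rw [← mul_assoc, ← integral_const_mul]
    have hz : ∀ x, x ∉ ball z s → u x * ((s ^ N)⁻¹ * (2 * gB (1 - ‖x - z‖ ^ 2 / s ^ 2))) = 0 := by
      intro x hx
      have : 1 - ‖x - z‖ ^ 2 / s ^ 2 ≤ 0 := by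
        simp [dist_eq_norm] at hx
        rw [sub_nonpos, le_div_iff₀ (by positivity)]; nlinarith
      simp [gB_nonpos this]
    rw [← setIntegral_eq_integral_of_forall_compl_eq_zero hz]
    have hgb : ∀ x : ES N, 2 * gB (1 - ‖x - z‖ ^ 2 / s ^ 2) ≤ C := by
      intro x
      have := hCall (s⁻¹ • (x - z))
      unfold eta at this
      convert this using 4
      rw [norm_smul, mul_pow]; simp; field_simp
    have hle : ∀ x ∈ ball z s, u x * ((s ^ N)⁻¹ * (2 * gB (1 - ‖x - z‖ ^ 2 / s ^ 2))) ≤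
        C * (s ^ N)⁻¹ * u x := by
      intro x hx
      have h1 := mul_le_mul_of_nonneg_left (hgb x) (mul_nonneg (hpos x hx)
        (by positivity : 0 ≤ (s ^ N)⁻¹))
      linarith
    refine setIntegral_mono_on ?_ (hui.const_mul _) measurableSet_ball hle
    refine (hui.const_mul (C * (s ^ N)⁻¹)).mono' ?_ ?_
    · refine (hum.mul ?_).aestronglyMeasurable
      exact measurable_const.mul (measurable_const.mul (gB_cont.measurable.comp (by fun_prop)))
    · filter_upwards [ae_restrict_mem measurableSet_ball] with x hx
      rw [Real.norm_of_nonneg (mul_nonneg (hpos x hx) (mul_nonneg (by positivity)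
        (mul_nonneg (by norm_num) (gB_nonneg _))))]
      exact hle x hx
  rw [div_mul_eq_mul_div, le_div_iff₀ ceta_pos]
  linarith

end


section


variable {N : ℕ}

def YY (ω : ℝ × ES N) : ES N := ω.1 • ω.2

lemma YY_meas : Measurable (YY : ℝ × ES N → ES N) := by unfold YY; fun_prop

lemma YY_norm : ∀ᵐ ω ∂(mm N), ‖YY ω‖ < 1 := by
  filter_upwards [mm_ae] with ω hω
  unfold YY
  rw [norm_smul, Real.norm_of_nonneg hω.1.1.le]
  nlinarith [hω.1.1, hω.1.2, hω.2, norm_nonneg ω.2]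

lemma nuE_neg : MeasurePreserving (fun ξ : ES N => -ξ) (nuE N) (nuE N) := by
  refine ⟨measurable_neg, ?_⟩
  ext s hs
  rw [Measure.map_apply measurable_neg hs]
  unfold nuE
  rw [withDensity_apply _ hs, withDensity_apply _ (measurable_neg hs),
    ← lintegral_indicator hs, ← lintegral_indicator (measurable_neg hs)]
  rw [← lintegral_neg_eq_self]
  congr 1; ext ξ
  simp only [indicator, eta_neg]
  have h1 : (-ξ ∈ Neg.neg ⁻¹' s) ↔ ξ ∈ s := by rw [mem_preimage, neg_neg]
  by_cases h2 : ξ ∈ s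
  · rw [if_pos h2, if_pos (h1.2 h2)]
  · rw [if_neg h2, if_neg (fun h => h2 (h1.1 h))]

def sgn (ω : ℝ × ES N) : ℝ × ES N := (ω.1, -ω.2)

lemma mm_neg : MeasurePreserving (sgn : ℝ × ES N → ℝ × ES N) (mm N) (mm N) := by
  have := (MeasurePreserving.id (volume.restrict (Ioc (0:ℝ) 1))).prod (nuE_neg (N := N))
  exact this

lemma mm_symm (F : ES N → ℝ) : ∫ ω, F (-YY ω) ∂(mm N) = ∫ ω, F (YY ω) ∂(mm N) := by
  have hme : MeasurableEmbedding (sgn : ℝ × ES N → ℝ × ES N) :=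
    ((MeasurableEquiv.refl ℝ).prodCongr (MeasurableEquiv.neg (ES N))).measurableEmbedding
  have := mm_neg.integral_comp hme (fun ω => F (YY ω))
  rw [← this]
  congr 1; ext ω; simp [YY, sgn]

lemma exists_c0 (N : ℕ) : ∃ c0 : ℝ, 0 < c0 ∧
    ENNReal.ofReal c0 • (volume.restrict (ball (0 : ES N) (1/4))) ≤ (mm N).map YY := by
  obtain ⟨ξ0, hξ0, hmin⟩ := (isCompact_closedBall (0 : ES N) (1/2)).exists_isMinOn
    ⟨0, by simp⟩ (eta_cont (N := N)).continuousOn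
  have he0 : 0 < eta ξ0 / ceta N :=
    div_pos (eta_pos (by simp at hξ0; linarith)) ceta_pos
  refine ⟨eta ξ0 / ceta N / 2, by positivity, ?_⟩
  set e0 := eta ξ0 / ceta N with he
  have hnu : ∀ A : Set (ES N), MeasurableSet A → A ⊆ ball 0 (1/2) →
      ENNReal.ofReal e0 * volume A ≤ nuE N A := by
    intro A hA hAs
    unfold nuE
    rw [withDensity_apply _ hA, ← setLIntegral_const]
    refine setLIntegral_mono' hA fun x hx => ?_
    refine ENNReal.ofReal_le_ofReal ?_
    exact div_le_div_of_nonneg_right (hmin (ball_subset_closedBall (hAs hx))) ceta_pos.le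
  refine Measure.le_iff.2 fun s hs => ?_
  rw [Measure.map_apply YY_meas hs, Measure.smul_apply, Measure.restrict_apply hs]
  unfold mm
  rw [Measure.prod_apply (YY_meas hs)]
  set A := s ∩ ball (0 : ES N) (1/4) with hA
  have hAm : MeasurableSet A := hs.inter measurableSet_ball
  calc ENNReal.ofReal (e0 / 2) • volume A = ∫⁻ σ in Ioc (1/2:ℝ) 1, ENNReal.ofReal e0 * volume A := by
        rw [setLIntegral_const, Real.volume_Ioc, smul_eq_mul, mul_right_comm, ← ENNReal.ofReal_mul he0.le]
        congr 2; ring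
    _ ≤ ∫⁻ σ in Ioc (1/2:ℝ) 1, nuE N (Prod.mk σ ⁻¹' (YY ⁻¹' s)) := by
        refine setLIntegral_mono' measurableSet_Ioc fun σ hσ => ?_
        have hσ0 : 0 < σ := by linarith [hσ.1]
        have h1 : volume A ≤ volume ((fun ξ : ES N => σ • ξ) ⁻¹' A) := by
          rw [Measure.addHaar_preimage_smul _ hσ0.ne']
          refine le_mul_of_one_le_left' ?_
          rw [ENNReal.one_le_ofReal, abs_of_pos (by positivity)]
          exact (one_le_inv₀ (by positivity)).2 (pow_le_one₀ hσ0.le hσ.2)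
        have hm : MeasurableSet ((fun ξ : ES N => σ • ξ) ⁻¹' A) := (measurable_const_smul σ) hAm
        calc _ ≤ ENNReal.ofReal e0 * volume ((fun ξ : ES N => σ • ξ) ⁻¹' A) := by gcongr
          _ ≤ nuE N ((fun ξ : ES N => σ • ξ) ⁻¹' A) := by
            refine hnu _ hm ?_
            intro ξ hξ
            have := hξ.2
            simp only [mem_ball, dist_zero_right, norm_smul, Real.norm_of_nonneg hσ0.le] at this ⊢
            by_contra hcon
            push Not at hcon
            nlinarith [hσ.1]
          _ ≤ _ := measure_mono fun ξ hξ => hξ.1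
    _ ≤ _ := lintegral_mono_set (Ioc_subset_Ioc_left (by norm_num))

/-- volume of the unit ball -/
def vN (N : ℕ) : ℝ := (volume (ball (0 : ES N) 1)).toReal

lemma vN_pos : 0 < vN N :=
  ENNReal.toReal_pos (measure_ball_pos _ _ one_pos).ne' measure_ball_lt_top.ne

lemma vol_ball (x : ES N) {s : ℝ} (hs : 0 < s) : (volume (ball x s)).toReal = s ^ N * vN N := by
  rw [Measure.addHaar_ball_of_pos _ _ hs, ENNReal.toReal_mul]
  simp only [finrank_euclideanSpace, Fintype.card_fin]
  rw [ENNReal.toReal_ofReal (by positivity)]; rfl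

lemma exists_k1 (N : ℕ) : ∃ k1 : ℝ, 0 < k1 ∧ k1 ≤ 1 ∧ ∀ e : ES N, ‖e‖ = 1 →
    k1 ≤ ∫ ω, (inner ℝ e (YY ω)) ^ 2 ∂(mm N) := by
  obtain ⟨c0, hc0, hle⟩ := exists_c0 N
  set k := c0 * ((1/16:ℝ)^2 * ((1/16) ^ N * vN N)) with hk
  have hkp : 0 < k := by have := vN_pos (N := N); positivity
  refine ⟨min k 1, by positivity, min_le_right _ _, ?_⟩
  intro e he
  refine (min_le_left _ _).trans ?_
  have hF : Continuous (fun y : ES N => (inner ℝ e y) ^ 2) := by fun_prop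
  have hae : ∀ᵐ y ∂((mm N).map YY), ‖y‖ < 1 :=
    (ae_map_iff YY_meas.aemeasurable (measurableSet_lt measurable_norm measurable_const)).2 YY_norm
  have : IsProbabilityMeasure ((mm N).map YY) := Measure.isProbabilityMeasure_map YY_meas.aemeasurable
  have hintg : Integrable (fun y : ES N => (inner ℝ e y) ^ 2) ((mm N).map YY) := by
    refine (integrable_const (1:ℝ)).mono' hF.aestronglyMeasurable ?_
    filter_upwards [hae] with y hy
    rw [Real.norm_of_nonneg (sq_nonneg _)]
    have : |inner ℝ e y| ≤ 1 := (abs_real_inner_le_norm e y).trans (by rw [he]; linarith)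
    nlinarith [abs_nonneg (inner ℝ e y), sq_abs (inner ℝ e y)]
  have h1 := integral_mono_measure hle (ae_of_all _ fun y => sq_nonneg (inner ℝ e y)) hintg
  rw [integral_map YY_meas.aemeasurable hF.aestronglyMeasurable, integral_smul_measure,
    ENNReal.toReal_ofReal hc0.le] at h1
  refine le_trans ?_ h1
  rw [hk, smul_eq_mul]
  refine mul_le_mul_of_nonneg_left ?_ hc0.le
  have hsub : ball ((1/8:ℝ) • e) (1/16) ⊆ ball (0 : ES N) (1/4) := by
    refine ball_subset_ball' ?_
    rw [dist_zero_right, norm_smul, he]; norm_num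
  have hint2 : IntegrableOn (fun y : ES N => (inner ℝ e y) ^ 2) (ball 0 (1/4)) :=
    (hF.continuousOn.integrableOn_compact (isCompact_closedBall 0 (1/4))).mono_set ball_subset_closedBall
  calc (1/16:ℝ)^2 * ((1/16) ^ N * vN N) = ∫ y in ball ((1/8:ℝ) • e) (1/16), (1/16:ℝ)^2 := by
        rw [setIntegral_const, Measure.real, vol_ball _ (by norm_num), smul_eq_mul]; ring
    _ ≤ ∫ y in ball ((1/8:ℝ) • e) (1/16), (inner ℝ e y) ^ 2 := by
        refine setIntegral_mono_on (integrableOn_const (measure_ball_lt_top.ne)) (hint2.mono_set hsub) measurableSet_ball ?_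
        intro y hy
        have h2 : inner ℝ e y = 1/8 + inner ℝ e (y - (1/8:ℝ) • e) := by
          rw [inner_sub_right, inner_smul_right, real_inner_self_eq_norm_sq, he]; ring
        have h3 : |inner ℝ e (y - (1/8:ℝ) • e)| ≤ 1/16 := by
          refine (abs_real_inner_le_norm _ _).trans ?_
          rw [he, one_mul, ← dist_eq_norm]; exact hy.le
        rw [abs_le] at h3
        have : 1/16 ≤ inner ℝ e y := by rw [h2]; linarith [h3.1]
        nlinarith
    _ ≤ _ := setIntegral_mono_set hint2 (ae_of_all _ fun y => sq_nonneg _) (Eventually.of_forall hsub)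

end


section


variable {N : ℕ}

/-- standing assumptions on the domain, the potential and the small parameter -/
structure Cx (Ω : Set (ES N)) (V : ES N → ℝ) (ε : ℝ) : Prop where
  op : IsOpen Ω
  bd : Bornology.IsBounded Ω
  ne : (Ωᶜ).Nonempty
  e0 : 0 < ε
  e1 : ε ≤ 1 / 16
  Vm : Measurable V
  V0 : ∀ x ∈ Ω, 0 ≤ V x
  Vb : ∀ x ∈ Ω, V x * dista Ω x ^ 2 * ε ^ 2 ≤ 1 / 4

def RR (Ω : Set (ES N)) (ε : ℝ) (z : ES N) : ℝ := ε * dista Ω z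
def ZZ (Ω : Set (ES N)) (ε : ℝ) (z : ES N) (ω : ℝ × ES N) : ES N := z + RR Ω ε z • YY ω
def kk (Ω : Set (ES N)) (V : ES N → ℝ) (ε : ℝ) (z : ES N) (ω : ℝ × ES N) : ℝ :=
  max (1 / 2) (min 1 (1 - (1 - ω.1) * ω.1 * RR Ω ε z ^ 2 * V (ZZ Ω ε z ω) * tau ω.2))
def Ev (Ω : Set (ES N)) (ε : ℝ) (f : ES N → ℝ) (z : ES N) : ℝ := ∫ ω, f (ZZ Ω ε z ω) ∂(mm N)
def TT (Ω : Set (ES N)) (V : ES N → ℝ) (ε : ℝ) (f : ES N → ℝ) (z : ES N) : ℝ :=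
  ∫ ω, kk Ω V ε z ω * f (ZZ Ω ε z ω) ∂(mm N)
def Good (Ω : Set (ES N)) (f : ES N → ℝ) : Prop :=
  Measurable f ∧ ∀ x ∈ Ω, ∃ C, ∀ᶠ w in 𝓝 x, |f w| ≤ C

variable {Ω : Set (ES N)} {V : ES N → ℝ} {ε : ℝ} {f g : ES N → ℝ} {z : ES N}

lemma kk_ge (ω : ℝ × ES N) : 1 / 2 ≤ kk Ω V ε z ω := le_max_left _ _
lemma kk_le (ω : ℝ × ES N) : kk Ω V ε z ω ≤ 1 := max_le (by norm_num) (min_le_left _ _)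
lemma kk_zero (ω : ℝ × ES N) : kk Ω (fun _ => 0) ε z ω = 1 := by simp [kk]; norm_num

lemma TT_zero : TT Ω (fun _ => 0) ε f z = Ev Ω ε f z := by simp [TT, Ev, kk_zero]

lemma dista_cont : Continuous (dista Ω) := continuous_infDist_pt _
lemma dista_nonneg (x : ES N) : 0 ≤ dista Ω x := infDist_nonneg
lemma dista_le_add (x y : ES N) : dista Ω x ≤ dista Ω y + dist x y := infDist_le_infDist_add_dist
lemma RR_cont : Continuous (RR Ω ε) := continuous_const.mul dista_cont
lemma ZZ_meas2 : Measurable (fun p : ES N × (ℝ × ES N) => ZZ Ω ε p.1 p.2) := by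
  unfold ZZ YY
  have := (RR_cont (Ω := Ω) (ε := ε)).measurable
  exact measurable_fst.add ((this.comp measurable_fst).smul (by fun_prop))
lemma kk_meas2 (hV : Measurable V) : Measurable (fun p : ES N × (ℝ × ES N) => kk Ω V ε p.1 p.2) := by
  unfold kk
  have h1 := (RR_cont (Ω := Ω) (ε := ε)).measurable
  have h2 := hV.comp (ZZ_meas2 (Ω := Ω) (ε := ε))
  have h3 := (tau_cont (N := N)).measurable
  refine measurable_const.max (measurable_const.min (measurable_const.sub ?_))
  refine Measurable.mul (Measurable.mul (Measurable.mul (by fun_prop) ?_) h2) (h3.comp (by fun_prop))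
  exact (h1.comp measurable_fst).pow_const 2
lemma ZZ_meas : Measurable (fun ω => ZZ Ω ε z ω) := ZZ_meas2.comp measurable_prodMk_left
lemma kk_meas (hV : Measurable V) : Measurable (fun ω => kk Ω V ε z ω) :=
  Measurable.comp (g := fun p : ES N × (ℝ × ES N) => kk Ω V ε p.1 p.2)
    (f := fun ω : ℝ × ES N => (z, ω)) (kk_meas2 (Ω := Ω) (ε := ε) hV) measurable_prodMk_left


lemma Cx.dpos (cx : Cx Ω V ε) (hz : z ∈ Ω) : 0 < dista Ω z := by
  have := (cx.op.isClosed_compl.notMem_iff_infDist_pos cx.ne (x := z)).1 (by simpa using hz)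
  exact this

lemma Cx.Rpos (cx : Cx Ω V ε) (hz : z ∈ Ω) : 0 < RR Ω ε z := mul_pos cx.e0 (cx.dpos hz)

lemma ball_dista : ball z (dista Ω z) ⊆ Ω := by
  intro x hx
  by_contra hc
  have := infDist_le_dist_of_mem (x := z) (s := Ωᶜ) hc
  rw [mem_ball, dist_comm] at hx
  exact absurd hx (not_lt.2 this)

lemma Cx.cb (cx : Cx Ω V ε) (hz : z ∈ Ω) : closedBall z (2 * RR Ω ε z) ⊆ Ω := by
  refine Subset.trans (closedBall_subset_ball ?_) ball_dista
  unfold RR; nlinarith [cx.e1, cx.dpos hz]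

lemma Cx.cb1 (cx : Cx Ω V ε) (hz : z ∈ Ω) : closedBall z (RR Ω ε z) ⊆ Ω :=
  (closedBall_subset_closedBall (by linarith [cx.Rpos hz])).trans (cx.cb hz)

lemma Cx.dball (cx : Cx Ω V ε) {x w : ES N} (hw : w ∈ closedBall x (RR Ω ε x)) :
    15 / 16 * dista Ω x ≤ dista Ω w ∧ dista Ω w ≤ 17 / 16 * dista Ω x := by
  have h1 := dista_le_add (Ω := Ω) x w
  have h2 := dista_le_add (Ω := Ω) w x
  rw [mem_closedBall] at hw
  rw [dist_comm] at h1
  have : RR Ω ε x ≤ 1 / 16 * dista Ω x := mul_le_mul_of_nonneg_right cx.e1 (dista_nonneg x)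
  constructor <;> linarith

lemma ZZ_mem : ∀ᵐ ω ∂(mm N), 0 ≤ RR Ω ε z → ZZ Ω ε z ω ∈ closedBall z (RR Ω ε z) := by
  filter_upwards [mm_ae] with ω hω hR
  exact zmem hR hω.1.1 hω.1.2 hω.2

lemma kk_form (cx : Cx Ω V ε) (hz : z ∈ Ω) : ∀ᵐ ω ∂(mm N), kk Ω V ε z ω =
    1 - (1 - ω.1) * ω.1 * RR Ω ε z ^ 2 * V (ZZ Ω ε z ω) * tau ω.2 := by
  filter_upwards [mm_ae, ZZ_mem] with ω hω hZ
  have hZ := hZ (cx.Rpos hz).le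
  have hZΩ := cx.cb1 hz hZ
  have hd := (cx.dball hZ).1
  have hv := cx.Vb _ hZΩ
  have hv0 := cx.V0 _ hZΩ
  have hdp := cx.dpos hz
  obtain ⟨t0, t1⟩ := tau_bd hω.2
  have a0 : 0 ≤ (1 - ω.1) * ω.1 := mul_nonneg (by linarith [hω.1.2]) hω.1.1.le
  have a1 : (1 - ω.1) * ω.1 ≤ 1 := by nlinarith [hω.1.1, hω.1.2]
  have hR : RR Ω ε z ^ 2 * V (ZZ Ω ε z ω) ≤ 1 := by
    unfold RR
    have h2 : dista Ω z ^ 2 ≤ 2 * dista Ω (ZZ Ω ε z ω) ^ 2 := by nlinarith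
    have h3 : 0 ≤ V (ZZ Ω ε z ω) * ε ^ 2 := by have := cx.e0; positivity
    have := mul_le_mul_of_nonneg_left h2 h3
    nlinarith
  have hR0 : 0 ≤ RR Ω ε z ^ 2 * V (ZZ Ω ε z ω) := by positivity
  have hb : (1 - ω.1) * ω.1 * (RR Ω ε z ^ 2 * V (ZZ Ω ε z ω)) * tau ω.2 ≤ 1 * 1 * (1 / 2) :=
    mul_le_mul (mul_le_mul a1 hR hR0 zero_le_one) t1 t0 (by norm_num)
  have hb0 : 0 ≤ (1 - ω.1) * ω.1 * (RR Ω ε z ^ 2 * V (ZZ Ω ε z ω)) * tau ω.2 := by positivity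
  rw [← mul_assoc] at hb hb0
  unfold kk
  rw [min_eq_right (by linarith), max_eq_right (by linarith)]

/-! ### Good functions -/

lemma Good.bdd (hf : Good Ω f) {K : Set (ES N)} (hK : IsCompact K) (hKΩ : K ⊆ Ω) :
    ∃ C, ∀ x ∈ K, |f x| ≤ C := by
  refine hK.induction_on (p := fun s => ∃ C, ∀ x ∈ s, |f x| ≤ C) ⟨0, by simp⟩ ?_ ?_ ?_
  · rintro s t hst ⟨C, hC⟩; exact ⟨C, fun x hx => hC x (hst hx)⟩
  · rintro s t ⟨C, hC⟩ ⟨D, hD⟩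
    refine ⟨max C D, ?_⟩
    rintro x (hx | hx)
    · exact (hC x hx).trans (le_max_left _ _)
    · exact (hD x hx).trans (le_max_right _ _)
  · intro x hx
    obtain ⟨C, hC⟩ := hf.2 x (hKΩ hx)
    exact ⟨_, mem_nhdsWithin_of_mem_nhds hC, C, fun y hy => hy⟩

lemma Good.intE (hf : Good Ω f) (cx : Cx Ω V ε) (hz : z ∈ Ω) :
    Integrable (fun ω => f (ZZ Ω ε z ω)) (mm N) := by
  obtain ⟨C, hC⟩ := hf.bdd (isCompact_closedBall z _) (cx.cb1 hz)
  refine (integrable_const C).mono' (hf.1.comp ZZ_meas).aestronglyMeasurable ?_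
  filter_upwards [ZZ_mem] with ω hω
  exact hC _ (hω (cx.Rpos hz).le)

lemma Good.intT (hf : Good Ω f) (cx : Cx Ω V ε) (hz : z ∈ Ω) :
    Integrable (fun ω => kk Ω V ε z ω * f (ZZ Ω ε z ω)) (mm N) := by
  obtain ⟨C, hC⟩ := hf.bdd (isCompact_closedBall z _) (cx.cb1 hz)
  refine (integrable_const C).mono' ((kk_meas cx.Vm).mul (hf.1.comp ZZ_meas)).aestronglyMeasurable ?_
  filter_upwards [ZZ_mem] with ω hω
  have := hC _ (hω (cx.Rpos hz).le)
  rw [norm_mul, Real.norm_of_nonneg (by linarith [kk_ge (Ω := Ω) (V := V) (ε := ε) (z := z) ω])]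
  calc _ ≤ 1 * |f (ZZ Ω ε z ω)| := mul_le_mul_of_nonneg_right (kk_le ω) (abs_nonneg _)
    _ ≤ C := by linarith

lemma Good.const (c : ℝ) : Good Ω (fun _ => c) :=
  ⟨measurable_const, fun _ _ => ⟨|c|, Eventually.of_forall fun _ => le_rfl⟩⟩
lemma Good.add (hf : Good Ω f) (hg : Good Ω g) : Good Ω (fun x => f x + g x) := by
  refine ⟨hf.1.add hg.1, fun x hx => ?_⟩
  obtain ⟨C, hC⟩ := hf.2 x hx
  obtain ⟨D, hD⟩ := hg.2 x hx
  refine ⟨C + D, ?_⟩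
  filter_upwards [hC, hD] with w h1 h2
  exact (abs_add_le _ _).trans (add_le_add h1 h2)
lemma Good.cmul (c : ℝ) (hf : Good Ω f) : Good Ω (fun x => c * f x) := by
  refine ⟨hf.1.const_mul c, fun x hx => ?_⟩
  obtain ⟨C, hC⟩ := hf.2 x hx
  refine ⟨|c| * C, ?_⟩
  filter_upwards [hC] with w h1
  rw [abs_mul]; exact mul_le_mul_of_nonneg_left h1 (abs_nonneg _)
lemma Good.sub (hf : Good Ω f) (hg : Good Ω g) : Good Ω (fun x => f x - g x) := by
  have := hf.add (hg.cmul (-1))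
  refine ⟨hf.1.sub hg.1, fun x hx => ?_⟩
  obtain ⟨C, hC⟩ := this.2 x hx
  refine ⟨C, hC.mono fun w hw => ?_⟩
  convert hw using 2; ring
lemma Good.of_abs_le (hf : Good Ω f) (hg : Measurable g) (h : ∀ x ∈ Ω, |g x| ≤ |f x|)
    (ho : IsOpen Ω) : Good Ω g := by
  refine ⟨hg, fun x hx => ?_⟩
  obtain ⟨C, hC⟩ := hf.2 x hx
  refine ⟨C, ?_⟩
  filter_upwards [hC, ho.mem_nhds hx] with w h1 h2
  exact (h w h2).trans h1
lemma Good.of_cont (hc : ContinuousOn f Ω) (hm : Measurable f) (ho : IsOpen Ω) : Good Ω f := by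
  refine ⟨hm, fun x hx => ⟨|f x| + 1, ?_⟩⟩
  have : ContinuousAt (fun y => |f y|) x := (hc.continuousAt (ho.mem_nhds hx)).abs
  exact (this.eventually (gt_mem_nhds (lt_add_one (|f x|)))).mono fun w hw => le_of_lt hw
lemma Good.max0 (hf : Good Ω f) (ho : IsOpen Ω) : Good Ω (fun x => max (f x) 0) := by
  refine hf.of_abs_le (hf.1.max measurable_const) (fun x _ => ?_) ho
  rw [abs_of_nonneg (le_max_right _ _)]
  exact max_le (le_abs_self _) (abs_nonneg _)
lemma Good.ind (hf : Good Ω f) (ho : IsOpen Ω) {s : Set (ES N)} (hs : MeasurableSet s) :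
    Good Ω (s.indicator f) := by
  refine hf.of_abs_le (hf.1.indicator hs) (fun x _ => ?_) ho
  by_cases h : x ∈ s <;> simp [h]

/-! ### operator algebra -/

lemma Ev_mono (cx : Cx Ω V ε) (hz : z ∈ Ω) (hf : Good Ω f) (hg : Good Ω g)
    (h : ∀ w ∈ closedBall z (RR Ω ε z), f w ≤ g w) : Ev Ω ε f z ≤ Ev Ω ε g z := by
  refine integral_mono_ae (hf.intE cx hz) (hg.intE cx hz) ?_
  filter_upwards [ZZ_mem] with ω hω
  exact h _ (hω (cx.Rpos hz).le)
lemma TT_mono (cx : Cx Ω V ε) (hz : z ∈ Ω) (hf : Good Ω f) (hg : Good Ω g)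
    (h : ∀ w ∈ closedBall z (RR Ω ε z), f w ≤ g w) : TT Ω V ε f z ≤ TT Ω V ε g z := by
  refine integral_mono_ae (hf.intT cx hz) (hg.intT cx hz) ?_
  filter_upwards [ZZ_mem] with ω hω
  exact mul_le_mul_of_nonneg_left (h _ (hω (cx.Rpos hz).le))
    (by linarith [kk_ge (Ω := Ω) (V := V) (ε := ε) (z := z) ω])
lemma TT_le_Ev (cx : Cx Ω V ε) (hz : z ∈ Ω) (hf : Good Ω f)
    (h : ∀ w ∈ closedBall z (RR Ω ε z), 0 ≤ f w) : TT Ω V ε f z ≤ Ev Ω ε f z := by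
  refine integral_mono_ae (hf.intT cx hz) (hf.intE cx hz) ?_
  filter_upwards [ZZ_mem] with ω hω
  exact mul_le_of_le_one_left (h _ (hω (cx.Rpos hz).le)) (kk_le ω)
lemma Ev_le_TT (cx : Cx Ω V ε) (hz : z ∈ Ω) (hf : Good Ω f)
    (h : ∀ w ∈ closedBall z (RR Ω ε z), 0 ≤ f w) : Ev Ω ε f z ≤ 2 * TT Ω V ε f z := by
  unfold TT
  rw [← integral_const_mul]
  refine integral_mono_ae (hf.intE cx hz) ((hf.intT cx hz).const_mul 2) ?_
  filter_upwards [ZZ_mem] with ω hω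
  have h1 := h _ (hω (cx.Rpos hz).le)
  have h2 := kk_ge (Ω := Ω) (V := V) (ε := ε) (z := z) ω
  nlinarith
lemma TT_nonneg (cx : Cx Ω V ε) (hz : z ∈ Ω)
    (h : ∀ w ∈ closedBall z (RR Ω ε z), 0 ≤ f w) : 0 ≤ TT Ω V ε f z := by
  refine integral_nonneg_of_ae ?_
  filter_upwards [ZZ_mem] with ω hω
  exact mul_nonneg (by linarith [kk_ge (Ω := Ω) (V := V) (ε := ε) (z := z) ω])
    (h _ (hω (cx.Rpos hz).le))
lemma TT_add (cx : Cx Ω V ε) (hz : z ∈ Ω) (hf : Good Ω f) (hg : Good Ω g) :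
    TT Ω V ε (fun x => f x + g x) z = TT Ω V ε f z + TT Ω V ε g z := by
  unfold TT
  rw [← integral_add (hf.intT cx hz) (hg.intT cx hz)]
  simp only [mul_add]
lemma TT_sub (cx : Cx Ω V ε) (hz : z ∈ Ω) (hf : Good Ω f) (hg : Good Ω g) :
    TT Ω V ε (fun x => f x - g x) z = TT Ω V ε f z - TT Ω V ε g z := by
  unfold TT
  rw [← integral_sub (hf.intT cx hz) (hg.intT cx hz)]
  simp only [mul_sub]
lemma TT_cmul (c : ℝ) : TT Ω V ε (fun x => c * f x) z = c * TT Ω V ε f z := by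
  unfold TT
  rw [← integral_const_mul]
  congr 1; ext ω; ring
lemma Ev_const (c : ℝ) : Ev Ω ε (fun _ => c) z = c := by simp [Ev]
lemma Cx.zero (cx : Cx Ω V ε) : Cx Ω (fun _ => 0) ε :=
  ⟨cx.op, cx.bd, cx.ne, cx.e0, cx.e1, measurable_const, fun _ _ => le_rfl, fun _ _ => by norm_num⟩
lemma Ev_add (cx : Cx Ω V ε) (hz : z ∈ Ω) (hf : Good Ω f) (hg : Good Ω g) :
    Ev Ω ε (fun x => f x + g x) z = Ev Ω ε f z + Ev Ω ε g z := by
  have := TT_add cx.zero hz hf hg; simpa only [TT_zero] using this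
lemma Ev_sub (cx : Cx Ω V ε) (hz : z ∈ Ω) (hf : Good Ω f) (hg : Good Ω g) :
    Ev Ω ε (fun x => f x - g x) z = Ev Ω ε f z - Ev Ω ε g z := by
  have := TT_sub cx.zero hz hf hg; simpa only [TT_zero] using this
lemma Ev_cmul (c : ℝ) : Ev Ω ε (fun x => c * f x) z = c * Ev Ω ε f z := by
  have := TT_cmul (Ω := Ω) (V := fun _ => 0) (ε := ε) (f := f) (z := z) c
  simpa only [TT_zero] using this
lemma TT_meas (cx : Cx Ω V ε) (hf : Measurable f) : Measurable (TT Ω V ε f) := by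
  have h : StronglyMeasurable (fun p : ES N × (ℝ × ES N) => kk Ω V ε p.1 p.2 * f (ZZ Ω ε p.1 p.2)) :=
    ((kk_meas2 cx.Vm).mul (hf.comp ZZ_meas2)).stronglyMeasurable
  exact h.integral_prod_right'.measurable

/-! ### harmonic functions -/

lemma harm_TT {u : ES N → ℝ} (cx : Cx Ω V ε) (hu : LVHarmonic Ω V u) (hum : Measurable u)
    (hz : z ∈ Ω) : u z = TT Ω V ε u z := by
  have hR := cx.Rpos hz
  have hB : ∀ x ∈ closedBall z (RR Ω ε z), |V x| ≤ 1 / RR Ω ε z ^ 2 := by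
    intro x hx
    have hxΩ := cx.cb1 hz hx
    rw [abs_of_nonneg (cx.V0 x hxΩ), le_div_iff₀ (by positivity)]
    have hd := (cx.dball hx).1
    have hv := cx.Vb _ hxΩ
    have hv0 := cx.V0 _ hxΩ
    have hdp := cx.dpos hz
    unfold RR
    have h2 : dista Ω z ^ 2 ≤ 2 * dista Ω x ^ 2 := by nlinarith
    have h3 : 0 ≤ V x * ε ^ 2 := by have := cx.e0; positivity
    have := mul_le_mul_of_nonneg_left h2 h3
    nlinarith
  have h := mean_formula hu hum cx.Vm hR (by linarith : RR Ω ε z < 2 * RR Ω ε z) (cx.cb hz) hB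
  rw [h]
  unfold TT
  refine integral_congr_ae ?_
  filter_upwards [kk_form cx hz] with ω hω
  rw [hω, mul_comm]; rfl

end


section


variable {N : ℕ} {Ω : Set (ES N)} {V : ES N → ℝ} {ε : ℝ}

def k1 (N : ℕ) : ℝ := (exists_k1 N).choose
lemma k1_pos : 0 < k1 N := (exists_k1 N).choose_spec.1
lemma k1_le : k1 N ≤ 1 := (exists_k1 N).choose_spec.2.1
lemma k1_spec (p : ES N) : k1 N * ‖p‖ ^ 2 ≤ ∫ ω, (inner ℝ p (YY ω)) ^ 2 ∂(mm N) := by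
  rcases eq_or_ne p 0 with h | h
  · simp [h]
  · have hp : 0 < ‖p‖ := norm_pos_iff.2 h
    have h1 := (exists_k1 N).choose_spec.2.2 (‖p‖⁻¹ • p) (by
      rw [norm_smul, norm_inv, norm_norm, inv_mul_cancel₀ hp.ne'])
    have h2 : ∀ ω : ℝ × ES N, (inner ℝ (‖p‖⁻¹ • p) (YY ω)) ^ 2 = (‖p‖ ^ 2)⁻¹ * (inner ℝ p (YY ω)) ^ 2 := by
      intro ω; rw [real_inner_smul_left]; field_simp
    simp_rw [h2] at h1
    rw [integral_const_mul] at h1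
    have h3 : k1 N ≤ (‖p‖ ^ 2)⁻¹ * ∫ ω, (inner ℝ p (YY ω)) ^ 2 ∂(mm N) := h1
    rw [inv_mul_eq_div, le_div_iff₀ (by positivity)] at h3
    exact h3

lemma int_YY_cont {F : ES N → ℝ} (hF : Continuous F) : Integrable (fun ω => F (YY ω)) (mm N) := by
  obtain ⟨C, hC⟩ := (isCompact_closedBall (0 : ES N) 1).exists_bound_of_continuousOn hF.continuousOn
  refine (integrable_const C).mono' (hF.measurable.comp YY_meas).aestronglyMeasurable ?_
  filter_upwards [YY_norm] with ω hω
  exact hC _ (by simp [hω.le])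

lemma Ev_sq (cx : Cx Ω V ε) {z : ES N} (hz : z ∈ Ω) :
    ‖z‖ ^ 2 + k1 N * RR Ω ε z ^ 2 ≤ Ev Ω ε (fun x => ‖x‖ ^ 2) z := by
  obtain ⟨w, hw⟩ := cx.ne
  have hne : w - z ≠ 0 := fun h => hw (by rw [sub_eq_zero.1 h]; exact hz)
  set e : ES N := ‖w - z‖⁻¹ • (w - z) with he
  have hen : ‖e‖ = 1 := by
    rw [he, norm_smul, norm_inv, norm_norm, inv_mul_cancel₀ (norm_ne_zero_iff.2 hne)]
  set R := RR Ω ε z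
  have h1 : Ev Ω ε (fun x => ‖x‖ ^ 2) z = ∫ ω, ‖z + R • YY ω‖ ^ 2 ∂(mm N) := rfl
  have h2 : ∫ ω, ‖z + R • YY ω‖ ^ 2 ∂(mm N) = ∫ ω, ‖z - R • YY ω‖ ^ 2 ∂(mm N) := by
    rw [← mm_symm (fun y => ‖z + R • y‖ ^ 2)]
    simp [sub_eq_add_neg]
  have i1 : Integrable (fun ω => ‖z + R • YY ω‖ ^ 2) (mm N) :=
    int_YY_cont (F := fun y => ‖z + R • y‖ ^ 2) (by fun_prop)
  have i2 : Integrable (fun ω => ‖z - R • YY ω‖ ^ 2) (mm N) :=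
    int_YY_cont (F := fun y => ‖z - R • y‖ ^ 2) (by fun_prop)
  have i3 : Integrable (fun ω => (inner ℝ e (YY ω)) ^ 2) (mm N) :=
    int_YY_cont (F := fun y => (inner ℝ e y) ^ 2) (by fun_prop)
  have h3 : ∫ ω, (2 * ‖z‖ ^ 2 + 2 * R ^ 2 * (inner ℝ e (YY ω)) ^ 2) ∂(mm N) ≤
      ∫ ω, (‖z + R • YY ω‖ ^ 2 + ‖z - R • YY ω‖ ^ 2) ∂(mm N) := by
    refine integral_mono ((integrable_const _).add (i3.const_mul _)) (i1.add i2) fun ω => ?_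
    have p := parallelogram_law_with_norm ℝ z (R • YY ω)
    have q : (inner ℝ e (YY ω)) ^ 2 ≤ ‖YY ω‖ ^ 2 := by
      have := abs_real_inner_le_norm e (YY ω)
      rw [hen, one_mul] at this
      rw [← sq_abs]; gcongr
    have q2 : ‖R • YY ω‖ ^ 2 = R ^ 2 * ‖YY ω‖ ^ 2 := by rw [norm_smul, mul_pow]; simp
    have q3 := mul_le_mul_of_nonneg_left q (sq_nonneg R)
    simp only
    nlinarith
  rw [integral_add i1 i2, integral_add (integrable_const _) (i3.const_mul _),
    integral_const_mul (2 * R ^ 2) (fun ω => (inner ℝ e (YY ω)) ^ 2),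
    integral_const, ← h2] at h3
  simp only [probReal_univ, one_smul] at h3
  have h4 := k1_spec e
  rw [hen] at h4
  rw [h1]
  have h5 := mul_le_mul_of_nonneg_left h4 (sq_nonneg R)
  linarith

/-- maximum principle -/
lemma MP (cx : Cx Ω V ε) {q : ES N → ℝ} (hq : Good Ω q) (h0 : ∀ x ∈ Ω, 0 ≤ q x)
    (hs : ∀ z ∈ Ω, 0 < q z → q z ≤ Ev Ω ε q z)
    (hb : ∀ w ∈ frontier Ω, Tendsto q (𝓝[Ω] w) (𝓝 0)) : ∀ x ∈ Ω, q x ≤ 0 := by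
  intro x1 hx1
  by_contra hm
  push Not at hm
  set m := q x1
  obtain ⟨D, hD0, hD⟩ := cx.bd.exists_pos_norm_le
  have hcl : IsCompact (closure Ω) := cx.bd.isCompact_closure
  -- bounded
  have hbdd : ∃ C, ∀ x ∈ Ω, q x ≤ C := by
    have : ∃ C, ∀ x ∈ closure Ω, x ∈ Ω → q x ≤ C := by
      refine hcl.induction_on (p := fun s => ∃ C, ∀ x ∈ s, x ∈ Ω → q x ≤ C) ⟨0, by simp⟩ ?_ ?_ ?_
      · rintro s t hst ⟨C, hC⟩; exact ⟨C, fun x hx => hC x (hst hx)⟩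
      · rintro s t ⟨C, hC⟩ ⟨D, hD⟩
        refine ⟨max C D, ?_⟩
        rintro x (hx | hx) hx2
        · exact (hC x hx hx2).trans (le_max_left _ _)
        · exact (hD x hx hx2).trans (le_max_right _ _)
      · intro x hx
        by_cases hxΩ : x ∈ Ω
        · obtain ⟨C, hC⟩ := hq.2 x hxΩ
          exact ⟨_, mem_nhdsWithin_of_mem_nhds hC, C, fun y hy _ => (le_abs_self _).trans hy⟩
        · have hf : x ∈ frontier Ω := by rw [cx.op.frontier_eq]; exact ⟨hx, hxΩ⟩
          have := (hb x hf).eventually (gt_mem_nhds one_pos)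
          rw [eventually_nhdsWithin_iff] at this
          exact ⟨_, mem_nhdsWithin_of_mem_nhds this, 1, fun y hy hyΩ => (hy hyΩ).le⟩
    obtain ⟨C, hC⟩ := this
    exact ⟨C, fun x hx => hC x (subset_closure hx) hx⟩
  have hd0 : ∃ d0 > 0, ∀ x ∈ Ω, m / 2 ≤ q x → d0 ≤ dista Ω x := by
    set A := closure {x | x ∈ Ω ∧ m / 2 ≤ q x} with hA
    have hAc : IsCompact A := hcl.of_isClosed_subset isClosed_closure (closure_mono fun x hx => hx.1)
    have hAΩ : A ⊆ Ω := by
      intro x hx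
      by_contra hxΩ
      have hxc : x ∈ closure Ω := closure_mono (fun y (hy : _ ∧ _) => hy.1) hx
      have hf : x ∈ frontier Ω := by rw [cx.op.frontier_eq]; exact ⟨hxc, hxΩ⟩
      have := (hb x hf).eventually (gt_mem_nhds (half_pos hm))
      rw [eventually_nhdsWithin_iff] at this
      obtain ⟨y, hy1, hy2⟩ := (mem_closure_iff_frequently.1 hx).and_eventually this |>.exists
      exact absurd (hy2 hy1.1) (not_lt.2 hy1.2)
    have hAne : A.Nonempty := ⟨x1, subset_closure ⟨hx1, by linarith⟩⟩
    obtain ⟨x2, hx2, hmin⟩ := hAc.exists_isMinOn hAne (dista_cont (Ω := Ω)).continuousOn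
    exact ⟨dista Ω x2, cx.dpos (hAΩ hx2), fun x hx hq => hmin (subset_closure ⟨hx, hq⟩)⟩
  obtain ⟨C, hC⟩ := hbdd
  obtain ⟨d0, hd0, hdd⟩ := hd0
  set κ := m / (4 * D ^ 2) with hκ
  have hκ0 : 0 < κ := by positivity
  have hκD : κ * D ^ 2 = m / 4 := by rw [hκ]; field_simp
  set g : ES N → ℝ := fun x => q x + κ * ‖x‖ ^ 2 with hg
  have hsq : ∀ x ∈ Ω, ‖x‖ ^ 2 ≤ D ^ 2 := fun x hx => by
    have := hD x hx; gcongr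
  have hgb : BddAbove (g '' Ω) := by
    refine ⟨C + κ * D ^ 2, ?_⟩
    rintro _ ⟨x, hx, rfl⟩
    exact add_le_add (hC x hx) (mul_le_mul_of_nonneg_left (hsq x hx) hκ0.le)
  set S := sSup (g '' Ω) with hS
  have hle : ∀ x ∈ Ω, g x ≤ S := fun x hx => le_csSup hgb ⟨x, hx, rfl⟩
  set η := min (m / 4) (κ * (k1 N * (ε * d0) ^ 2)) with hη
  have hk := k1_pos (N := N)
  have he := cx.e0
  have hη0 : 0 < η := by positivity
  obtain ⟨_, ⟨x, hx, rfl⟩, hxS⟩ := exists_lt_of_lt_csSup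
    (⟨g x1, x1, hx1, rfl⟩ : (g '' Ω).Nonempty) (by linarith : S - η < S)
  have hmS : m ≤ S := by
    refine le_trans ?_ (hle x1 hx1)
    have : 0 ≤ κ * ‖x1‖ ^ 2 := by positivity
    simp only [hg]; linarith
  have hqx : m / 2 ≤ q x := by
    have h1 := mul_le_mul_of_nonneg_left (hsq x hx) hκ0.le
    have h2 : η ≤ m / 4 := min_le_left _ _
    simp only [hg] at hxS
    linarith
  have hcq : Good Ω (fun x : ES N => ‖x‖ ^ 2) :=
    Good.of_cont (by fun_prop) (by fun_prop) cx.op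
  have e1 : Ev Ω ε g x = Ev Ω ε q x + κ * Ev Ω ε (fun x => ‖x‖ ^ 2) x := by
    rw [hg, Ev_add cx hx hq (hcq.cmul κ), Ev_cmul]
  have e2 : Ev Ω ε g x ≤ S := by
    have := Ev_mono cx hx (hq.add (hcq.cmul κ)) (Good.const S) (fun w hw => hle w (cx.cb1 hx hw))
    rwa [Ev_const] at this
  have e3 := hs x hx (by linarith)
  have e4 := mul_le_mul_of_nonneg_left (Ev_sq cx hx) hκ0.le
  have e5 : κ * (k1 N * (ε * d0) ^ 2) ≤ κ * (k1 N * RR Ω ε x ^ 2) := by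
    have := hdd x hx hqx
    unfold RR; gcongr
  have e6 : η ≤ κ * (k1 N * (ε * d0) ^ 2) := min_le_right _ _
  simp only [hg] at hxS
  nlinarith

lemma one_add_half_sq_cosh (t : ℝ) : 1 + t ^ 2 / 2 ≤ Real.cosh t := by
  have h1 : Real.cosh t = 1 + 2 * Real.sinh (t / 2) ^ 2 := by
    have := Real.cosh_two_mul (t / 2)
    rw [show 2 * (t / 2) = t by ring, Real.cosh_sq] at this
    linarith
  have h2 : (t / 2) ^ 2 ≤ Real.sinh (t / 2) ^ 2 := by
    rcases le_total 0 (t / 2) with h | h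
    · have := Real.self_le_sinh_iff.2 h
      gcongr
    · have := Real.sinh_le_self_iff.2 h
      nlinarith
  rw [h1]; nlinarith

/-- the Gaussian barrier -/
lemma barrier (cx : Cx Ω V ε) {z p : ES N} (hz : z ∈ Ω) {β : ℝ} (hβ : 0 < β)
    (h1 : β * RR Ω ε z ^ 2 ≤ 1 / 2) (h2 : 1 ≤ β * ‖z - p‖ ^ 2 * k1 N) :
    Real.exp (-(β * ‖z - p‖ ^ 2)) ≤ Ev Ω ε (fun x => Real.exp (-(β * ‖x - p‖ ^ 2))) z := by
  set R := RR Ω ε z with hR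
  set F : ES N → ℝ := fun y => Real.exp (-(β * ‖z + R • y - p‖ ^ 2)) with hF
  have hFc : Continuous F := by fun_prop
  have e1 : Ev Ω ε (fun x => Real.exp (-(β * ‖x - p‖ ^ 2))) z = ∫ ω, F (YY ω) ∂(mm N) := rfl
  have e2 := mm_symm F
  have i1 := int_YY_cont hFc
  have i2 : Integrable (fun ω => F (-YY ω)) (mm N) := int_YY_cont (F := fun y => F (-y)) (by fun_prop)
  have i3 : Integrable (fun ω => (inner ℝ (z - p) (YY ω)) ^ 2) (mm N) :=
    int_YY_cont (F := fun y => (inner ℝ (z - p) y) ^ 2) (by fun_prop)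
  set f0 := Real.exp (-(β * ‖z - p‖ ^ 2)) with hf0
  have hf0p : 0 < f0 := Real.exp_pos _
  have key : ∀ ω : ℝ × ES N, ‖YY ω‖ < 1 →
      2 * (f0 * (1 - β * R ^ 2)) * (1 + 2 * β ^ 2 * R ^ 2 * (inner ℝ (z - p) (YY ω)) ^ 2) ≤
      F (YY ω) + F (-YY ω) := by
    intro ω hω
    set t := 2 * β * R * inner ℝ (z - p) (YY ω) with ht
    set b := β * R ^ 2 * ‖YY ω‖ ^ 2 with hb
    have a1 : F (YY ω) = f0 * Real.exp (-b) * Real.exp (-t) := by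
      rw [hF, hf0, ← Real.exp_add, ← Real.exp_add]
      simp only
      congr 1
      have : z + R • YY ω - p = (z - p) + R • YY ω := by abel
      rw [this, norm_add_sq_real, norm_smul, mul_pow, inner_smul_right, Real.norm_eq_abs, sq_abs]
      rw [hb, ht]; ring
    have a2 : F (-YY ω) = f0 * Real.exp (-b) * Real.exp t := by
      rw [hF, hf0, ← Real.exp_add, ← Real.exp_add]
      simp only
      congr 1
      have : z + R • (-YY ω) - p = (z - p) - R • YY ω := by rw [smul_neg]; abel
      rw [this, norm_sub_sq_real, norm_smul, mul_pow, inner_smul_right, Real.norm_eq_abs, sq_abs]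
      rw [hb, ht]; ring
    have a3 : 1 - β * R ^ 2 ≤ Real.exp (-b) := by
      have := Real.add_one_le_exp (-b)
      have h4 : b ≤ β * R ^ 2 := by
        rw [hb]
        refine mul_le_of_le_one_right (by positivity) ?_
        nlinarith [norm_nonneg (YY ω)]
      linarith
    have a4 : 2 * (1 + t ^ 2 / 2) ≤ Real.exp (-t) + Real.exp t := by
      have := one_add_half_sq_cosh t
      rw [Real.cosh_eq] at this
      linarith
    have a5 : t ^ 2 / 2 = 2 * β ^ 2 * R ^ 2 * (inner ℝ (z - p) (YY ω)) ^ 2 := by rw [ht]; ring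
    rw [a1, a2, ← a5]
    have b1 : f0 * (1 - β * R ^ 2) ≤ f0 * Real.exp (-b) := mul_le_mul_of_nonneg_left a3 hf0p.le
    have b2 := mul_le_mul b1 a4 (by positivity) (by positivity)
    linarith
  have h3 : ∫ ω, 2 * (f0 * (1 - β * R ^ 2)) *
      (1 + 2 * β ^ 2 * R ^ 2 * (inner ℝ (z - p) (YY ω)) ^ 2) ∂(mm N) ≤
      ∫ ω, (F (YY ω) + F (-YY ω)) ∂(mm N) := by
    refine integral_mono_ae (((integrable_const _).add (i3.const_mul _)).const_mul _) (i1.add i2) ?_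
    filter_upwards [YY_norm] with ω hω
    exact key ω hω
  rw [integral_add i1 i2, e2, integral_const_mul, integral_add (integrable_const _) (i3.const_mul _),
    integral_const_mul, integral_const, ← e1] at h3
  simp only [probReal_univ, one_smul] at h3
  have h4 := k1_spec (z - p)
  set J := ∫ ω, (inner ℝ (z - p) (YY ω)) ^ 2 ∂(mm N)
  have h5 : 2 * β * R ^ 2 ≤ 2 * β ^ 2 * R ^ 2 * J := by
    have : 1 ≤ β * J := by nlinarith
    have := mul_le_mul_of_nonneg_left this (by positivity : 0 ≤ 2 * β * R ^ 2)
    linarith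
  have h6 : 1 ≤ (1 - β * R ^ 2) * (1 + 2 * β ^ 2 * R ^ 2 * J) := by
    have h7 : 0 ≤ β * R ^ 2 := by positivity
    nlinarith
  have h8 := mul_le_mul_of_nonneg_left h6 hf0p.le
  linarith

end


section


set_option linter.unusedVariables false

variable {N : ℕ} {Ω : Set (ES N)} {V : ES N → ℝ} {ε : ℝ}

def c0 (N : ℕ) : ℝ := (exists_c0 N).choose
lemma c0_pos : 0 < c0 N := (exists_c0 N).choose_spec.1
lemma c0_spec : ENNReal.ofReal (c0 N) • volume.restrict (ball (0 : ES N) (1 / 4)) ≤ (mm N).map YY :=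
  (exists_c0 N).choose_spec.2
def C2 (N : ℕ) : ℝ := (exists_H2 N).choose
lemma C2_pos : 0 < C2 N := (exists_H2 N).choose_spec.1

def SupAt (Ω : Set (ES N)) (V : ES N → ℝ) (ε : ℝ) (v : ES N → ℝ) (x : ES N) : Prop :=
  (∀ w ∈ closedBall x (RR Ω ε x), 0 ≤ v w) ∧ TT Ω V ε v x ≤ v x
def NiceAt (Ω : Set (ES N)) (V : ES N → ℝ) (ε : ℝ) (u : ES N → ℝ) (x : ES N) : Prop :=
  (∀ w ∈ closedBall x (RR Ω ε x), 0 ≤ u w) ∧ u x = TT Ω V ε u x ∧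
    ∀ s, 0 < s → s ≤ RR Ω ε x → u x ≤ C2 N * ((s ^ N)⁻¹ * ∫ w in ball x s, u w)

lemma NiceAt.sup {u : ES N → ℝ} {x : ES N} (h : NiceAt Ω V ε u x) : SupAt Ω V ε u x :=
  ⟨h.1, h.2.1.ge⟩
lemma SupAt.nonneg {u : ES N → ℝ} {x : ES N} (cx : Cx Ω V ε) (hx : x ∈ Ω)
    (h : SupAt Ω V ε u x) : 0 ≤ u x :=
  h.1 x (mem_closedBall_self (cx.Rpos hx).le)

lemma harm_nice {u : ES N → ℝ} (cx : Cx Ω V ε) (hu : LVHarmonic Ω V u) (hum : Measurable u)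
    {x : ES N} (hx : x ∈ Ω) (h0 : ∀ w ∈ closedBall x (RR Ω ε x), 0 ≤ u w) : NiceAt Ω V ε u x := by
  refine ⟨h0, harm_TT cx hu hum hx, fun s hs hsR => ?_⟩
  refine (exists_H2 N).choose_spec.2 Ω V u hu hum cx.V0 x s (2 * RR Ω ε x) hs ?_ (cx.cb hx) ?_
  · linarith [cx.Rpos hx]
  · intro w hw
    exact h0 w (closedBall_subset_closedBall hsR (ball_subset_closedBall hw))

lemma L1 (cx : Cx Ω V ε) {f : ES N → ℝ} (hf : Good Ω f) {z : ES N} (hz : z ∈ Ω)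
    (h0 : ∀ w ∈ closedBall z (RR Ω ε z), 0 ≤ f w) :
    c0 N * ((RR Ω ε z ^ N)⁻¹ * ∫ x in ball z (RR Ω ε z / 4), f x) ≤ Ev Ω ε f z := by
  have hR := cx.Rpos hz
  set R := RR Ω ε z with hRd
  set g := (ball z (R / 4)).indicator f with hg
  have hgG : Good Ω g := hf.ind cx.op measurableSet_ball
  have hsub : ball z (R / 4) ⊆ closedBall z R :=
    (ball_subset_ball (by linarith)).trans ball_subset_closedBall
  have hg0 : ∀ w, 0 ≤ g w := fun w => by
    by_cases h : w ∈ ball z (R / 4)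
    · simp only [hg, indicator_of_mem h]; exact h0 w (hsub h)
    · simp [hg, indicator_of_notMem h]
  have h1 : Ev Ω ε g z ≤ Ev Ω ε f z := Ev_mono cx hz hgG hf fun w hw => by
    by_cases h : w ∈ ball z (R / 4)
    · simp [hg, indicator_of_mem h]
    · simp only [hg, indicator_of_notMem h]; exact h0 w hw
  refine le_trans ?_ h1
  set F : ES N → ℝ := fun y => g (z + R • y) with hF
  have hFm : Measurable F := hgG.1.comp (by fun_prop)
  have h2 : Ev Ω ε g z = ∫ y, F y ∂((mm N).map YY) := by
    rw [integral_map YY_meas.aemeasurable hFm.aestronglyMeasurable]; rfl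
  have hintg : Integrable F ((mm N).map YY) := by
    rw [integrable_map_measure hFm.aestronglyMeasurable YY_meas.aemeasurable]
    exact hgG.intE cx hz
  have h3 := integral_mono_measure (f := F) c0_spec (Eventually.of_forall fun y => hg0 _) hintg
  rw [integral_smul_measure, ENNReal.toReal_ofReal c0_pos.le] at h3
  have h4 : ∫ y in ball (0 : ES N) (1 / 4), F y = ∫ y, F y := by
    refine setIntegral_eq_integral_of_forall_compl_eq_zero fun y hy => ?_
    simp only [hF, hg]
    refine indicator_of_notMem (fun h => hy ?_) _
    simp only [mem_ball, dist_zero_right, dist_self_add_left, norm_smul, Real.norm_of_nonneg hR.le] at h ⊢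
    have : R * ‖y‖ < R * (1 / 4) := by linarith
    exact lt_of_mul_lt_mul_left this hR.le
  rw [h4, show ∫ y, F y = _ from chg_var g z hR, hg, integral_indicator measurableSet_ball] at h3
  rw [h2]; exact h3

def cc (N : ℕ) (K : ℝ) : ℝ := min 1 (c0 N / 2 * vN N * (K⁻¹) ^ N)
lemma cc_pos {K : ℝ} (hK : 0 < K) : 0 < cc N K := by
  have := c0_pos (N := N); have := vN_pos (N := N)
  unfold cc; positivity
lemma cc_le {K : ℝ} : cc N K ≤ 1 := min_le_left _ _

lemma Good.intB {f : ES N → ℝ} (hf : Good Ω f) {z : ES N} {s : ℝ} (h : closedBall z s ⊆ Ω) :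
    IntegrableOn f (ball z s) := by
  obtain ⟨C, hC⟩ := hf.bdd (isCompact_closedBall z _) h
  refine Integrable.mono' (g := fun _ => C) ?_ hf.1.aestronglyMeasurable ?_
  · exact integrableOn_const (measure_ball_lt_top.ne)
  · refine (ae_restrict_iff' measurableSet_ball).2 (Eventually.of_forall fun x hx => ?_)
    exact hC x (ball_subset_closedBall hx)

lemma L2 (cx : Cx Ω V ε) {v : ES N → ℝ} (hv : Good Ω v) {x p : ES N} (hx : x ∈ Ω)
    (h0 : ∀ w ∈ closedBall x (RR Ω ε x), 0 ≤ v w) {s lam K : ℝ} (hs : 0 < s) (hl : 0 ≤ lam)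
    (hsub : ball p s ⊆ ball x (RR Ω ε x / 4)) (hK : RR Ω ε x ≤ K * s)
    (hlv : ∀ w ∈ ball p s, lam ≤ v w) : lam * cc N K ≤ TT Ω V ε v x := by
  have hR := cx.Rpos hx
  have hc := c0_pos (N := N)
  have hvN := vN_pos (N := N)
  have hK0 : 0 < K := by by_contra h; push Not at h; nlinarith
  have h1 := Ev_le_TT cx hx hv h0
  have h2 := L1 cx hv hx h0
  set R := RR Ω ε x with hRd
  have hsubR : ball x (R / 4) ⊆ closedBall x R :=
    (ball_subset_ball (by linarith)).trans ball_subset_closedBall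
  have hI : IntegrableOn v (ball x (R / 4)) :=
    hv.intB ((closedBall_subset_closedBall (by linarith)).trans (cx.cb1 hx))
  have h3 : lam * (s ^ N * vN N) ≤ ∫ w in ball x (R / 4), v w := by
    have a1 : ∫ w in ball p s, lam = lam * (s ^ N * vN N) := by
      rw [setIntegral_const, ← vol_ball p hs, smul_eq_mul, mul_comm]; rfl
    rw [← a1]
    calc ∫ w in ball p s, lam ≤ ∫ w in ball p s, v w := by
          refine setIntegral_mono_on (integrableOn_const measure_ball_lt_top.ne) (hI.mono_set hsub)
            measurableSet_ball hlv
      _ ≤ _ := by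
          refine setIntegral_mono_set hI ?_ hsub.eventuallyLE
          exact (ae_restrict_iff' measurableSet_ball).2 (Eventually.of_forall fun w hw => h0 w (hsubR hw))
  have h4 : (K⁻¹) ^ N ≤ (R ^ N)⁻¹ * s ^ N := by
    rw [← inv_pow, ← mul_pow]
    refine pow_le_pow_left₀ (by positivity) ?_ N
    rw [inv_mul_eq_div, le_div_iff₀ hR, inv_mul_eq_div, div_le_iff₀ hK0]; linarith
  calc lam * cc N K ≤ lam * (c0 N / 2 * vN N * (K⁻¹) ^ N) :=
        mul_le_mul_of_nonneg_left (min_le_right _ _) hl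
    _ ≤ lam * (c0 N / 2 * vN N * ((R ^ N)⁻¹ * s ^ N)) := by gcongr
    _ = 1 / 2 * (c0 N * ((R ^ N)⁻¹ * (lam * (s ^ N * vN N)))) := by ring
    _ ≤ 1 / 2 * (c0 N * ((R ^ N)⁻¹ * ∫ w in ball x (R / 4), v w)) := by gcongr
    _ ≤ _ := by linarith

def CH (N : ℕ) (K : ℝ) : ℝ := 2 * C2 N / c0 N * K ^ N
lemma CH_pos {K : ℝ} (hK : 0 < K) : 0 < CH N K := by
  have := c0_pos (N := N); have := C2_pos (N := N)
  unfold CH; positivity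

lemma L3 (cx : Cx Ω V ε) {u : ES N → ℝ} (hu : Good Ω u) {x p : ES N} (hx : x ∈ Ω)
    (h0 : ∀ w ∈ closedBall x (RR Ω ε x), 0 ≤ u w) {s K : ℝ} (hs : 0 < s)
    (hsub : ball p s ⊆ ball x (RR Ω ε x / 4)) (hK : RR Ω ε x ≤ K * s)
    (hp : u p ≤ C2 N * ((s ^ N)⁻¹ * ∫ w in ball p s, u w)) : u p ≤ CH N K * TT Ω V ε u x := by
  have hR := cx.Rpos hx
  have hc := c0_pos (N := N)
  have hC := C2_pos (N := N)
  have hK0 : 0 < K := by by_contra h; push Not at h; nlinarith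
  have h1 := Ev_le_TT cx hx hu h0
  have h2 := L1 cx hu hx h0
  set R := RR Ω ε x with hRd
  have hsubR : ball x (R / 4) ⊆ closedBall x R :=
    (ball_subset_ball (by linarith)).trans ball_subset_closedBall
  have hI : IntegrableOn u (ball x (R / 4)) :=
    hu.intB ((closedBall_subset_closedBall (by linarith)).trans (cx.cb1 hx))
  have hae : 0 ≤ᵐ[volume.restrict (ball x (R / 4))] u :=
    (ae_restrict_iff' measurableSet_ball).2 (Eventually.of_forall fun w hw => h0 w (hsubR hw))
  have h3 : ∫ w in ball p s, u w ≤ ∫ w in ball x (R / 4), u w :=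
    setIntegral_mono_set hI hae hsub.eventuallyLE
  have h30 : 0 ≤ ∫ w in ball x (R / 4), u w := integral_nonneg_of_ae hae
  have h4 : (s ^ N)⁻¹ ≤ K ^ N * (R ^ N)⁻¹ := by
    rw [← inv_pow, ← inv_pow, ← mul_pow]
    refine pow_le_pow_left₀ (by positivity) ?_ N
    rw [← div_eq_mul_inv, le_div_iff₀ hR, inv_mul_eq_div, div_le_iff₀ hs]; linarith
  calc u p ≤ C2 N * ((s ^ N)⁻¹ * ∫ w in ball p s, u w) := hp
    _ ≤ C2 N * ((s ^ N)⁻¹ * ∫ w in ball x (R / 4), u w) := by gcongr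
    _ ≤ C2 N * ((K ^ N * (R ^ N)⁻¹) * ∫ w in ball x (R / 4), u w) := by gcongr
    _ = C2 N / c0 N * K ^ N * (c0 N * ((R ^ N)⁻¹ * ∫ w in ball x (R / 4), u w)) := by field_simp
    _ ≤ C2 N / c0 N * K ^ N * (2 * TT Ω V ε u x) := by
        refine mul_le_mul_of_nonneg_left (by linarith) (by positivity)
    _ = _ := by unfold CH; ring

lemma ball_sub3 {p q w : ES N} {s r : ℝ} (h : dist p q ≤ s) (hw : w ∈ ball q s) (hr : 3 * s ≤ r) :
    ball p s ⊆ ball w r := by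
  intro y hy
  rw [mem_ball] at *
  calc dist y w ≤ dist y p + dist p q + dist q w := dist_triangle4 _ _ _ _
    _ < r := by rw [dist_comm q w]; linarith

/-- one step of the weak Harnack chain -/
lemma step_sup (cx : Cx Ω V ε) {v : ES N → ℝ} (hv : Good Ω v) {p q : ES N} {s lam K : ℝ} (hs : 0 < s)
    (hl : 0 ≤ lam) (hpq : dist p q ≤ s)
    (hS : ∀ w ∈ ball q s, w ∈ Ω ∧ SupAt Ω V ε v w ∧ 12 * s ≤ RR Ω ε w ∧ RR Ω ε w ≤ K * s)
    (hp : ∀ w ∈ ball p s, lam ≤ v w) : ∀ w ∈ ball q s, lam * cc N K ≤ v w := by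
  intro w hw
  obtain ⟨a, b, c, d⟩ := hS w hw
  exact (L2 cx hv a b.1 hs hl (ball_sub3 hpq hw (by linarith)) d hp).trans b.2

lemma seg_sup (cx : Cx Ω V ε) {v : ES N → ℝ} (hv : Good Ω v) {p q : ES N} {s lam K : ℝ} (hs : 0 < s)
    (hK : 0 < K) (hl : 0 ≤ lam) (n : ℕ) (hpq : ‖q - p‖ ≤ n * s)
    (hS : ∀ t ∈ Icc (0 : ℝ) 1, ∀ w ∈ ball (p + t • (q - p)) s,
      w ∈ Ω ∧ SupAt Ω V ε v w ∧ 12 * s ≤ RR Ω ε w ∧ RR Ω ε w ≤ K * s)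
    (hp : ∀ w ∈ ball p s, lam ≤ v w) : ∀ w ∈ ball q s, lam * cc N K ^ n ≤ v w := by
  rcases Nat.eq_zero_or_pos n with hn | hn
  · subst hn
    have : q = p := by
      rw [← sub_eq_zero, ← norm_le_zero_iff]; simpa using hpq
    subst this; simpa using hp
  have hn' : (0 : ℝ) < n := by exact_mod_cast hn
  have key : ∀ i : ℕ, i ≤ n → ∀ w ∈ ball (p + ((i : ℝ) / n) • (q - p)) s, lam * cc N K ^ i ≤ v w := by
    intro i
    induction i with
    | zero => intro _; simpa using hp
    | succ i ih =>
      intro hi w hw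
      have h1 := ih (by omega)
      rw [pow_succ, ← mul_assoc]
      refine step_sup cx hv hs (mul_nonneg hl (pow_nonneg (cc_pos hK).le _)) ?_ (hS _ ⟨by positivity, ?_⟩) h1 w hw
      · rw [dist_eq_norm, add_sub_add_left_eq_sub, ← sub_smul, norm_smul]
        have : ((i : ℝ) / n - ((i + 1 : ℕ) : ℝ) / n) = - (1 / n) := by push_cast; field_simp; ring
        rw [this, norm_neg, Real.norm_of_nonneg (by positivity), one_div, inv_mul_le_iff₀ hn']
        exact hpq
      · rw [div_le_one hn']; exact_mod_cast hi
  have := key n le_rfl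
  rwa [div_self hn'.ne', one_smul, add_sub_cancel] at this

/-- local lower bound for nice functions -/
lemma HB (cx : Cx Ω V ε) {u : ES N → ℝ} (hu : Good Ω u) {p : ES N} {s K : ℝ} (hs : 0 < s)
    (hp : NiceAt Ω V ε u p) (hS : ∀ w ∈ ball p s, w ∈ Ω ∧ SupAt Ω V ε u w ∧
      12 * s ≤ RR Ω ε w ∧ RR Ω ε w ≤ K * s) : ∀ w ∈ ball p s, u p * (CH N K)⁻¹ ≤ u w := by
  intro w hw
  obtain ⟨a, b, c, d⟩ := hS w hw
  obtain ⟨a', b', c', d'⟩ := hS p (mem_ball_self hs)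
  have hK : 0 < K := by by_contra h; push Not at h; nlinarith [cx.Rpos a]
  have := L3 cx hu a b.1 hs (ball_sub3 (by simp [hs.le]) hw (by linarith)) d (hp.2.2 s hs (by linarith))
  rw [← div_eq_mul_inv, div_le_iff₀ (CH_pos hK), mul_comm]
  exact this.trans (mul_le_mul_of_nonneg_left b.2 (CH_pos hK).le)

end


section


set_option linter.unusedVariables false

variable {N : ℕ} {Ω : Set (ES N)} {V : ES N → ℝ} {ε : ℝ}

structure Patch (Ω : Set (ES N)) (y0 e : ES N) (H : ES N → ℝ) (Λ r1 : ℝ) : Prop where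
  e1 : ‖e‖ = 1
  L1 : 1 ≤ Λ
  r0 : 0 < r1
  H0 : H y0 = 0
  lip : ∀ x w, |H x - H w| ≤ Λ * ‖x - w‖
  tr : ∀ x (t : ℝ), H (x + t • e) = H x + t
  mem : ∀ x ∈ ball y0 r1, (x ∈ Ω ↔ 0 < H x)
  fr : ∀ x ∈ ball y0 r1, (x ∈ frontier Ω ↔ H x = 0)
  dl : ∀ x ∈ ball y0 r1, x ∈ Ω → H x ≤ Λ * dista Ω x
  du : ∀ x ∈ ball y0 r1, x ∈ Ω → dista Ω x ≤ H x

lemma exists_patch (hΩ : IsLipschitzDomain Ω) (hne : (Ωᶜ).Nonempty) {y0 : ES N} (hy : y0 ∈ frontier Ω) :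
    ∃ e H Λ r1, Patch Ω y0 e H Λ r1 := by
  obtain ⟨ho, -, hl⟩ := hΩ
  obtain ⟨g, i, f, L, r0, hr0, hf, hfi, hm⟩ := hl y0 hy
  set e : ES N := g.symm (EuclideanSpace.single i 1) with he
  set H : ES N → ℝ := fun x => g x i - f (g x) with hH
  set Λ : ℝ := 1 + L with hΛ
  have hΛ1 : 1 ≤ Λ := by simp [hΛ]
  have hmem : ∀ x ∈ ball y0 r0, (x ∈ Ω ↔ 0 < H x) := fun x hx => by
    rw [hm x hx, hH]; simp
  have hlip : ∀ x w, |H x - H w| ≤ Λ * ‖x - w‖ := by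
    intro x w
    have h1 : |g x i - g w i| ≤ ‖x - w‖ := by
      have := PiLp.norm_apply_le (g x - g w) i
      rw [← map_sub, g.norm_map, map_sub] at this
      simpa using this
    have h2 : |f (g x) - f (g w)| ≤ L * ‖x - w‖ := by
      have := hf.dist_le_mul (g x) (g w)
      rwa [g.dist_map, Real.dist_eq, dist_eq_norm] at this
    calc |H x - H w| = |(g x i - g w i) - (f (g x) - f (g w))| := by rw [hH]; congr 1; ring
      _ ≤ |g x i - g w i| + |f (g x) - f (g w)| := abs_sub _ _
      _ ≤ _ := by rw [hΛ]; linarith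
  have htr : ∀ x (t : ℝ), H (x + t • e) = H x + t := by
    intro x t
    have h1 : g (x + t • e) = g x + t • EuclideanSpace.single i 1 := by
      rw [map_add, map_smul, he, g.apply_symm_apply]
    have h2 : f (g (x + t • e)) = f (g x) := by
      refine hfi _ _ fun j hj => ?_
      rw [h1]; simp [hj]
    simp only [hH]
    rw [h2, h1]
    simp; ring
  have hHc : Continuous H := by
    refine (LipschitzWith.of_dist_le_mul (K := Real.toNNReal Λ) fun x w => ?_).continuous
    rw [Real.dist_eq, dist_eq_norm, Real.coe_toNNReal _ (by linarith)]
    exact hlip x w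
  have hfr : ∀ x ∈ ball y0 r0, (x ∈ frontier Ω ↔ H x = 0) := by
    intro x hx
    rw [ho.frontier_eq]
    constructor
    · rintro ⟨h1, h2⟩
      rw [hmem x hx] at h2
      push Not at h2
      refine le_antisymm h2 ?_
      by_contra h3
      push Not at h3
      have h4 : ∀ᶠ y in 𝓝 x, H y < 0 ∧ y ∈ ball y0 r0 :=
        (hHc.continuousAt.eventually (gt_mem_nhds h3)).and (isOpen_ball.mem_nhds hx)
      obtain ⟨y, hy, h5, h6⟩ := ((mem_closure_iff_frequently.1 h1).and_eventually h4).exists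
      exact absurd ((hmem y h6).1 hy) (by linarith)
    · intro h
      refine ⟨?_, fun hc => by rw [hmem x hx, h] at hc; exact lt_irrefl _ hc⟩
      have hc : Continuous (fun t : ℝ => x + t • e) := by fun_prop
      have h1 : Tendsto (fun t : ℝ => x + t • e) (𝓝[>] 0) (𝓝 x) := by
        have := hc.tendsto 0
        simp only [zero_smul, add_zero] at this
        exact this.mono_left nhdsWithin_le_nhds
      refine mem_closure_of_tendsto h1 ?_
      filter_upwards [h1.eventually (isOpen_ball.mem_nhds hx), self_mem_nhdsWithin] with t h2 h3
      rw [hmem _ h2, htr, h, zero_add]; exact h3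
  have hH0 : H y0 = 0 := (hfr y0 (mem_ball_self hr0)).1 hy
  have hen : ‖e‖ = 1 := by rw [he, g.symm.norm_map]; simp
  have hHb : ∀ x, |H x| ≤ Λ * ‖x - y0‖ := fun x => by
    have := hlip x y0; rwa [hH0, sub_zero] at this
  have hle : r0 / (4 * Λ) ≤ r0 / 4 := by
    refine div_le_div_of_nonneg_left hr0.le (by norm_num) (by linarith)
  have hΛr : Λ * (r0 / (4 * Λ)) = r0 / 4 := by field_simp
  have hsub : ball y0 (r0 / (4 * Λ)) ⊆ ball y0 r0 := ball_subset_ball (by linarith)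
  have hHr : ∀ x ∈ ball y0 (r0 / (4 * Λ)), |H x| ≤ r0 / 4 := fun x hx => by
    refine (hHb x).trans ?_
    rw [mem_ball, dist_eq_norm] at hx
    rw [← hΛr]; gcongr
  refine ⟨e, H, Λ, r0 / (4 * Λ), ⟨hen, hΛ1, by positivity, hH0, hlip, htr, fun x hx => hmem x (hsub hx),
    fun x hx => hfr x (hsub hx), ?_, ?_⟩⟩
  · intro x hx hxΩ
    have h1 : H x / Λ ≤ dista Ω x := by
      refine (le_infDist hne).2 fun w hw => ?_
      rw [div_le_iff₀ (by linarith), dist_eq_norm]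
      by_cases hwb : w ∈ ball y0 r0
      · have h2 : H w ≤ 0 := by by_contra h; exact hw ((hmem w hwb).2 (not_le.1 h))
        have := (le_abs_self _).trans (hlip x w)
        linarith
      · have h2 := (le_abs_self _).trans (hHr x hx)
        rw [mem_ball, not_lt] at hwb
        rw [mem_ball] at hx
        have h3 := dist_triangle w x y0
        have h4 : r0 / 4 ≤ ‖x - w‖ := by rw [← dist_eq_norm, dist_comm]; linarith
        nlinarith
    rwa [div_le_iff₀ (by linarith), mul_comm] at h1
  · intro x hx hxΩ
    have h0 := (hmem x (hsub hx)).1 hxΩ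
    have h1 := (le_abs_self _).trans (hHr x hx)
    have h2 : x + (-H x) • e ∈ ball y0 r0 := by
      rw [mem_ball] at *
      calc dist (x + (-H x) • e) y0 ≤ dist (x + (-H x) • e) x + dist x y0 := dist_triangle _ _ _
        _ = H x + dist x y0 := by
            rw [dist_self_add_left, norm_smul, hen, mul_one, norm_neg, Real.norm_of_nonneg h0.le]
        _ < r0 := by linarith
    have h3 : x + (-H x) • e ∈ Ωᶜ := fun h => by
      rw [hmem _ h2, htr] at h; linarith
    have := infDist_le_dist_of_mem (x := x) h3
    rwa [dist_self_add_right, norm_smul, hen, mul_one, norm_neg, Real.norm_of_nonneg h0.le] at this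

variable {y0 e : ES N} {H : ES N → ℝ} {Λ r1 : ℝ}

lemma Patch.cont (P : Patch Ω y0 e H Λ r1) : Continuous H := by
  refine (LipschitzWith.of_dist_le_mul (K := Real.toNNReal Λ) fun x w => ?_).continuous
  rw [Real.dist_eq, dist_eq_norm, Real.coe_toNNReal _ (by linarith [P.L1])]
  exact P.lip x w

lemma Patch.ub (P : Patch Ω y0 e H Λ r1) (x w : ES N) : H x ≤ H w + Λ * dist x w := by
  have := (le_abs_self _).trans (P.lip x w)
  rw [dist_eq_norm]; linarith
lemma Patch.lb (P : Patch Ω y0 e H Λ r1) (x w : ES N) : H w - Λ * dist x w ≤ H x := by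
  have := P.ub w x
  rw [dist_comm] at this; linarith

def gK (Λ κ : ℝ) : ℝ := 192 * Λ ^ 3 / κ
def gn (Λ κ ε : ℝ) : ℕ := ⌈96 * Λ ^ 2 / (ε * κ)⌉₊
/-- graph chain -/
lemma GC (cx : Cx Ω V ε) (P : Patch Ω y0 e H Λ r1) {v : ES N → ℝ} (hv : Good Ω v)
    {b : ES N} {ϱ κ lam : ℝ} (hϱ : 0 < ϱ) (hκ : 0 < κ) (hκ1 : κ ≤ 1) (hb : H b = 0)
    (hsub : ball b (8 * Λ * ϱ) ⊆ ball y0 r1)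
    (hS : ∀ x ∈ Ω, x ∈ ball b (8 * Λ * ϱ) → κ * ϱ / 2 ≤ H x → SupAt Ω V ε v x)
    {w1 w2 : ES N} (h1 : w1 ∈ ball b (2 * ϱ)) (h2 : w2 ∈ ball b (2 * ϱ)) (hw1 : κ * ϱ ≤ H w1)
    (hw2 : κ * ϱ ≤ H w2) (hl : 0 ≤ lam) (hlv : ∀ w ∈ ball w1 (ε * κ * ϱ / (24 * Λ)), lam ≤ v w) :
    ∀ w ∈ ball w2 (ε * κ * ϱ / (24 * Λ)), lam * cc N (gK Λ κ) ^ (3 * gn Λ κ ε) ≤ v w := by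
  have hΛ := P.L1
  have he := cx.e0
  have he1 := cx.e1
  set s := ε * κ * ϱ / (24 * Λ) with hs
  have hs0 : 0 < s := by positivity
  have hsΛ : 24 * Λ * s = ε * κ * ϱ := by rw [hs]; field_simp
  have hsκ : Λ * s ≤ κ * ϱ / 2 := by
    have : ε * (κ * ϱ) ≤ 1 / 16 * (κ * ϱ) := by gcongr
    have h3 : 0 < κ * ϱ := by positivity
    linarith
  have hκϱ : κ * ϱ ≤ ϱ := mul_le_of_le_one_left hϱ.le hκ1
  have hss : s ≤ ϱ / 2 := by nlinarith
  have hK0 : 0 < gK Λ κ := by unfold gK; positivity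
  have hn : 4 * Λ * ϱ ≤ gn Λ κ ε * s := by
    have h3 := Nat.le_ceil (96 * Λ ^ 2 / (ε * κ))
    have h4 := mul_le_mul_of_nonneg_right h3 hs0.le
    refine le_trans (le_of_eq ?_) h4
    rw [hs]; field_simp; ring
  -- the main local fact
  have key : ∀ c ∈ ball b (6 * Λ * ϱ), κ * ϱ ≤ H c → ∀ w ∈ ball c s,
      w ∈ Ω ∧ SupAt Ω V ε v w ∧ 12 * s ≤ RR Ω ε w ∧ RR Ω ε w ≤ gK Λ κ * s := by
    intro c hc hHc w hw
    rw [mem_ball] at hc hw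
    have hwb : dist w b < 8 * Λ * ϱ := by
      have := dist_triangle w c b
      nlinarith
    have hHw : κ * ϱ / 2 ≤ H w := by
      have := P.lb w c
      have h3 : Λ * dist w c ≤ Λ * s := by gcongr
      linarith
    have hwy := hsub (mem_ball.2 hwb)
    have hwΩ : w ∈ Ω := (P.mem w hwy).2 (by have : 0 < κ * ϱ := by positivity
                                            linarith)
    refine ⟨hwΩ, hS w hwΩ hwb hHw, ?_, ?_⟩
    · have h3 := P.dl w hwy hwΩ
      have h4 : κ * ϱ / (2 * Λ) ≤ dista Ω w := by
        rw [div_le_iff₀ (by linarith)]; linarith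
      have : ε * (κ * ϱ / (2 * Λ)) ≤ RR Ω ε w := mul_le_mul_of_nonneg_left h4 he.le
      refine le_trans (le_of_eq ?_) this
      rw [hs]; field_simp; ring
    · have h3 := P.du w hwy hwΩ
      have h4 := P.ub w b
      rw [hb] at h4
      have h5 : dista Ω w ≤ 8 * Λ ^ 2 * ϱ := by nlinarith
      have : RR Ω ε w ≤ ε * (8 * Λ ^ 2 * ϱ) := mul_le_mul_of_nonneg_left h5 he.le
      refine this.trans (le_of_eq ?_)
      rw [hs, gK]; field_simp; ring
  set h := 4 * Λ * ϱ with hh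
  have hh0 : 0 < h := by positivity
  have hne : ∀ t : ℝ, 0 ≤ t → ‖t • e‖ = t := fun t ht => by
    rw [norm_smul, P.e1, mul_one, Real.norm_of_nonneg ht]
  rw [mem_ball] at h1 h2
  have up : ∀ w, dist w b < 2 * ϱ → κ * ϱ ≤ H w → ∀ t : ℝ, 0 ≤ t → t ≤ h →
      w + t • e ∈ ball b (6 * Λ * ϱ) ∧ κ * ϱ ≤ H (w + t • e) := by
    intro w hw hHw t ht0 hth
    refine ⟨?_, by rw [P.tr]; linarith⟩
    rw [mem_ball]
    have := dist_triangle (w + t • e) w b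
    rw [dist_self_add_left, hne t ht0] at this
    nlinarith
  have s1 := seg_sup cx hv (p := w1) (q := w1 + h • e) hs0 hK0 hl (gn Λ κ ε)
    (by rw [add_sub_cancel_left, hne h hh0.le]; exact hn)
    (by
      intro t ht
      rw [add_sub_cancel_left, smul_smul]
      have := up w1 h1 hw1 (t * h) (mul_nonneg ht.1 hh0.le) (mul_le_of_le_one_left hh0.le ht.2)
      exact key _ this.1 this.2) hlv
  have hl1 : 0 ≤ lam * cc N (gK Λ κ) ^ gn Λ κ ε := mul_nonneg hl (pow_nonneg (cc_pos hK0).le _)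
  have s2 := seg_sup cx hv (p := w1 + h • e) (q := w2 + h • e) hs0 hK0 hl1 (gn Λ κ ε)
    (by
      rw [add_sub_add_right_eq_sub, ← dist_eq_norm]
      refine le_trans ?_ hn
      have := dist_triangle w2 b w1
      rw [dist_comm b w1] at this
      nlinarith)
    (by
      intro t ht
      have h3 : w1 + h • e + t • (w2 + h • e - (w1 + h • e)) = (w1 + t • (w2 - w1)) + h • e := by
        rw [add_sub_add_right_eq_sub]; abel
      rw [h3]
      have h4 : w1 + t • (w2 - w1) ∈ ball b (2 * ϱ) :=
        (convex_ball b (2 * ϱ)).add_smul_sub_mem h1 h2 ht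
      rw [mem_ball] at h4
      refine key _ ?_ ?_
      · rw [mem_ball]
        have := dist_triangle (w1 + t • (w2 - w1) + h • e) (w1 + t • (w2 - w1)) b
        rw [dist_self_add_left, hne h hh0.le] at this
        nlinarith
      · rw [P.tr]
        have := P.lb (w1 + t • (w2 - w1)) b
        rw [hb] at this
        nlinarith) s1
  have hl2 : 0 ≤ lam * cc N (gK Λ κ) ^ gn Λ κ ε * cc N (gK Λ κ) ^ gn Λ κ ε :=
    mul_nonneg hl1 (pow_nonneg (cc_pos hK0).le _)
  have s3 := seg_sup cx hv (p := w2 + h • e) (q := w2) hs0 hK0 hl2 (gn Λ κ ε)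
    (by rw [sub_add_cancel_left, norm_neg, hne h hh0.le]; exact hn)
    (by
      intro t ht
      have h3 : w2 + h • e + t • (w2 - (w2 + h • e)) = w2 + ((1 - t) * h) • e := by
        rw [sub_add_cancel_left]; module
      rw [h3]
      have := up w2 h2 hw2 ((1 - t) * h) (mul_nonneg (by linarith [ht.2]) hh0.le)
        (mul_le_of_le_one_left hh0.le (by linarith [ht.1]))
      exact key _ this.1 this.2) s2
  intro w hw
  have := s3 w hw
  rw [show 3 * gn Λ κ ε = gn Λ κ ε + gn Λ κ ε + gn Λ κ ε by ring, pow_add, pow_add]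
  rw [← mul_assoc, ← mul_assoc]; exact this

def gCt (N : ℕ) (Λ κ ε : ℝ) : ℝ := CH N (gK Λ κ) * (cc N (gK Λ κ) ^ (3 * gn Λ κ ε))⁻¹

lemma gCt_pos (hΛ : 1 ≤ Λ) {κ : ℝ} (hκ : 0 < κ) : 0 < gCt N Λ κ ε := by
  have hK0 : 0 < gK Λ κ := by unfold gK; positivity
  have := CH_pos (N := N) hK0
  have := cc_pos (N := N) hK0
  unfold gCt; positivity

/-- graph Harnack for nice functions, with a ball at the target -/
lemma GH (cx : Cx Ω V ε) (P : Patch Ω y0 e H Λ r1) {v : ES N → ℝ} (hv : Good Ω v)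
    {b : ES N} {ϱ κ : ℝ} (hϱ : 0 < ϱ) (hκ : 0 < κ) (hκ1 : κ ≤ 1) (hb : H b = 0)
    (hsub : ball b (8 * Λ * ϱ) ⊆ ball y0 r1)
    (hS : ∀ x ∈ Ω, x ∈ ball b (8 * Λ * ϱ) → κ * ϱ / 2 ≤ H x → NiceAt Ω V ε v x)
    {w1 w2 : ES N} (h1 : w1 ∈ ball b (2 * ϱ)) (h2 : w2 ∈ ball b (2 * ϱ)) (hw1 : κ * ϱ ≤ H w1)
    (hw2 : κ * ϱ ≤ H w2) :
    ∀ w ∈ ball w2 (ε * κ * ϱ / (24 * Λ)), v w1 ≤ gCt N Λ κ ε * v w := by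
  have hΛ := P.L1
  have he := cx.e0
  have he1 := cx.e1
  have hK0 : 0 < gK Λ κ := by unfold gK; positivity
  have hCH := CH_pos (N := N) hK0
  have hcc := pow_pos (cc_pos (N := N) hK0) (3 * gn Λ κ ε)
  set s := ε * κ * ϱ / (24 * Λ) with hs
  have hs0 : 0 < s := by positivity
  have hsΛ : 24 * Λ * s = ε * κ * ϱ := by rw [hs]; field_simp
  have h3 : 0 < κ * ϱ := by positivity
  have hsκ : Λ * s ≤ κ * ϱ / 2 := by
    have : ε * (κ * ϱ) ≤ 1 / 16 * (κ * ϱ) := by gcongr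
    linarith
  have hκϱ : κ * ϱ ≤ ϱ := mul_le_of_le_one_left hϱ.le hκ1
  have hss : s ≤ ϱ / 2 := by nlinarith
  have key : ∀ w ∈ ball w1 s,
      w ∈ Ω ∧ NiceAt Ω V ε v w ∧ 12 * s ≤ RR Ω ε w ∧ RR Ω ε w ≤ gK Λ κ * s := by
    intro w hw
    rw [mem_ball] at h1 hw
    have hwb : dist w b < 8 * Λ * ϱ := by
      have := dist_triangle w w1 b
      nlinarith
    have hHw : κ * ϱ / 2 ≤ H w := by
      have := P.lb w w1
      have h3 : Λ * dist w w1 ≤ Λ * s := by gcongr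
      linarith
    have hwy := hsub (mem_ball.2 hwb)
    have hwΩ : w ∈ Ω := (P.mem w hwy).2 (by linarith)
    refine ⟨hwΩ, hS w hwΩ hwb hHw, ?_, ?_⟩
    · have h3 := P.dl w hwy hwΩ
      have h4 : κ * ϱ / (2 * Λ) ≤ dista Ω w := by
        rw [div_le_iff₀ (by linarith)]; linarith
      have : ε * (κ * ϱ / (2 * Λ)) ≤ RR Ω ε w := mul_le_mul_of_nonneg_left h4 he.le
      refine le_trans (le_of_eq ?_) this
      rw [hs]; field_simp; ring
    · have h3 := P.du w hwy hwΩ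
      have h4 := P.ub w b
      rw [hb] at h4
      have h5 : dista Ω w ≤ 8 * Λ ^ 2 * ϱ := by nlinarith
      have : RR Ω ε w ≤ ε * (8 * Λ ^ 2 * ϱ) := mul_le_mul_of_nonneg_left h5 he.le
      refine this.trans (le_of_eq ?_)
      rw [hs, gK]; field_simp; ring
  have hw1s := key w1 (mem_ball_self hs0)
  have h4 := HB cx hv hs0 hw1s.2.1 (fun w hw => ⟨(key w hw).1, (key w hw).2.1.sup, (key w hw).2.2⟩)
  have h5 := GC cx P hv hϱ hκ hκ1 hb hsub (fun x a b c => (hS x a b c).sup) h1 h2 hw1 hw2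
    (mul_nonneg (hw1s.2.1.sup.nonneg cx hw1s.1) (inv_nonneg.2 hCH.le)) h4
  intro w hw
  have := h5 w hw
  rw [gCt]
  set q := cc N (gK Λ κ) ^ (3 * gn Λ κ ε)
  have h6 := mul_le_mul_of_nonneg_left this (by positivity : 0 ≤ CH N (gK Λ κ) * q⁻¹)
  refine le_trans (le_of_eq ?_) h6
  field_simp

end


section


set_option linter.unusedVariables false

variable {N : ℕ} {Ω : Set (ES N)} {V : ES N → ℝ} {ε : ℝ}
variable {y0 e : ES N} {H : ES N → ℝ} {Λ r1 : ℝ}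

def thB (N : ℕ) (Λ : ℝ) : ℝ := 64 * Λ ^ 2 / k1 N
def th (N : ℕ) (Λ : ℝ) : ℝ := (1 - Real.exp (-(thB N Λ / 16))) / (1 - Real.exp (-(9 * thB N Λ / 64)))

lemma thB_pos (h : 1 ≤ Λ) : 0 < thB N Λ := by
  have := k1_pos (N := N); unfold thB; positivity
lemma th_den (h : 1 ≤ Λ) : 0 < 1 - Real.exp (-(9 * thB N Λ / 64)) := by
  have := thB_pos (N := N) h
  rw [sub_pos, Real.exp_lt_one_iff]; linarith
lemma th_pos (h : 1 ≤ Λ) : 0 < th N Λ := by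
  have := thB_pos (N := N) h
  refine div_pos ?_ (th_den h)
  rw [sub_pos, Real.exp_lt_one_iff]; linarith
lemma th_lt (h : 1 ≤ Λ) : th N Λ < 1 := by
  have := thB_pos (N := N) h
  rw [th, div_lt_one (th_den h)]
  have : Real.exp (-(9 * thB N Λ / 64)) < Real.exp (-(thB N Λ / 16)) := Real.exp_lt_exp.2 (by linarith)
  linarith

/-- decay lemma -/
lemma DL (cx : Cx Ω V ε) (P : Patch Ω y0 e H Λ r1) (hε : 32 * Λ ^ 2 * ε ^ 2 ≤ k1 N)
    {q : ES N → ℝ} (hq : Good Ω q) {y : ES N} {ρ S : ℝ} (hρ : 0 < ρ) (hS : 0 ≤ S) (hy : H y = 0)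
    (hsub : ball y ρ ⊆ ball y0 r1) (hq0 : ∀ x ∈ Ω, x ∈ ball y ρ → q x ≤ S)
    (hqs : ∀ x ∈ Ω, x ∈ ball y (ρ / 2) → 0 < q x → q x ≤ Ev Ω ε q x)
    (hqb : ∀ w ∈ frontier Ω, w ∈ closedBall y (ρ / 2) →
      Tendsto (fun x => max (q x) 0) (𝓝[Ω] w) (𝓝 0)) :
    ∀ x ∈ Ω, x ∈ ball y (ρ / 8) → q x ≤ th N Λ * S := by
  have hΛ := P.L1
  have hk := k1_pos (N := N)
  have he := cx.e0
  have hB := thB_pos (N := N) hΛ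
  set B := thB N Λ with hBd
  set p := y + (-(ρ / 8)) • e with hp
  have hyp : dist y p = ρ / 8 := by
    rw [hp, dist_self_add_right, norm_smul, P.e1, mul_one, norm_neg, Real.norm_of_nonneg (by positivity)]
  have hHp : H p = -(ρ / 8) := by rw [hp, P.tr, hy, zero_add]
  set β := B / ρ ^ 2 with hβ
  have hβ0 : 0 < β := by positivity
  have hβρ : β * ρ ^ 2 = B := by rw [hβ]; field_simp
  have hyΩ : y ∈ Ωᶜ := fun h => by
    rw [P.mem y (hsub (mem_ball_self hρ)), hy] at h; exact lt_irrefl _ h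
  set f : ES N → ℝ := fun x => Real.exp (-(β * ‖x - p‖ ^ 2)) with hf
  have hfc : Continuous f := by fun_prop
  set D := 1 - Real.exp (-(9 * B / 64)) with hD
  have hD0 : 0 < D := th_den hΛ
  set Φ : ES N → ℝ := fun x => S / D - S / D * f x with hΦ
  have hSD : 0 ≤ S / D := by positivity
  have hΦc : Continuous Φ := by fun_prop
  have hf1 : ∀ x, f x ≤ 1 := fun x => by
    rw [hf]; simp only; rw [Real.exp_le_one_iff]
    have : 0 ≤ β * ‖x - p‖ ^ 2 := by positivity
    linarith
  have hΦ0 : ∀ x, 0 ≤ Φ x := fun x => by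
    have := mul_le_mul_of_nonneg_left (hf1 x) hSD
    simp only [hΦ]; linarith
  have hΦS : ∀ x, ρ / 2 ≤ dist x y → S ≤ Φ x := by
    intro x hx
    have h1 : 3 * ρ / 8 ≤ ‖x - p‖ := by
      rw [← dist_eq_norm]
      have := dist_triangle x p y
      rw [dist_comm p y] at this; linarith
    have h2 : 9 * B / 64 ≤ β * ‖x - p‖ ^ 2 := by
      have : (3 * ρ / 8) ^ 2 ≤ ‖x - p‖ ^ 2 := by gcongr
      have := mul_le_mul_of_nonneg_left this hβ0.le
      rw [← hβρ]; linarith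
    have h3 : f x ≤ Real.exp (-(9 * B / 64)) := Real.exp_le_exp.2 (by linarith)
    have h4 : D ≤ 1 - f x := by rw [hD]; linarith
    calc S = S / D * D := by field_simp
      _ ≤ S / D * (1 - f x) := by gcongr
      _ = Φ x := by rw [hΦ]; ring
  have hΦG : Good Ω Φ := Good.of_cont hΦc.continuousOn hΦc.measurable cx.op
  have hfG : Good Ω f := Good.of_cont hfc.continuousOn hfc.measurable cx.op
  have hdy : ∀ z, dista Ω z ≤ dist z y := fun z => infDist_le_dist_of_mem hyΩ
  have hΦE : ∀ z ∈ Ω, z ∈ ball y (ρ / 2) → Ev Ω ε Φ z ≤ Φ z := by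
    intro z hz hzb
    have hzy := hsub (ball_subset_ball (by linarith) hzb)
    have h1 := hdy z
    rw [mem_ball] at hzb
    have hzp : ρ / (8 * Λ) ≤ ‖z - p‖ := by
      have := P.ub z p
      have h2 := (P.mem z hzy).1 hz
      rw [hHp, dist_eq_norm] at this
      rw [div_le_iff₀ (by positivity)]; linarith
    have hb := barrier cx hz (p := p) hβ0 (by
      have h3 : RR Ω ε z ≤ ε * (ρ / 2) := mul_le_mul_of_nonneg_left (by linarith) he.le
      have h4 : RR Ω ε z ^ 2 ≤ (ε * (ρ / 2)) ^ 2 := by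
        have := cx.Rpos hz; gcongr
      have h5 := mul_le_mul_of_nonneg_left h4 hβ0.le
      have h6 : β * (ε * (ρ / 2)) ^ 2 = B * ε ^ 2 / 4 := by rw [← hβρ]; ring
      have h7 : B * ε ^ 2 = 64 * Λ ^ 2 * ε ^ 2 / k1 N := by rw [hBd, thB]; ring
      have h8 : 64 * Λ ^ 2 * ε ^ 2 / k1 N ≤ 2 := by rw [div_le_iff₀ hk]; linarith
      linarith) (by
      have h3 : (ρ / (8 * Λ)) ^ 2 ≤ ‖z - p‖ ^ 2 := by gcongr
      have h4 : β * (ρ / (8 * Λ)) ^ 2 * k1 N = 1 := by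
        rw [hβ, hBd, thB]; field_simp; norm_num
      rw [← h4]; gcongr)
    have h2 : Ev Ω ε Φ z = S / D - S / D * Ev Ω ε f z := by
      rw [hΦ, Ev_sub cx hz (Good.const _) (hfG.cmul _), Ev_const, Ev_cmul]
    rw [h2]
    have := mul_le_mul_of_nonneg_left hb hSD
    simp only [hΦ, hf]; linarith
  set Q : Set (ES N) := Ω ∩ ball y (ρ / 2) with hQ
  have hQm : MeasurableSet Q := cx.op.measurableSet.inter measurableSet_ball
  set qt : ES N → ℝ := Q.indicator (fun x => max (q x - Φ x) 0) with hqt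
  have hqtG : Good Ω qt := ((hq.sub hΦG).max0 cx.op).ind cx.op hQm
  have hqt0 : ∀ x, 0 ≤ qt x := fun x => indicator_nonneg (fun _ _ => le_max_right _ _) _
  have hmain : ∀ x ∈ Ω, qt x ≤ 0 := by
    refine MP cx hqtG (fun x _ => hqt0 x) ?_ ?_
    · intro z hz hpos
      have hzQ : z ∈ Q := by by_contra h; simp [hqt, indicator_of_notMem h] at hpos
      rw [hqt, indicator_of_mem hzQ] at hpos
      have h1 : 0 < q z - Φ z := by
        by_contra h; rw [max_eq_right (not_lt.1 h)] at hpos; exact lt_irrefl _ hpos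
      have h2 : qt z = q z - Φ z := by rw [hqt, indicator_of_mem hzQ, max_eq_left h1.le]
      have h3 := hqs z hz hzQ.2 (by linarith [hΦ0 z])
      have h4 := hΦE z hz hzQ.2
      have h5 : Ev Ω ε (fun x => q x - Φ x) z ≤ Ev Ω ε qt z := by
        refine Ev_mono cx hz (hq.sub hΦG) hqtG fun w hw => ?_
        have hwΩ := cx.cb1 hz hw
        by_cases hwQ : w ∈ Q
        · rw [hqt, indicator_of_mem hwQ]; exact le_max_left _ _
        · rw [hqt, indicator_of_notMem hwQ]
          have hwd : ρ / 2 ≤ dist w y := by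
            by_contra h; exact hwQ ⟨hwΩ, mem_ball.2 (not_le.1 h)⟩
          have hwρ : w ∈ ball y ρ := by
            rw [mem_closedBall] at hw
            have a1 := hdy z
            have a2 := hzQ.2
            rw [mem_ball] at a2 ⊢
            have a3 : RR Ω ε z ≤ 1 / 16 * dista Ω z := mul_le_mul_of_nonneg_right cx.e1 (dista_nonneg z)
            have := dist_triangle w z y
            linarith
          have := hq0 w hwΩ hwρ
          have := hΦS w hwd
          linarith
      rw [Ev_sub cx hz hq hΦG] at h5
      rw [h2]; linarith
    · intro w hw
      by_cases hwb : w ∈ closedBall y (ρ / 2)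
      · refine tendsto_of_tendsto_of_tendsto_of_le_of_le tendsto_const_nhds (hqb w hw hwb) hqt0 fun x => ?_
        by_cases hx : x ∈ Q
        · rw [hqt, indicator_of_mem hx]
          exact max_le_max (by linarith [hΦ0 x]) le_rfl
        · rw [hqt, indicator_of_notMem hx]; exact le_max_right _ _
      · have h1 : ∀ᶠ x in 𝓝 w, qt x = 0 := by
          filter_upwards [isClosed_closedBall.isOpen_compl.mem_nhds hwb] with x hx
          exact indicator_of_notMem (fun h => hx (ball_subset_closedBall h.2)) _
        exact tendsto_const_nhds.congr' (h1.filter_mono nhdsWithin_le_nhds |>.mono fun x hx => hx.symm)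
  intro x hx hxb
  have hxQ : x ∈ Q := ⟨hx, ball_subset_ball (by linarith) hxb⟩
  have h1 := hmain x hx
  rw [hqt, indicator_of_mem hxQ] at h1
  have h2 : q x ≤ Φ x := by linarith [(le_max_left (q x - Φ x) 0).trans h1]
  refine h2.trans ?_
  have h3 : ‖x - p‖ ≤ ρ / 4 := by
    rw [← dist_eq_norm]
    rw [mem_ball] at hxb
    have := dist_triangle x y p
    linarith
  have h4 : β * ‖x - p‖ ^ 2 ≤ B / 16 := by
    have : ‖x - p‖ ^ 2 ≤ (ρ / 4) ^ 2 := by gcongr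
    have := mul_le_mul_of_nonneg_left this hβ0.le
    rw [← hβρ]; linarith
  have h5 : Real.exp (-(B / 16)) ≤ f x := Real.exp_le_exp.2 (by linarith)
  have h6 := mul_le_mul_of_nonneg_left h5 hSD
  calc Φ x ≤ S / D * (1 - Real.exp (-(B / 16))) := by simp only [hΦ]; linarith
    _ = th N Λ * S := by rw [th, ← hBd, ← hD]; ring

end


section


set_option linter.unusedVariables false

variable {N : ℕ} {Ω : Set (ES N)} {V : ES N → ℝ} {ε : ℝ}
variable {y0 e : ES N} {H : ES N → ℝ} {Λ r1 : ℝ}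

lemma bdd_of_vanish (ho : IsOpen Ω) {u : ES N → ℝ} (hu : Good Ω u) {K : Set (ES N)} (hK : IsCompact K)
    (hb : ∀ w ∈ frontier Ω, w ∈ K → Tendsto u (𝓝[Ω] w) (𝓝 0)) : ∃ C, ∀ x ∈ K, x ∈ Ω → u x ≤ C := by
  refine hK.induction_on (p := fun s => ∃ C, ∀ x ∈ s, x ∈ Ω → u x ≤ C) ⟨0, by simp⟩ ?_ ?_ ?_
  · rintro s t hst ⟨C, hC⟩; exact ⟨C, fun x hx => hC x (hst hx)⟩
  · rintro s t ⟨C, hC⟩ ⟨D, hD⟩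
    refine ⟨max C D, ?_⟩
    rintro x (hx | hx) hx2
    · exact (hC x hx hx2).trans (le_max_left _ _)
    · exact (hD x hx hx2).trans (le_max_right _ _)
  · intro x hx
    by_cases hxΩ : x ∈ Ω
    · obtain ⟨C, hC⟩ := hu.2 x hxΩ
      exact ⟨_, mem_nhdsWithin_of_mem_nhds hC, C, fun y hy _ => (le_abs_self _).trans hy⟩
    · by_cases hxc : x ∈ closure Ω
      · have hf : x ∈ frontier Ω := by rw [ho.frontier_eq]; exact ⟨hxc, hxΩ⟩
        have := (hb x hf hx).eventually (gt_mem_nhds one_pos)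
        rw [eventually_nhdsWithin_iff] at this
        exact ⟨_, mem_nhdsWithin_of_mem_nhds this, 1, fun y hy hyΩ => (hy hyΩ).le⟩
      · exact ⟨_, mem_nhdsWithin_of_mem_nhds (isClosed_closure.isOpen_compl.mem_nhds hxc), 0,
          fun y hy hyΩ => absurd (subset_closure hyΩ) hy⟩

lemma Patch.ne (P : Patch Ω y0 e H Λ r1) {t : ℝ} (ht : 0 ≤ t) : ‖t • e‖ = t := by
  rw [norm_smul, P.e1, mul_one, Real.norm_of_nonneg ht]
lemma Patch.de (P : Patch Ω y0 e H Λ r1) (x : ES N) {t : ℝ} (ht : 0 ≤ t) : dist (x + t • e) x = t := by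
  rw [dist_self_add_left, P.ne ht]

/-- growth of nice functions near the boundary -/
lemma growth (cx : Cx Ω V ε) (P : Patch Ω y0 e H Λ r1) : ∃ (p : ℕ) (C : ℝ), 0 < C ∧
    ∀ (u : ES N → ℝ) (z : ES N) (ρ : ℝ), Good Ω u → 0 < ρ → H z = 0 →
      ball z (40 * Λ ^ 2 * ρ) ⊆ ball y0 r1 →
      (∀ x ∈ Ω, x ∈ ball z (40 * Λ ^ 2 * ρ) → NiceAt Ω V ε u x) →
      ∀ x ∈ Ω, x ∈ ball z (2 * ρ) → u x * H x ^ p ≤ C * ρ ^ p * u (z + ρ • e) := by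
  have hΛ := P.L1
  set C' := gCt N Λ (1 / 2) ε with hC'
  have hC'0 : 0 < C' := gCt_pos hΛ (by norm_num)
  set p := ⌈C'⌉₊ with hp
  have hCp : C' ≤ 2 ^ p := by
    have h1 := Nat.le_ceil C'
    have h2 : ((p : ℕ) : ℝ) ≤ 2 ^ p := by exact_mod_cast Nat.lt_two_pow_self.le
    exact h1.trans h2
  set C := gCt N Λ (1 / (5 * Λ)) ε with hC
  have hC0 : 0 < C := gCt_pos hΛ (by positivity)
  refine ⟨p, (4 * Λ) ^ p * C, by positivity, ?_⟩
  intro u z ρ hu hρ hz hsub hn x hx hxz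
  have hr : 4 * Λ * ρ ≤ 4 * Λ ^ 2 * ρ := by
    have : 4 * Λ ≤ 4 * Λ ^ 2 := by nlinarith
    gcongr
  have hρΛ : ρ ≤ Λ * ρ := by nlinarith
  have hρ2 : Λ * ρ ≤ Λ ^ 2 * ρ := by nlinarith
  set K := 40 * Λ ^ 2 * ρ with hK
  have hxy : x ∈ ball y0 r1 := hsub (ball_subset_ball (by linarith) hxz)
  have hHx := (P.mem x hxy).1 hx
  rw [mem_ball] at hxz
  have hHx2 : H x < 2 * Λ * ρ := by
    have := P.ub x z
    rw [hz] at this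
    nlinarith
  set b := x + (-H x) • e with hb
  have hHb : H b = 0 := by rw [hb, P.tr]; ring
  have hxb : x = b + H x • e := by rw [hb]; simp
  have hbz : dist b z < 4 * Λ * ρ := by
    have := dist_triangle b x z
    have hbx : dist b x = H x := by
      rw [hb, dist_self_add_left, neg_smul, norm_neg, P.ne hHx.le]
    linarith
  have hA : H (z + ρ • e) = ρ := by rw [P.tr, hz, zero_add]
  have hAd := P.de z hρ.le
  -- points b + t e
  have hbase : ∀ t, 2 * Λ * ρ ≤ t → t ≤ 4 * Λ * ρ → u (b + t • e) ≤ C * u (z + ρ • e) := by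
    intro t ht1 ht2
    have ht0 : 0 ≤ t := by nlinarith
    have hs : 8 * Λ * (5 * Λ * ρ) = K := by rw [hK]; ring
    refine GH cx P hu (b := z) (ϱ := 5 * Λ * ρ) (κ := 1 / (5 * Λ)) (by positivity) (by positivity)
      (by rw [div_le_one (by positivity)]; linarith) hz (by rw [hs]; exact hsub)
      (fun w hw hwb _ => hn w hw (by rwa [hs] at hwb)) (w1 := b + t • e) (w2 := z + ρ • e)
      ?_ ?_ ?_ ?_ _ (mem_ball_self ?_)
    · rw [mem_ball]
      have := dist_triangle (b + t • e) b z
      rw [P.de b ht0] at this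
      linarith
    · rw [mem_ball, hAd]; linarith
    · rw [P.tr, hHb]; field_simp; linarith
    · rw [hA]; field_simp; linarith
    · have := cx.e0; positivity
  have hnn : 0 ≤ u (z + ρ • e) := by
    have h1 : z + ρ • e ∈ ball z K := by rw [mem_ball, hAd]; linarith
    have h2 : z + ρ • e ∈ Ω := (P.mem _ (hsub h1)).2 (by rw [hA]; exact hρ)
    exact (hn _ h2 h1).sup.nonneg cx h2
  have hdbl : ∀ t, 0 < t → t < 2 * Λ * ρ → u (b + t • e) ≤ C' * u (b + (2 * t) • e) := by
    intro t ht0 ht1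
    have hs : ball b (8 * Λ * (2 * t)) ⊆ ball z K := by
      refine ball_subset_ball' ?_
      have : Λ * t ≤ 2 * Λ ^ 2 * ρ := by nlinarith
      linarith
    refine GH cx P hu (b := b) (ϱ := 2 * t) (κ := 1 / 2) (by positivity) (by positivity)
      (by norm_num) hHb (hs.trans hsub)
      (fun w hw hwb _ => hn w hw (hs hwb)) (w1 := b + t • e) (w2 := b + (2 * t) • e)
      ?_ ?_ ?_ ?_ _ (mem_ball_self ?_)
    · rw [mem_ball, P.de b ht0.le]; linarith
    · rw [mem_ball, P.de b (by linarith)]; linarith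
    · rw [P.tr, hHb]; linarith
    · rw [P.tr, hHb]; linarith
    · have := cx.e0; positivity
  have hind : ∀ n : ℕ, ∀ t, 0 < t → t ≤ 4 * Λ * ρ → 2 * Λ * ρ ≤ 2 ^ n * t →
      u (b + t • e) * t ^ p ≤ (4 * Λ * ρ) ^ p * (C * u (z + ρ • e)) := by
    intro n
    induction n with
    | zero =>
      intro t ht0 ht1 ht2
      have h1 := hbase t (by simpa using ht2) ht1
      have h2 : t ^ p ≤ (4 * Λ * ρ) ^ p := by gcongr
      rw [mul_comm]
      calc t ^ p * u (b + t • e) ≤ t ^ p * (C * u (z + ρ • e)) := by gcongr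
        _ ≤ _ := by gcongr
    | succ n ih =>
      intro t ht0 ht1 ht2
      rcases le_or_gt (2 * Λ * ρ) t with h | h
      · have h1 := hbase t h ht1
        have h2 : t ^ p ≤ (4 * Λ * ρ) ^ p := by gcongr
        rw [mul_comm]
        calc t ^ p * u (b + t • e) ≤ t ^ p * (C * u (z + ρ • e)) := by gcongr
          _ ≤ _ := by gcongr
      · have h1 := ih (2 * t) (by linarith) (by linarith) (by rw [pow_succ] at ht2; linarith)
        have h2 := hdbl t ht0 h
        have hnn2 : 0 ≤ u (b + (2 * t) • e) := by
          have h3 : b + (2 * t) • e ∈ ball z K := by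
            rw [mem_ball]
            have := dist_triangle (b + (2 * t) • e) b z
            rw [P.de b (by linarith)] at this
            linarith
          have h4 : b + (2 * t) • e ∈ Ω := (P.mem _ (hsub h3)).2 (by rw [P.tr, hHb]; linarith)
          exact (hn _ h4 h3).sup.nonneg cx h4
        calc u (b + t • e) * t ^ p ≤ (C' * u (b + (2 * t) • e)) * t ^ p := by gcongr
          _ ≤ (2 ^ p * u (b + (2 * t) • e)) * t ^ p := by gcongr
          _ = u (b + (2 * t) • e) * (2 * t) ^ p := by rw [mul_pow]; ring
          _ ≤ _ := h1
  obtain ⟨n, hn'⟩ := pow_unbounded_of_one_lt (2 * Λ * ρ / H x) (one_lt_two)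
  rw [div_lt_iff₀ hHx] at hn'
  have := hind n (H x) hHx (by nlinarith) hn'.le
  rw [← hxb] at this
  refine this.trans (le_of_eq ?_)
  rw [mul_pow (4 * Λ) ρ]; ring

/-- Carleson estimate -/
lemma carleson (cx : Cx Ω V ε) (P : Patch Ω y0 e H Λ r1) (hε : 32 * Λ ^ 2 * ε ^ 2 ≤ k1 N) :
    ∃ C : ℝ, 1 ≤ C ∧
    ∀ (u : ES N → ℝ) (z : ES N) (ρ : ℝ), Good Ω u → 0 < ρ → H z = 0 →
      ball z (40 * Λ ^ 2 * ρ) ⊆ ball y0 r1 →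
      (∀ x ∈ Ω, x ∈ ball z (40 * Λ ^ 2 * ρ) → NiceAt Ω V ε u x) →
      (∀ w ∈ frontier Ω, w ∈ ball z (40 * Λ ^ 2 * ρ) → Tendsto u (𝓝[Ω] w) (𝓝 0)) →
      ∀ x ∈ Ω, x ∈ ball z ρ → u x ≤ C * u (z + ρ • e) := by
  have hΛ := P.L1
  obtain ⟨p, C, hC, hg⟩ := growth cx P
  set θ := th N Λ with hθ
  have hθ0 : 0 < θ := th_pos hΛ
  have hθ1 : θ < 1 := th_lt hΛ
  set β := (1 - θ) / (20 * (p + 1)) with hβ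
  have hp1 : (0 : ℝ) < p + 1 := by positivity
  have hβ0 : 0 < β := div_pos (by linarith) (by positivity)
  have hβp : 10 * p * β ≤ (1 - θ) / 2 := by
    rw [hβ]
    have : (p : ℝ) / (p + 1) ≤ 1 := by rw [div_le_one hp1]; linarith
    calc 10 * (p : ℝ) * ((1 - θ) / (20 * (p + 1))) = (1 - θ) / 2 * (p / (p + 1)) := by field_simp; ring
      _ ≤ (1 - θ) / 2 * 1 := by
          refine mul_le_mul_of_nonneg_left this (by linarith)
      _ = _ := by ring
  have hβ20 : β ≤ 1 / 20 := by
    rw [hβ, div_le_div_iff₀ (by positivity) (by norm_num)]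
    have : (0 : ℝ) ≤ p := by positivity
    nlinarith
  have hbern : (1 + θ) / 2 ≤ (1 - 10 * β) ^ p := by
    have := one_add_mul_le_pow (a := -(10 * β)) (by linarith) p
    rw [show 1 + -(10 * β) = 1 - 10 * β by ring] at this
    linarith
  set θ' := 2 * θ / (1 + θ) with hθ'
  have hθ'1 : θ' < 1 := by rw [hθ', div_lt_one (by linarith)]; linarith
  have hθθ : θ ≤ θ' * (1 - 10 * β) ^ p := by
    have h1 : θ = θ' * ((1 + θ) / 2) := by rw [hθ']; field_simp
    have h2 : θ' * ((1 + θ) / 2) ≤ θ' * (1 - 10 * β) ^ p :=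
      mul_le_mul_of_nonneg_left hbern (by positivity)
    linarith
  refine ⟨max 1 (C * (β ^ p)⁻¹), le_max_left _ _, ?_⟩
  intro u z ρ hu hρ hz hsub hn hbv
  have hρΛ : ρ ≤ Λ * ρ := by nlinarith
  have hρ2 : Λ * ρ ≤ Λ ^ 2 * ρ := by nlinarith
  have hg := hg u z ρ hu hρ hz hsub hn
  set K := 40 * Λ ^ 2 * ρ with hK
  have hA : H (z + ρ • e) = ρ := by rw [P.tr, hz, zero_add]
  have hAd := P.de z hρ.le
  have hnn : 0 ≤ u (z + ρ • e) := by
    have h1 : z + ρ • e ∈ ball z K := by rw [mem_ball, hAd]; linarith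
    have h2 : z + ρ • e ∈ Ω := (P.mem _ (hsub h1)).2 (by rw [hA]; exact hρ)
    exact (hn _ h2 h1).sup.nonneg cx h2
  set a := C * (β ^ p)⁻¹ * ρ ^ p * u (z + ρ • e) with ha
  have ha0 : 0 ≤ a := by positivity
  obtain ⟨C3, hC3⟩ := bdd_of_vanish cx.op hu (isCompact_closedBall z (2 * ρ))
    (fun w hw hwb => hbv w hw (closedBall_subset_ball (by linarith) hwb))
  set D := Ω ∩ ball z (2 * ρ) with hD
  set F : ES N → ℝ := fun x => u x * (2 * ρ - dist x z) ^ p with hF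
  have hub : ∀ x ∈ D, 0 ≤ u x := fun x hx =>
    (hn x hx.1 (ball_subset_ball (by linarith) hx.2)).sup.nonneg cx hx.1
  have hFb : BddAbove (F '' D) := by
    refine ⟨max C3 0 * (2 * ρ) ^ p, ?_⟩
    rintro _ ⟨x, hx, rfl⟩
    have h1 := hC3 x (ball_subset_closedBall hx.2) hx.1
    have h2 := mem_ball.1 hx.2
    have h3 := hub x hx
    have h4 := dist_nonneg (x := x) (y := z)
    have h5 : 0 ≤ 2 * ρ - dist x z := by linarith
    have h6 : (2 * ρ - dist x z) ^ p ≤ (2 * ρ) ^ p := by gcongr; linarith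
    have h7 : u x ≤ max C3 0 := h1.trans (le_max_left _ _)
    simp only [hF]
    gcongr
  set S := sSup (F '' D) with hS
  have hFS : ∀ x ∈ D, F x ≤ S := fun x hx => le_csSup hFb ⟨x, hx, rfl⟩
  have hF0 : ∀ x ∈ D, 0 ≤ F x := fun x hx =>
    mul_nonneg (hub x hx) (pow_nonneg (by linarith [mem_ball.1 hx.2]) _)
  have hmainF : ∀ x ∈ D, F x ≤ max a (θ' * S) := by
    intro x hx
    have hS0 : 0 ≤ S := (hF0 x hx).trans (hFS x hx)
    have hxb := mem_ball.1 hx.2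
    set d := 2 * ρ - dist x z with hd
    have hd0 : 0 < d := by linarith
    have hxy : x ∈ ball y0 r1 := hsub (ball_subset_ball (by linarith) hx.2)
    have hHx := (P.mem x hxy).1 hx.1
    rcases le_or_gt (β * d) (H x) with h | h
    · refine le_trans ?_ (le_max_left _ _)
      have h1 := hg x hx.1 hx.2
      have h2 : d ^ p ≤ (β ^ p)⁻¹ * H x ^ p := by
        rw [← inv_pow, ← mul_pow]
        refine pow_le_pow_left₀ hd0.le ?_ _
        rw [inv_mul_eq_div, le_div_iff₀ hβ0]; linarith
      calc F x = u x * d ^ p := rfl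
        _ ≤ u x * ((β ^ p)⁻¹ * H x ^ p) := mul_le_mul_of_nonneg_left h2 (hub x hx)
        _ = (β ^ p)⁻¹ * (u x * H x ^ p) := by ring
        _ ≤ (β ^ p)⁻¹ * (C * ρ ^ p * u (z + ρ • e)) := by gcongr
        _ = a := by rw [ha]; ring
    · refine le_trans ?_ (le_max_right _ _)
      set b := x + (-H x) • e with hb
      have hHb : H b = 0 := by rw [hb, P.tr]; ring
      have hbx : dist b x = H x := by
        rw [hb, dist_self_add_left, neg_smul, norm_neg, P.ne hHx.le]
      have hβd : β * d ≤ d / 20 := by nlinarith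
      have hin : ∀ w, dist w b < 9 * H x → dist w z < 2 * ρ ∧ (1 - 10 * β) * d ≤ 2 * ρ - dist w z := by
        intro w hw
        have := dist_triangle4 w b x z
        constructor <;> linarith
      have hDL := DL cx P hε hu (y := b) (ρ := 9 * H x) (S := S / ((1 - 10 * β) * d) ^ p) (by linarith)
        (by have : 0 < (1 - 10 * β) * d := mul_pos (by linarith) hd0
            positivity) hHb
        (fun w hw => hsub (ball_subset_ball (by linarith) (mem_ball.2 (hin w hw).1)))
        (fun w hw hwb => by
          have h1 := hin w hwb
          have h3 : 0 < (1 - 10 * β) * d := mul_pos (by linarith) hd0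
          rw [le_div_iff₀ (pow_pos h3 p)]
          have hwD : w ∈ D := ⟨hw, mem_ball.2 h1.1⟩
          refine le_trans ?_ (hFS w hwD)
          have := hub w hwD
          simp only [hF]
          gcongr
          exact h1.2)
        (fun w hw hwb _ => by
          have h1 := hin w (by rw [mem_ball] at hwb; linarith)
          have h2 := hn w hw (ball_subset_ball (by linarith) (mem_ball.2 h1.1))
          rw [h2.2.1]
          exact TT_le_Ev cx hw hu h2.1)
        (fun w hw hwb => by
          have h1 := hin w (by rw [mem_closedBall] at hwb; linarith)
          have h2 := hbv w hw (ball_subset_ball (by linarith) (mem_ball.2 h1.1))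
          have := h2.max (tendsto_const_nhds (x := (0 : ℝ)))
          rwa [max_self] at this)
        x hx.1 (by rw [mem_ball, dist_comm, hbx]; linarith)
      have h3 : 0 < (1 - 10 * β) := by linarith
      calc F x = u x * d ^ p := rfl
        _ ≤ (θ * (S / ((1 - 10 * β) * d) ^ p)) * d ^ p := by gcongr
        _ = θ / (1 - 10 * β) ^ p * S := by rw [mul_pow]; field_simp
        _ ≤ θ' * S := by
            refine mul_le_mul_of_nonneg_right ?_ hS0
            rw [div_le_iff₀ (by positivity)]; exact hθθ
  intro x hx hxz
  have hxD : x ∈ D := ⟨hx, ball_subset_ball (by linarith) hxz⟩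
  have hS0 : 0 ≤ S := (hF0 x hxD).trans (hFS x hxD)
  have hSle : S ≤ max a (θ' * S) := by
    refine csSup_le (⟨F x, x, hxD, rfl⟩ : (F '' D).Nonempty) ?_
    rintro _ ⟨w, hw, rfl⟩
    exact hmainF w hw
  have hSa : S ≤ a := by
    rcases le_max_iff.1 hSle with h | h
    · exact h
    · have : S ≤ 0 := by nlinarith
      linarith
  have h1 := (hFS x hxD).trans hSa
  have h2 : ρ ^ p ≤ (2 * ρ - dist x z) ^ p := by
    rw [mem_ball] at hxz
    gcongr; linarith
  have h3 : u x * ρ ^ p ≤ a := (mul_le_mul_of_nonneg_left h2 (hub x hxD)).trans h1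
  have h4 : u x ≤ C * (β ^ p)⁻¹ * u (z + ρ • e) := by
    have : u x * ρ ^ p ≤ (C * (β ^ p)⁻¹ * u (z + ρ • e)) * ρ ^ p := by
      refine h3.trans (le_of_eq ?_); rw [ha]; ring
    exact le_of_mul_le_mul_right this (by positivity)
  exact h4.trans (mul_le_mul_of_nonneg_right (le_max_right _ _) hnn)

end


section


set_option linter.unusedVariables false

variable {N : ℕ} {Ω : Set (ES N)} {V : ES N → ℝ} {ε : ℝ}
variable {y0 e : ES N} {H : ES N → ℝ} {Λ r1 : ℝ}

lemma TT_const_le (cx : Cx Ω V ε) {z : ES N} (hz : z ∈ Ω) {c : ℝ} (hc : 0 ≤ c) :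
    TT Ω V ε (fun _ => c) z ≤ c := by
  have := TT_le_Ev cx hz (Good.const c) (fun _ _ => hc)
  rwa [Ev_const] at this

lemma dista_le_H (P : Patch Ω y0 e H Λ r1) {x : ES N} (hx : x ∈ ball y0 r1) (hxΩ : x ∈ Ω) :
    dista Ω x ≤ H x := P.du x hx hxΩ

set_option maxHeartbeats 2000000 in
/-- one step of the De Silva and Savin iteration -/
lemma bhp_step (cx : Cx Ω V ε) (P : Patch Ω y0 e H Λ r1) (hε : 32 * Λ ^ 2 * ε ^ 2 ≤ k1 N)
    {w : ES N → ℝ} (hw : Good Ω w) {z : ES N} {ρ lam ep a M t0 : ℝ} {n : ℕ} (hρ : 0 < ρ) (hl : 0 ≤ lam)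
    (hep : ep = ε / (32 * Λ)) (ha : a = cc N (16 * Λ) / 4) (hM : M = 4 / cc N (16 * Λ))
    (hn : 1 ≤ n) (hna : th N Λ ^ n ≤ a) (ht0 : t0 = ep / (9 * n))
    (hsub : ball z ρ ⊆ ball y0 r1)
    (hs : ∀ x ∈ Ω, x ∈ ball z ρ → TT Ω V ε w x ≤ w x)
    (hb : ∀ ζ ∈ frontier Ω, ζ ∈ ball z ρ → Tendsto (fun x => max (-w x) 0) (𝓝[Ω] ζ) (𝓝 0))
    (h1 : ∀ x ∈ Ω, x ∈ ball z ρ → -lam ≤ w x)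
    (h2 : ∀ x ∈ Ω, x ∈ ball z ρ → t0 * ρ ≤ H x → lam * M ≤ w x) :
    (∀ x ∈ Ω, x ∈ ball z ((1 - ep) * ρ) → -(a * lam) ≤ w x) ∧
    (∀ x ∈ Ω, x ∈ ball z ((1 - ep) * ρ) → t0 * ((1 - ep) * ρ) ≤ H x → a * lam * M ≤ w x) := by
  have hΛ := P.L1
  have he := cx.e0
  have he1 := cx.e1
  have hc := cc_pos (N := N) (K := 16 * Λ) (by linarith)
  have hc1 := cc_le (N := N) (K := 16 * Λ)
  have hn0 : (1 : ℝ) ≤ n := by exact_mod_cast hn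
  have hep0 : 0 < ep := by rw [hep]; positivity
  have hep1 : ep ≤ 1 / 32 := by
    rw [hep, div_le_div_iff₀ (by positivity) (by norm_num)]; nlinarith
  have ha0 : 0 < a := by rw [ha]; positivity
  have ha1 : a ≤ 1 := by rw [ha]; linarith
  have hM0 : 0 < M := by rw [hM]; positivity
  have haM : a * M = 1 := by rw [ha, hM]; field_simp
  have hMc : M * cc N (16 * Λ) = 4 := by rw [hM]; field_simp
  have ht00 : 0 < t0 := by rw [ht0]; positivity
  have ht0n : 9 * t0 * n = ep := by rw [ht0]; field_simp
  have ht0e : ε * t0 ≤ ep := by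
    have : t0 ≤ ep := by rw [ht0]; exact div_le_self hep0.le (by linarith)
    nlinarith
  have hepρ : 0 < ep * ρ := by positivity
  set q : ES N → ℝ := fun x => max (-w x) 0 with hq
  have hqG : Good Ω q := by
    have := (hw.cmul (-1)).max0 cx.op
    simpa only [neg_one_mul] using this
  have hwpG : Good Ω (fun x => max (w x) 0) := hw.max0 cx.op
  have hdec : ∀ x, w x = max (w x) 0 - q x := fun x => by
    simp only [hq]
    rcases le_total 0 (w x) with h | h
    · rw [max_eq_left h, max_eq_right (by linarith)]; ring
    · rw [max_eq_right h, max_eq_left (by linarith)]; ring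
  have hTdec : ∀ x ∈ Ω, TT Ω V ε w x = TT Ω V ε (fun x => max (w x) 0) x - TT Ω V ε q x := by
    intro x hx
    rw [← TT_sub cx hx hwpG hqG]
    congr 1; ext y; exact hdec y
  constructor
  · -- decay of the negative part
    set τ := t0 * ρ with hτ
    have hτ0 : 0 < τ := by positivity
    have hit : ∀ j : ℕ, ∀ x ∈ Ω, x ∈ ball z (ρ - 9 * τ * j) → q x ≤ th N Λ ^ j * lam := by
      intro j
      induction j with
      | zero =>
        intro x hx hxz
        have := h1 x hx (by simpa using hxz)
        simp only [pow_zero, one_mul, hq]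
        exact max_le (by linarith) hl
      | succ j ih =>
        intro x hx hxz
        rw [mem_ball] at hxz
        push_cast at hxz
        have hj : (0 : ℝ) ≤ 9 * τ * j := by positivity
        have hxρ : x ∈ ball z ρ := by rw [mem_ball]; linarith
        have hxy := hsub hxρ
        have hpw : 0 ≤ th N Λ ^ j * lam := mul_nonneg (pow_nonneg (th_pos hΛ).le _) hl
        have hHx := (P.mem x hxy).1 hx
        rcases le_or_gt τ (H x) with h | h
        · have h3 := h2 x hx hxρ h
          have h4 : 0 ≤ lam * M := by positivity
          have h5 : q x = 0 := by simp only [hq]; exact max_eq_right (by linarith)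
          rw [h5]
          exact mul_nonneg (pow_nonneg (th_pos hΛ).le _) hl
        · set b := x + (-H x) • e with hbd
          have hHb : H b = 0 := by rw [hbd, P.tr]; ring
          have hbx : dist b x = H x := by
            rw [hbd, dist_self_add_left, neg_smul, norm_neg, P.ne hHx.le]
          have hin : ball b (8 * τ) ⊆ ball z (ρ - 9 * τ * j) := by
            intro y hy
            rw [mem_ball] at hy ⊢
            have := dist_triangle4 y b x z
            linarith
          have hin2 : ball b (8 * τ) ⊆ ball z ρ := hin.trans (ball_subset_ball (by linarith))
          have := DL cx P hε hqG (y := b) (ρ := 8 * τ) (S := th N Λ ^ j * lam) (by linarith) hpw hHb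
            (hin2.trans hsub) (fun y hy hyb => ih y hy (hin hyb)) ?_ ?_ x hx ?_
          · rw [pow_succ]; linarith
          · intro y hy hyb hpos
            have hyρ := hin2 (ball_subset_ball (by linarith) hyb)
            have h3 := hs y hy hyρ
            have h4 : q y = -w y := by
              simp only [hq] at hpos ⊢
              refine max_eq_left ?_
              by_contra hcn
              rw [max_eq_right (by linarith)] at hpos
              exact lt_irrefl _ hpos
            have h5 := hTdec y hy
            have h6 : 0 ≤ TT Ω V ε (fun x => max (w x) 0) y := TT_nonneg cx hy fun _ _ => le_max_right _ _
            have h7 := TT_le_Ev cx hy hqG (fun _ _ => le_max_right _ _)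
            rw [h4]; linarith
          · intro ζ hζ hζb
            have := hb ζ hζ (hin2 (closedBall_subset_ball (by linarith) hζb))
            refine this.congr fun y => ?_
            simp only [hq]
            rw [max_eq_left (le_max_right _ _)]
          · rw [mem_ball, dist_comm, hbx]; linarith
    intro x hx hxz
    have h3 := hit n x hx (by
      have : ρ - 9 * τ * n = (1 - ep) * ρ := by rw [hτ, ← ht0n]; ring
      rwa [this])
    have h4 : -w x ≤ q x := le_max_left _ _
    have h5 : th N Λ ^ n * lam ≤ a * lam := by gcongr
    linarith
  · intro x hx hxz hxH
    rw [mem_ball] at hxz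
    have hxρ : x ∈ ball z ρ := by rw [mem_ball]; linarith
    have hxy := hsub hxρ
    have halM : a * lam * M = lam := by rw [mul_right_comm, haM, one_mul]
    rcases le_or_gt (t0 * ρ) (H x) with h | h
    · refine le_trans ?_ (h2 x hx hxρ h)
      have : 0 ≤ lam * M := by positivity
      nlinarith
    · have hR := cx.Rpos hx
      have hRH : RR Ω ε x ≤ ε * H x := mul_le_mul_of_nonneg_left (P.du x hxy hx) he.le
      have hRH2 : ε * H x ≤ Λ * RR Ω ε x := by
        have := mul_le_mul_of_nonneg_left (P.dl x hxy hx) he.le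
        unfold RR; linarith
      set R := RR Ω ε x with hRd
      have hRρ : R ≤ ep * ρ := by
        have : ε * H x ≤ ε * (t0 * ρ) := by gcongr
        nlinarith
      have hcb : closedBall x R ⊆ ball z ρ := by
        intro y hy
        rw [mem_closedBall] at hy
        rw [mem_ball]
        have := dist_triangle y x z
        linarith
      have hq1 : TT Ω V ε q x ≤ lam := by
        refine (TT_mono cx hx hqG (Good.const lam) fun y hy => ?_).trans (TT_const_le cx hx hl)
        have := h1 y (cx.cb1 hx hy) (hcb hy)
        exact max_le (by linarith) hl
      have hd := P.de x (t := R / 8) (by positivity)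
      have hRL : R / (16 * Λ) ≤ R / 16 := by
        refine div_le_div_of_nonneg_left hR.le (by norm_num) (by linarith)
      have hL2 := L2 cx hwpG hx (fun _ _ => le_max_right _ _) (p := x + (R / 8) • e)
        (s := R / (16 * Λ)) (lam := lam * M) (K := 16 * Λ) (by positivity) (by positivity)
        (by
          intro y hy
          rw [mem_ball] at hy ⊢
          have := dist_triangle y (x + (R / 8) • e) x
          rw [hd] at this
          linarith)
        (by rw [← hRd]; apply le_of_eq; field_simp)
        (by
          intro y hy
          rw [mem_ball] at hy
          have hyR : y ∈ closedBall x R := by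
            rw [mem_closedBall]
            have := dist_triangle y (x + (R / 8) • e) x
            rw [hd] at this
            linarith
          have hHy : H x + R / 16 ≤ H y := by
            have h3 := P.lb y (x + (R / 8) • e)
            rw [P.tr] at h3
            have h4 : Λ * dist y (x + (R / 8) • e) ≤ Λ * (R / (16 * Λ)) := by gcongr
            have h5 : Λ * (R / (16 * Λ)) = R / 16 := by field_simp
            linarith
          have h6 : ep * 2 * H x ≤ R / 16 := by
            rw [hep]
            have : ε / (32 * Λ) * 2 * H x = (ε * H x) / (16 * Λ) := by field_simp; ring
            rw [this, div_le_div_iff₀ (by positivity) (by norm_num)]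
            linarith
          have h7 : t0 * ρ ≤ H y := by
            have h8 : t0 * ρ ≤ (1 + 2 * ep) * (t0 * ((1 - ep) * ρ)) := by
              have : 0 < t0 * ρ := by positivity
              have h9 : 1 ≤ (1 + 2 * ep) * (1 - ep) := by nlinarith
              nlinarith
            have h9 : (1 + 2 * ep) * (t0 * ((1 - ep) * ρ)) ≤ (1 + 2 * ep) * H x := by gcongr
            linarith
          exact (h2 y (cx.cb1 hx hyR) (hcb hyR) h7).trans (le_max_left _ _))
      have h3 := hs x hx hxρ
      rw [hTdec x hx] at h3
      have h4 : lam * M * cc N (16 * Λ) = 4 * lam := by rw [mul_assoc, hMc]; ring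
      rw [halM]; linarith

set_option maxHeartbeats 2000000 in
/-- boundary Harnack -/
lemma BHP (cx : Cx Ω V ε) (P : Patch Ω y0 e H Λ r1) (hε : 32 * Λ ^ 2 * ε ^ 2 ≤ k1 N)
    {σ : ℝ} (hσ : 0 < σ) : ∃ C : ℝ, 0 < C ∧
    ∀ (u v : ES N → ℝ) (z : ES N) (ρ : ℝ), Good Ω u → Good Ω v → 0 < ρ → H z = 0 →
      ball z (40 * Λ ^ 2 * ρ) ⊆ ball y0 r1 →
      (∀ x ∈ Ω, x ∈ ball z (40 * Λ ^ 2 * ρ) → NiceAt Ω V ε u x) →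
      (∀ w ∈ frontier Ω, w ∈ ball z (40 * Λ ^ 2 * ρ) → Tendsto u (𝓝[Ω] w) (𝓝 0)) →
      (∀ x ∈ Ω, x ∈ ball z (40 * Λ ^ 2 * ρ) → SupAt Ω V ε v x) →
      (∀ x ∈ ball (z + ρ • e) (σ * ρ), 1 ≤ v x) →
      ∀ t, 0 < t → t < ρ → u (z + t • e) ≤ C * u (z + ρ • e) * v (z + t • e) := by
  have hΛ := P.L1
  have he := cx.e0
  have he1 := cx.e1
  obtain ⟨C, hC, hcar⟩ := carleson cx P hε
  have hc := cc_pos (N := N) (K := 16 * Λ) (by linarith)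
  have hc1 := cc_le (N := N) (K := 16 * Λ)
  obtain ⟨n', hn'⟩ := exists_pow_lt_of_lt_one (by positivity : 0 < cc N (16 * Λ) / 4) (th_lt (N := N) hΛ)
  set ep := ε / (32 * Λ) with hep
  set a := cc N (16 * Λ) / 4 with ha
  set M := 4 / cc N (16 * Λ) with hM
  set n := n' + 1 with hn
  have hna : th N Λ ^ n ≤ a := by
    rw [hn, pow_succ]
    have := pow_pos (th_pos (N := N) hΛ) n'
    nlinarith [th_lt (N := N) hΛ]
  set t0 := ep / (9 * n) with ht0
  have hn0 : (1 : ℝ) ≤ n := by rw [hn]; push_cast; linarith [Nat.cast_nonneg (α := ℝ) n']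
  have hep0 : 0 < ep := by rw [hep]; positivity
  have hep1 : ep ≤ 1 / 32 := by
    rw [hep, div_le_div_iff₀ (by positivity) (by norm_num)]; nlinarith
  have ht00 : 0 < t0 := by rw [ht0]; positivity
  have ht01 : t0 ≤ ep := by rw [ht0]; exact div_le_self hep0.le (by linarith)
  have ha0 : 0 < a := by rw [ha]; positivity
  have hM0 : 0 < M := by rw [hM]; positivity
  set κ := min t0 σ with hκ
  have hκ0 : 0 < κ := lt_min ht00 hσ
  have hκ1 : κ ≤ 1 := (min_le_left _ _).trans (by linarith)
  have hgK : 0 < gK Λ κ := by unfold gK; positivity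
  set cg := cc N (gK Λ κ) ^ (3 * gn Λ κ ε) with hcg
  have hcg0 : 0 < cg := pow_pos (cc_pos hgK) _
  set α := (M + 1) / cg with hα
  have hα0 : 0 < α := by positivity
  refine ⟨α * C, by positivity, ?_⟩
  intro u v z ρ hu hv hρ hz hsub hun huv hvs hv1 t ht0' htρ
  have hρΛ : ρ ≤ Λ * ρ := by nlinarith
  have hρ2 : Λ * ρ ≤ Λ ^ 2 * ρ := by nlinarith
  have hcar := hcar u z ρ hu hρ hz hsub hun huv
  set K := 40 * Λ ^ 2 * ρ with hK
  have hA : H (z + ρ • e) = ρ := by rw [P.tr, hz, zero_add]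
  have hAd := P.de z hρ.le
  have hnn : 0 ≤ u (z + ρ • e) := by
    have h1 : z + ρ • e ∈ ball z K := by rw [mem_ball, hAd]; linarith
    have h2 : z + ρ • e ∈ Ω := (P.mem _ (hsub h1)).2 (by rw [hA]; exact hρ)
    exact (hun _ h2 h1).sup.nonneg cx h2
  set U := C * u (z + ρ • e) with hU
  have hU0 : 0 ≤ U := by positivity
  have hρK : ball z ρ ⊆ ball z K := ball_subset_ball (by linarith)
  set w : ES N → ℝ := fun x => α * U * v x - u x with hw
  have hwG : Good Ω w := (hv.cmul _).sub hu
  have hvl : ∀ x ∈ Ω, x ∈ ball z ρ → t0 * ρ ≤ H x → cg ≤ v x := by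
    intro x hx hxz hxH
    have h8 : ball z (8 * Λ * ρ) ⊆ ball z K := ball_subset_ball (by linarith)
    have := GC cx P hv (b := z) (ϱ := ρ) (κ := κ) (lam := 1) hρ hκ0 hκ1 hz (h8.trans hsub)
      (fun y hy hyb _ => hvs y hy (h8 hyb)) (w1 := z + ρ • e) (w2 := x)
      (by rw [mem_ball, hAd]; linarith) (ball_subset_ball (by linarith) hxz)
      (by rw [hA]; exact mul_le_of_le_one_left hρ.le hκ1)
      (le_trans (mul_le_mul_of_nonneg_right (min_le_left _ _) hρ.le) hxH) zero_le_one
      (fun y hy => hv1 y (ball_subset_ball (by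
        rw [div_le_iff₀ (by positivity)]
        have h1 : κ * ρ ≤ σ * ρ := mul_le_mul_of_nonneg_right (min_le_right _ _) hρ.le
        have h2 : 0 < κ * ρ := by positivity
        nlinarith) hy)) x (mem_ball_self (by positivity))
    rwa [one_mul] at this
  set y := 1 - ep with hy
  have hy0 : 0 < y := by linarith
  have hy1 : y < 1 := by linarith
  have hws : ∀ x ∈ Ω, x ∈ ball z ρ → TT Ω V ε w x ≤ w x := by
    intro x hx hxz
    have h1 := hun x hx (hρK hxz)
    have h2 := (hvs x hx (hρK hxz)).2
    rw [hw, TT_sub cx hx (hv.cmul _) hu, TT_cmul, ← h1.2.1]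
    have := mul_le_mul_of_nonneg_left h2 (by positivity : 0 ≤ α * U)
    simp only; linarith
  have hwb : ∀ ζ ∈ frontier Ω, ζ ∈ ball z ρ → Tendsto (fun x => max (-w x) 0) (𝓝[Ω] ζ) (𝓝 0) := by
    intro ζ hζ hζb
    have h1 := (huv ζ hζ (hρK hζb)).max (tendsto_const_nhds (x := (0 : ℝ)))
    rw [max_self] at h1
    refine tendsto_of_tendsto_of_tendsto_of_le_of_le' tendsto_const_nhds h1
      (Eventually.of_forall fun _ => le_max_right _ _) ?_
    have h2 : ∀ᶠ x in 𝓝[Ω] ζ, x ∈ ball z ρ :=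
      mem_nhdsWithin_of_mem_nhds (isOpen_ball.mem_nhds hζb)
    filter_upwards [h2, self_mem_nhdsWithin] with x hx hxΩ
    have h3 := (hvs x hxΩ (hρK hx)).nonneg cx hxΩ
    have h4 : 0 ≤ α * U * v x := by positivity
    exact max_le_max (by simp only [hw]; linarith) le_rfl
  have hyk : ∀ k : ℕ, y ^ k * ρ ≤ ρ := fun k => mul_le_of_le_one_left hρ.le (pow_le_one₀ hy0.le hy1.le)
  have main : ∀ k : ℕ, (∀ x ∈ Ω, x ∈ ball z (y ^ k * ρ) → -(a ^ k * U) ≤ w x) ∧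
      (∀ x ∈ Ω, x ∈ ball z (y ^ k * ρ) → t0 * (y ^ k * ρ) ≤ H x → a ^ k * U * M ≤ w x) := by
    intro k
    induction k with
    | zero =>
      simp only [pow_zero, one_mul]
      constructor
      · intro x hx hxz
        have h1 := hcar x hx hxz
        have h3 := (hvs x hx (hρK hxz)).nonneg cx hx
        have h4 : 0 ≤ α * U * v x := by positivity
        simp only [hw]; linarith
      · intro x hx hxz hxH
        have h1 := hcar x hx hxz
        have h3 := hvl x hx hxz hxH
        have h4 : α * U * cg ≤ α * U * v x := by gcongr
        have h5 : α * U * cg = (M + 1) * U := by rw [hα]; field_simp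
        simp only [hw]; linarith
    | succ k ih =>
      have hbk : ball z (y ^ k * ρ) ⊆ ball z ρ := ball_subset_ball (hyk k)
      have := bhp_step cx P hε hwG (z := z) (ρ := y ^ k * ρ) (lam := a ^ k * U) (by positivity)
        (by positivity) hep ha hM (by omega) hna ht0 ((hbk.trans hρK).trans hsub)
        (fun x hx hxb => hws x hx (hbk hxb)) (fun x hx hxb => hwb x hx (hbk hxb)) ih.1 ih.2
      have e1 : y ^ (k + 1) * ρ = (1 - ep) * (y ^ k * ρ) := by rw [pow_succ, hy]; ring
      have e2 : a ^ (k + 1) * U = a * (a ^ k * U) := by rw [pow_succ]; ring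
      rw [e1, e2]; exact this
  -- choose k
  have hex : ∃ k : ℕ, y ^ (k + 1) * ρ ≤ t := by
    obtain ⟨k, hk⟩ := exists_pow_lt_of_lt_one (div_pos ht0' hρ) hy1
    rw [lt_div_iff₀ hρ] at hk
    refine ⟨k, le_trans ?_ hk.le⟩
    rw [pow_succ]
    have : 0 < y ^ k := by positivity
    have : y ^ k * y ≤ y ^ k := mul_le_of_le_one_right this.le hy1.le
    gcongr
  classical
  have hk1 := Nat.find_spec hex
  have hk2 : t < y ^ (Nat.find hex) * ρ := by
    rcases Nat.eq_zero_or_pos (Nat.find hex) with h | h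
    · rw [h]; simpa using htρ
    · have := Nat.find_min hex (m := Nat.find hex - 1) (by omega)
      rw [Nat.sub_add_cancel h] at this
      exact not_le.1 this
  set k := Nat.find hex
  have hzt : z + t • e ∈ ball z (y ^ k * ρ) := by rw [mem_ball, P.de z ht0'.le]; exact hk2
  have hztρ : z + t • e ∈ ball z ρ := ball_subset_ball (hyk k) hzt
  have hHt : H (z + t • e) = t := by rw [P.tr, hz, zero_add]
  have hztΩ : z + t • e ∈ Ω := (P.mem _ (hsub (hρK hztρ))).2 (by rw [hHt]; exact ht0')
  have h1 := (main k).2 _ hztΩ hzt (by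
    rw [hHt]
    refine le_trans ?_ hk1
    rw [pow_succ]
    have : 0 < y ^ k * ρ := by positivity
    have h3 : t0 ≤ y := by linarith
    nlinarith)
  have h2 : 0 ≤ a ^ k * U * M := by positivity
  simp only [hw] at h1
  rw [mul_assoc α C, ← hU]
  linarith

end


section


set_option linter.unusedVariables false

variable {N : ℕ} {Ω : Set (ES N)} {V : ES N → ℝ} {ε : ℝ}
variable {y0 e : ES N} {H : ES N → ℝ} {Λ r1 : ℝ}

lemma SupAt.cmul {v : ES N → ℝ} {x : ES N} {c : ℝ} (hc : 0 ≤ c) (h : SupAt Ω V ε v x) :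
    SupAt Ω V ε (fun w => c * v w) x :=
  ⟨fun w hw => mul_nonneg hc (h.1 w hw), by rw [TT_cmul]; exact mul_le_mul_of_nonneg_left h.2 hc⟩

lemma dista_le_dist_fr (ho : IsOpen Ω) {x y : ES N} (hy : y ∈ frontier Ω) : dista Ω x ≤ dist x y := by
  have : y ∈ Ωᶜ := fun h => by
    rw [ho.frontier_eq] at hy; exact hy.2 h
  exact infDist_le_dist_of_mem this

set_option maxHeartbeats 2000000 in
/-- comparison outside of a ball centered on the boundary -/
lemma shell (cx : Cx Ω V ε) (P : Patch Ω y0 e H Λ r1) (hε : 32 * Λ ^ 2 * ε ^ 2 ≤ k1 N)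
    {κ : ℝ} (hκ : 0 < κ) (hκ1 : κ ≤ 1 / (400 * Λ ^ 2)) : ∃ C : ℝ, 0 < C ∧
    ∀ (u v : ES N → ℝ) (y : ES N) (ϱ : ℝ), Good Ω u → Good Ω v → 0 < ϱ → H y = 0 →
      ball y (8 * Λ * ϱ) ⊆ ball y0 r1 →
      (∀ x ∈ Ω, κ * ϱ / (4 * Λ) ≤ dist x y → NiceAt Ω V ε u x) →
      (∀ w ∈ frontier Ω, κ * ϱ / (4 * Λ) < dist w y → Tendsto u (𝓝[Ω] w) (𝓝 0)) →
      (∀ x ∈ Ω, κ * ϱ / (4 * Λ) ≤ dist x y → SupAt Ω V ε v x) →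
      (∀ x ∈ ball (y + ϱ • e) (ε * κ * ϱ / (24 * Λ)), 1 ≤ v x) →
      ∀ x ∈ Ω, ϱ ≤ dist x y → u x ≤ C * u (y + ϱ • e) * v x := by
  have hΛ := P.L1
  have he := cx.e0
  have he1 := cx.e1
  have hΛ2 : 1 ≤ Λ ^ 2 := by nlinarith
  have hκΛ : 400 * Λ ^ 2 * κ ≤ 1 := by
    rw [le_div_iff₀ (by positivity)] at hκ1; linarith
  have hκ2 : κ ≤ 1 / 400 := by nlinarith
  set g := 1 / (400 * Λ ^ 2) with hg
  have hg0 : 0 < g := by positivity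
  have hgΛ : 40 * Λ ^ 2 * g = 1 / 10 := by rw [hg]; field_simp; norm_num
  have hg1 : g ≤ 1 / 400 := by nlinarith
  have hσ : 0 < ε * κ / (24 * Λ * g) := by positivity
  obtain ⟨CB, hCB, hB⟩ := BHP cx P hε hσ
  have hgK : 0 < gK Λ κ := by unfold gK; positivity
  set cg := cc N (gK Λ κ) ^ (3 * gn Λ κ ε) with hcg
  have hcg0 : 0 < cg := pow_pos (cc_pos hgK) _
  have hG := gCt_pos (N := N) (ε := ε) hΛ hκ
  set G := gCt N Λ κ ε with hGd
  refine ⟨(CB + 1) * G / cg, by positivity, ?_⟩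
  intro u v y ϱ hu hv hϱ hy hsub hun huv hvs hv1
  set A := y + ϱ • e with hA
  have hAd : dist A y = ϱ := P.de y hϱ.le
  have hAH : H A = ϱ := by rw [hA, P.tr, hy, zero_add]
  have hϱΛ : ϱ ≤ Λ * ϱ := by nlinarith
  have hyfr : y ∈ frontier Ω := (P.fr y (hsub (mem_ball_self (by positivity)))).2 hy
  have hexc : κ * ϱ / (4 * Λ) ≤ ϱ / 1600 := by
    rw [div_le_div_iff₀ (by positivity) (by norm_num)]; nlinarith
  have hHexc : ∀ x, κ * ϱ / 2 ≤ H x → κ * ϱ / (4 * Λ) ≤ dist x y := by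
    intro x hx
    have := P.ub x y
    rw [div_le_iff₀ (by positivity)]
    nlinarith
  have hAin : A ∈ ball y (2 * ϱ) := by rw [mem_ball, hAd]; linarith
  have hAκ : κ * ϱ ≤ H A := by rw [hAH]; nlinarith
  have hAΩ : A ∈ Ω := (P.mem _ (hsub (by rw [mem_ball, hAd]; nlinarith))).2 (by rw [hAH]; exact hϱ)
  have huA : 0 ≤ u A := (hun A hAΩ (by rw [hAd]; linarith)).sup.nonneg cx hAΩ
  -- interior points
  have hintg : ∀ p ∈ ball y (2 * ϱ), κ * ϱ ≤ H p →
      (∀ w ∈ ball p (ε * κ * ϱ / (24 * Λ)), cg ≤ v w) ∧ u p ≤ G * u A := by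
    intro p hp hpH
    constructor
    · have := GC cx P hv (b := y) (ϱ := ϱ) (κ := κ) (lam := 1) hϱ hκ (by linarith) hy hsub
        (fun x hx _ hxH => hvs x hx (hHexc x hxH)) (w1 := A) (w2 := p) hAin hp hAκ hpH zero_le_one hv1
      intro w hw
      have := this w hw
      rwa [one_mul] at this
    · exact GH cx P hu (b := y) (ϱ := ϱ) (κ := κ) hϱ hκ (by linarith) hy hsub
        (fun x hx _ hxH => hun x hx (hHexc x hxH)) (w1 := p) (w2 := A) hp hAin hpH hAκ A
        (mem_ball_self (by positivity))
  have hsh : ∀ x ∈ Ω, ϱ / 2 ≤ dist x y → dist x y ≤ ϱ → u x ≤ (CB + 1) * G / cg * u A * v x := by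
    intro x hx hx1 hx2
    have hxball : x ∈ ball y (8 * Λ * ϱ) := by rw [mem_ball]; nlinarith
    have hHx := (P.mem x (hsub hxball)).1 hx
    have hvx : 0 ≤ v x := (hvs x hx (by linarith)).nonneg cx hx
    rcases le_or_gt (g * ϱ) (H x) with h | h
    · have hpH : κ * ϱ ≤ H x := le_trans (by gcongr) h
      obtain ⟨h1, h2⟩ := hintg x (by rw [mem_ball]; linarith) hpH
      have h3 := h1 x (mem_ball_self (by positivity))
      have h4 : G * u A ≤ G * u A * (v x / cg) := by
        refine le_mul_of_one_le_right (by positivity) ?_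
        rw [le_div_iff₀ hcg0, one_mul]; exact h3
      have h5 : (CB + 1) * G / cg * u A * v x = (CB + 1) * (G * u A * (v x / cg)) := by ring
      have h6 : 0 ≤ G * u A * (v x / cg) := by positivity
      rw [h5]; nlinarith
    · set z := x + (-H x) • e with hzd
      have hHz : H z = 0 := by rw [hzd, P.tr]; ring
      have hzx : dist z x = H x := by
        rw [hzd, dist_self_add_left, neg_smul, norm_neg, P.ne hHx.le]
      have hxz : z + H x • e = x := by rw [hzd]; simp
      set A' := z + (g * ϱ) • e with hA'
      have hgϱ : 0 < g * ϱ := by positivity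
      have hgϱ1 : g * ϱ ≤ ϱ / 400 := by nlinarith
      have hA'z : dist A' z = g * ϱ := P.de z hgϱ.le
      have hA'H : H A' = g * ϱ := by rw [hA', P.tr, hHz, zero_add]
      have hA'in : A' ∈ ball y (2 * ϱ) := by
        rw [mem_ball]
        have := dist_triangle4 A' z x y
        linarith
      obtain ⟨h1, h2⟩ := hintg A' hA'in (by rw [hA'H]; gcongr)
      have hK : 40 * Λ ^ 2 * (g * ϱ) = ϱ / 10 := by rw [← mul_assoc, hgΛ]; ring
      have hfar : ∀ p ∈ ball z (40 * Λ ^ 2 * (g * ϱ)), κ * ϱ / (4 * Λ) < dist p y := by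
        intro p hp
        rw [hK, mem_ball] at hp
        have := dist_triangle4 x z p y
        rw [dist_comm x z, dist_comm z p] at this
        linarith
      have hsub2 : ball z (40 * Λ ^ 2 * (g * ϱ)) ⊆ ball y0 r1 := by
        refine Subset.trans ?_ hsub
        intro p hp
        rw [hK, mem_ball] at hp
        rw [mem_ball]
        have := dist_triangle4 p z x y
        nlinarith
      have h3 := hB u (fun w => cg⁻¹ * v w) z (g * ϱ) hu (hv.cmul _) hgϱ hHz hsub2
        (fun p hp hpz => hun p hp (hfar p hpz).le)
        (fun p hp hpz => huv p hp (hfar p hpz))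
        (fun p hp hpz => (hvs p hp (hfar p hpz).le).cmul (by positivity))
        (by
          intro p hp
          have hr : ε * κ / (24 * Λ * g) * (g * ϱ) = ε * κ * ϱ / (24 * Λ) := by field_simp
          rw [hr] at hp
          have := h1 p hp
          rw [inv_mul_eq_div, le_div_iff₀ hcg0, one_mul]; exact this)
        (H x) hHx h
      rw [hxz] at h3
      have h4 : CB * u A' * (cg⁻¹ * v x) ≤ CB * (G * u A) * (cg⁻¹ * v x) := by gcongr
      have h5 : (CB + 1) * G / cg * u A * v x = CB * (G * u A) * (cg⁻¹ * v x) + G * u A * (cg⁻¹ * v x) := by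
        field_simp
      have h6 : 0 ≤ G * u A * (cg⁻¹ * v x) := by positivity
      rw [h5]; linarith
  set D := (CB + 1) * G / cg * u A with hD
  have hD0 : 0 ≤ D := by positivity
  set f : ES N → ℝ := fun x => max (u x - D * v x) 0 with hf
  have hfG : Good Ω f := (hu.sub (hv.cmul D)).max0 cx.op
  set S := (ball y (3 * ϱ / 4))ᶜ with hS
  set q : ES N → ℝ := S.indicator f with hq
  have hqG : Good Ω q := hfG.ind cx.op isOpen_ball.measurableSet.compl
  have hf0 : ∀ x, 0 ≤ f x := fun x => le_max_right _ _
  have hq0 : ∀ x, 0 ≤ q x := fun x => indicator_nonneg (fun x _ => hf0 x) x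
  have hMP := MP cx hqG (fun x _ => hq0 x) ?_ ?_
  · intro x hx hxy
    have h1 := hMP x hx
    have hxS : x ∈ S := by rw [hS, mem_compl_iff, mem_ball]; linarith
    rw [hq, indicator_of_mem hxS] at h1
    have := le_max_left (u x - D * v x) 0
    simp only [hf] at h1
    linarith
  · intro x hx hqx
    have hxS : x ∈ S := by
      by_contra hc; rw [hq, indicator_of_notMem hc] at hqx; exact lt_irrefl _ hqx
    rw [hq, indicator_of_mem hxS] at hqx ⊢
    have hxd : 3 * ϱ / 4 ≤ dist x y := by rw [hS, mem_compl_iff, mem_ball, not_lt] at hxS; exact hxS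
    have hpos : 0 < u x - D * v x := by
      by_contra hc
      simp only [hf] at hqx
      rw [max_eq_right (by linarith)] at hqx; exact lt_irrefl _ hqx
    have hxϱ : ϱ < dist x y := by
      by_contra hc
      have := hsh x hx (by linarith) (by linarith)
      linarith
    have hfx : f x = u x - D * v x := max_eq_left hpos.le
    have hcl : ∀ w ∈ closedBall x (RR Ω ε x), w ∈ S := by
      intro w hw
      rw [mem_closedBall] at hw
      have h1 := dista_le_dist_fr cx.op (x := x) hyfr
      have h2 : RR Ω ε x ≤ dist x y / 16 := by
        unfold RR
        have := dista_nonneg (Ω := Ω) x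
        nlinarith
      have h3 := dist_triangle x w y
      rw [dist_comm x w] at h3
      rw [hS, mem_compl_iff, mem_ball, not_lt]
      linarith
    have h1 := (hun x hx (by linarith)).2.1
    have h2 := (hvs x hx (by linarith)).2
    have h3 : u x - D * v x ≤ TT Ω V ε (fun x => u x - D * v x) x := by
      rw [TT_sub cx hx hu (hv.cmul D), TT_cmul, ← h1]
      have := mul_le_mul_of_nonneg_left h2 hD0
      linarith
    have h4 : TT Ω V ε (fun x => u x - D * v x) x ≤ TT Ω V ε q x := by
      refine TT_mono cx hx (hu.sub (hv.cmul D)) hqG fun w hw => ?_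
      rw [hq, indicator_of_mem (hcl w hw)]
      exact le_max_left _ _
    have h5 := TT_le_Ev cx hx hqG (fun w _ => hq0 w)
    rw [hfx]; linarith
  · intro w hw
    rcases lt_or_ge (κ * ϱ / (4 * Λ)) (dist w y) with h | h
    · have h1 := (huv w hw h).max (tendsto_const_nhds (x := (0 : ℝ)))
      rw [max_self] at h1
      refine tendsto_of_tendsto_of_tendsto_of_le_of_le' tendsto_const_nhds h1
        (Eventually.of_forall hq0) ?_
      have h2 : ∀ᶠ x in 𝓝[Ω] w, κ * ϱ / (4 * Λ) < dist x y :=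
        mem_nhdsWithin_of_mem_nhds
          ((continuous_id.dist continuous_const).continuousAt.eventually (lt_mem_nhds h))
      filter_upwards [h2, self_mem_nhdsWithin] with x hx hxΩ
      have h3 := (hvs x hxΩ hx.le).nonneg cx hxΩ
      have h4 : 0 ≤ D * v x := by positivity
      refine (indicator_le_self' (fun x _ => hf0 x) x).trans ?_
      exact max_le_max (by linarith) le_rfl
    · refine tendsto_const_nhds.congr' ?_
      have h2 : ∀ᶠ x in 𝓝[Ω] w, x ∈ ball y (3 * ϱ / 4) :=
        mem_nhdsWithin_of_mem_nhds (isOpen_ball.mem_nhds (by rw [mem_ball]; linarith))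
      filter_upwards [h2] with x hx
      rw [hq, indicator_of_notMem (by rw [hS]; simpa using hx)]

set_option maxHeartbeats 1000000 in
/-- global boundary Harnack principle -/
lemma GBHP (cx : Cx Ω V ε) (P : Patch Ω y0 e H Λ r1) (hε : 32 * Λ ^ 2 * ε ^ 2 ≤ k1 N)
    {κ : ℝ} (hκ : 0 < κ) (hκ1 : κ ≤ 1 / (400 * Λ ^ 2)) : ∃ C : ℝ, 1 ≤ C ∧
    ∀ (u v : ES N → ℝ) (y : ES N) (ϱ : ℝ) (x0 : ES N), Good Ω u → Good Ω v → 0 < ϱ → H y = 0 →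
      ball y (8 * Λ * ϱ) ⊆ ball y0 r1 →
      (∀ x ∈ Ω, κ * ϱ / (4 * Λ) ≤ dist x y → NiceAt Ω V ε u x) →
      (∀ w ∈ frontier Ω, κ * ϱ / (4 * Λ) < dist w y → Tendsto u (𝓝[Ω] w) (𝓝 0)) →
      (∀ x ∈ Ω, κ * ϱ / (4 * Λ) ≤ dist x y → NiceAt Ω V ε v x) →
      (∀ w ∈ frontier Ω, κ * ϱ / (4 * Λ) < dist w y → Tendsto v (𝓝[Ω] w) (𝓝 0)) →
      (∀ x ∈ Ω, 0 < v x) → x0 ∈ Ω → ϱ ≤ dist x0 y →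
      ∀ x ∈ Ω, ϱ ≤ dist x y → v x * u x0 ≤ C * v x0 * u x := by
  have hΛ := P.L1
  have he := cx.e0
  have he1 := cx.e1
  have hΛ2 : 1 ≤ Λ ^ 2 := by nlinarith
  have hκΛ : 400 * Λ ^ 2 * κ ≤ 1 := by
    rw [le_div_iff₀ (by positivity)] at hκ1; linarith
  have hκ2 : κ ≤ 1 / 400 := by nlinarith
  obtain ⟨C, hC, hs⟩ := shell cx P hε hκ hκ1
  have hG := gCt_pos (N := N) (ε := ε) hΛ hκ
  set G := gCt N Λ κ ε with hGd
  refine ⟨(C * G) ^ 2 + 1, by nlinarith [sq_nonneg (C * G)], ?_⟩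
  -- two sided version of shell
  have key : ∀ (u v : ES N → ℝ) (y : ES N) (ϱ : ℝ), Good Ω u → Good Ω v → 0 < ϱ → H y = 0 →
      ball y (8 * Λ * ϱ) ⊆ ball y0 r1 →
      (∀ x ∈ Ω, κ * ϱ / (4 * Λ) ≤ dist x y → NiceAt Ω V ε u x) →
      (∀ w ∈ frontier Ω, κ * ϱ / (4 * Λ) < dist w y → Tendsto u (𝓝[Ω] w) (𝓝 0)) →
      (∀ x ∈ Ω, κ * ϱ / (4 * Λ) ≤ dist x y → NiceAt Ω V ε v x) → 0 < v (y + ϱ • e) →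
      ∀ x ∈ Ω, ϱ ≤ dist x y → u x * v (y + ϱ • e) ≤ C * G * u (y + ϱ • e) * v x := by
    intro u v y ϱ hu hv hϱ hy hsub hun huv hvn hvA x hx hxy
    set A := y + ϱ • e with hA
    have hAd : dist A y = ϱ := P.de y hϱ.le
    have hAH : H A = ϱ := by rw [hA, P.tr, hy, zero_add]
    have hHexc : ∀ x, κ * ϱ / 2 ≤ H x → κ * ϱ / (4 * Λ) ≤ dist x y := by
      intro x hx
      have := P.ub x y
      rw [div_le_iff₀ (by positivity)]
      nlinarith
    have hAin : A ∈ ball y (2 * ϱ) := by rw [mem_ball, hAd]; linarith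
    have hAκ : κ * ϱ ≤ H A := by rw [hAH]; nlinarith
    have h1 := GH cx P hv (b := y) (ϱ := ϱ) (κ := κ) hϱ hκ (by linarith) hy hsub
        (fun x hx _ hxH => hvn x hx (hHexc x hxH)) (w1 := A) (w2 := A) hAin hAin hAκ hAκ
    have h2 := hs u (fun w => G / v A * v w) y ϱ hu (hv.cmul _) hϱ hy hsub hun huv
      (fun p hp hpy => (hvn p hp hpy).sup.cmul (by positivity))
      (fun p hp => by
        have := h1 p hp
        rw [div_mul_eq_mul_div, le_div_iff₀ hvA, one_mul]; exact this) x hx hxy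
    have h3 : C * u A * (G / v A * v x) = (C * G * u A * v x) / v A := by ring
    rw [h3, le_div_iff₀ hvA] at h2
    exact h2
  intro u v y ϱ x0 hu hv hϱ hy hsub hun huv hvn hvv hvpos hx0 hx0y x hx hxy
  have hexc : κ * ϱ / (4 * Λ) ≤ ϱ := by
    rw [div_le_iff₀ (by positivity)]; nlinarith
  have hux := (hun x hx (by linarith)).sup.nonneg cx hx
  have hux0 := (hun x0 hx0 (by linarith)).sup.nonneg cx hx0
  have hvx := hvpos x hx
  have hvx0 := hvpos x0 hx0
  set A := y + ϱ • e with hA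
  have hAd : dist A y = ϱ := P.de y hϱ.le
  have hAΩ : A ∈ Ω := (P.mem _ (hsub (by rw [mem_ball, hAd]; nlinarith))).2
    (by rw [hA, P.tr, hy, zero_add]; exact hϱ)
  have hvA := hvpos A hAΩ
  have huA := (hun A hAΩ (by rw [hAd]; linarith)).sup.nonneg cx hAΩ
  have h1 := key u v y ϱ hu hv hϱ hy hsub hun huv hvn hvA x0 hx0 hx0y
  rw [← hA] at h1
  rcases hux0.eq_or_lt with h | h
  · rw [← h, mul_zero]; positivity
  · have huA' : 0 < u A := by
      rcases huA.eq_or_lt with h' | h'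
      · rw [← h', mul_zero, zero_mul] at h1
        nlinarith [mul_pos h hvA]
      · exact h'
    have h2 := key v u y ϱ hv hu hϱ hy hsub hvn hvv hun huA' x hx hxy
    rw [← hA] at h2
    have h3 := mul_le_mul h1 h2 (by positivity) (by positivity)
    have h4 : (v x * u x0) * (u A * v A) ≤ ((C * G) ^ 2 * v x0 * u x) * (u A * v A) := by
      nlinarith
    have h5 := le_of_mul_le_mul_right h4 (by positivity)
    nlinarith [mul_nonneg hvx0.le hux]

end


section


set_option linter.unusedVariables false

variable {N : ℕ} {Ω : Set (ES N)} {V : ES N → ℝ} {ε : ℝ}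
variable {y0 e : ES N} {H : ES N → ℝ} {Λ r1 : ℝ}

/-! ### linearity of harmonicity -/

lemma lap_cont {φ : ES N → ℝ} (h : ContDiff ℝ (⊤ : ℕ∞) φ) : Continuous (lap φ) := by
  unfold lap
  refine continuous_finsetSum _ fun i _ => ?_
  have h1 : ContDiff ℝ 1 (fun y => fderiv ℝ φ y (EuclideanSpace.single i 1)) := by
    have h2 : ContDiff ℝ 1 (fderiv ℝ φ) := h.fderiv_right (m := 1) (by norm_cast)
    exact h2.clm_apply contDiff_const
  exact (h1.continuous_fderiv one_ne_zero).clm_apply continuous_const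

lemma lap_supp {φ : ES N → ℝ} {x : ES N} (hx : x ∉ tsupport φ) : lap φ x = 0 := by
  unfold lap
  refine Finset.sum_eq_zero fun i _ => ?_
  have h1 : φ =ᶠ[𝓝 x] 0 := notMem_tsupport_iff_eventuallyEq.1 hx
  have h2 : (fun y => fderiv ℝ φ y (EuclideanSpace.single i 1)) =ᶠ[𝓝 x] fun _ => 0 := by
    filter_upwards [h1.eventuallyEq_nhds] with y hy
    rw [hy.fderiv_eq]; simp
  rw [h2.fderiv_eq]; simp

lemma int_test {f g : ES N → ℝ} (hf : LocallyIntegrableOn f Ω) {S : Set (ES N)} (hS : IsCompact S)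
    (hSΩ : S ⊆ Ω) (hg : Continuous g) (hgS : ∀ x ∉ S, g x = 0) :
    IntegrableOn (fun x => f x * g x) Ω := by
  have h1 : IntegrableOn f S := hf.integrableOn_compact_subset hSΩ hS
  have h2 : IntegrableOn (fun x => f x * g x) S := h1.mul_continuousOn hg.continuousOn hS
  have h3 : Integrable (fun x => f x * g x) := by
    rw [← integrableOn_iff_integrable_of_support_subset (s := S)]
    · exact h2
    · intro x hx
      by_contra hc
      exact hx (by simp [hgS x hc])
  exact h3.integrableOn

lemma LVHarmonic.comb {u v : ES N → ℝ} (hu : LVHarmonic Ω V u) (hv : LVHarmonic Ω V v) (a b : ℝ) :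
    LVHarmonic Ω V (fun x => a * u x + b * v x) := by
  have e1 : (fun x => V x * (a * u x + b * v x)) =
      fun x => a * (V x * u x) + b * (V x * v x) := by ext x; ring
  refine ⟨(hu.1.const_mul a |>.add (hv.1.const_mul b)), ?_, ?_, ?_⟩
  · exact (hu.2.1.smul a).add (hv.2.1.smul b)
  · rw [e1]
    exact (hu.2.2.1.smul a).add (hv.2.2.1.smul b)
  · intro φ hφ
    have h1 := hu.2.2.2 φ hφ
    have h2 := hv.2.2.2 φ hφ
    have i1 := int_test hu.2.1 hφ.2.1 hφ.2.2 (lap_cont hφ.1) (fun x hx => lap_supp hx)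
    have i2 := int_test hv.2.1 hφ.2.1 hφ.2.2 (lap_cont hφ.1) (fun x hx => lap_supp hx)
    have i3 := int_test hu.2.2.1 hφ.2.1 hφ.2.2 hφ.1.continuous (fun x hx => image_eq_zero_of_notMem_tsupport hx)
    have i4 := int_test hv.2.2.1 hφ.2.1 hφ.2.2 hφ.1.continuous (fun x hx => image_eq_zero_of_notMem_tsupport hx)
    have e2 : (fun x => (a * u x + b * v x) * lap φ x) =
      fun x => a * (u x * lap φ x) + b * (v x * lap φ x) := by ext x; ring
    have e3 : (fun x => V x * (a * u x + b * v x) * φ x) =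
      fun x => a * (V x * u x * φ x) + b * (V x * v x * φ x) := by ext x; ring
    rw [e2, e3, integral_add (i1.const_mul a) (i2.const_mul b), integral_add (i3.const_mul a) (i4.const_mul b)]
    simp only [integral_const_mul]
    rw [h1, h2]

lemma LVHarmonic.congr {u v : ES N → ℝ} (ho : IsOpen Ω) (hu : LVHarmonic Ω V u) (h : ∀ x ∈ Ω, u x = v x) :
    LVHarmonic Ω V v := by
  have hae : u =ᵐ[volume.restrict Ω] v := (ae_restrict_iff' ho.measurableSet).2 (Eventually.of_forall h)
  refine ⟨hu.1.congr fun x hx => (h x hx).symm, hu.2.1.congr hae, hu.2.2.1.congr ?_, ?_⟩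
  · filter_upwards [hae] with x hx
    rw [hx]
  · intro φ hφ
    have h1 := hu.2.2.2 φ hφ
    have e1 : ∫ x in Ω, v x * lap φ x = ∫ x in Ω, u x * lap φ x :=
      setIntegral_congr_fun ho.measurableSet (fun x hx => by simp only [h x hx])
    have e2 : ∫ x in Ω, V x * v x * φ x = ∫ x in Ω, V x * u x * φ x :=
      setIntegral_congr_fun ho.measurableSet (fun x hx => by simp only [h x hx])
    rw [e1, e2]; exact h1

/-! ### interior Harnack -/

def NiceAll (Ω : Set (ES N)) (V : ES N → ℝ) (ε : ℝ) (u : ES N → ℝ) : Prop :=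
  Good Ω u ∧ ∀ x ∈ Ω, NiceAt Ω V ε u x

lemma harn_loc (cx : Cx Ω V ε) {p : ES N} (hp : p ∈ Ω) {u : ES N → ℝ} (hu : NiceAll Ω V ε u)
    {w1 w2 : ES N} (h1 : w1 ∈ ball p (RR Ω ε p / 64)) (h2 : w2 ∈ ball p (RR Ω ε p / 64)) :
    u w1 ≤ CH N 34 * u w2 := by
  have hR := cx.Rpos hp
  have hin : ∀ w ∈ closedBall p (RR Ω ε p), w ∈ Ω := cx.cb1 hp
  have he := cx.e0
  rw [mem_ball] at h1 h2
  have hw1 : w1 ∈ Ω := hin _ (by rw [mem_closedBall]; linarith)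
  have := HB cx hu.1 (p := w1) (s := RR Ω ε p / 32) (K := 34) (by positivity) (hu.2 w1 hw1) ?_ w2 ?_
  · have hC := CH_pos (N := N) (K := 34) (by norm_num)
    rwa [← div_eq_mul_inv, div_le_iff₀ hC, mul_comm] at this
  · intro w hw
    rw [mem_ball] at hw
    have hwp : w ∈ closedBall p (RR Ω ε p) := by
      rw [mem_closedBall]
      have := dist_triangle w w1 p
      linarith
    have hd := cx.dball hwp
    have h3 := mul_le_mul_of_nonneg_left hd.1 he.le
    have h4 := mul_le_mul_of_nonneg_left hd.2 he.le
    refine ⟨hin _ hwp, (hu.2 w (hin _ hwp)).sup, ?_, ?_⟩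
    · unfold RR at hR ⊢; linarith
    · unfold RR at hR ⊢; linarith
  · rw [mem_ball]
    have := dist_triangle_right w2 w1 p
    linarith

lemma harn_glob (cx : Cx Ω V ε) (hc : IsPreconnected Ω) {x y : ES N} (hx : x ∈ Ω) (hy : y ∈ Ω) :
    ∃ C : ℝ, 0 < C ∧ ∀ u, NiceAll Ω V ε u → u x ≤ C * u y ∧ u y ≤ C * u x := by
  refine hc.induction₂ (P := fun x y => ∃ C : ℝ, 0 < C ∧ ∀ u, NiceAll Ω V ε u → u x ≤ C * u y ∧ u y ≤ C * u x)
    ?_ ?_ ?_ hx hy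
  · intro x hx
    have hR := cx.Rpos hx
    have h1 : ball x (RR Ω ε x / 64) ∈ 𝓝[Ω] x := mem_nhdsWithin_of_mem_nhds (ball_mem_nhds _ (by positivity))
    filter_upwards [h1] with y hy
    exact ⟨CH N 34, CH_pos (by norm_num), fun u hu =>
      ⟨harn_loc cx hx hu (mem_ball_self (by positivity)) hy,
        harn_loc cx hx hu hy (mem_ball_self (by positivity))⟩⟩
  · rintro x y z hx hy hz ⟨C, hC, h1⟩ ⟨D, hD, h2⟩
    refine ⟨C * D, by positivity, fun u hu => ⟨?_, ?_⟩⟩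
    · have a1 := (h1 u hu).1
      have a2 := mul_le_mul_of_nonneg_left (h2 u hu).1 hC.le
      linarith
    · have a1 := (h2 u hu).2
      have a2 := mul_le_mul_of_nonneg_left (h1 u hu).2 hD.le
      linarith
  · rintro x y hx hy ⟨C, hC, h1⟩
    exact ⟨C, hC, fun u hu => (h1 u hu).symm⟩

lemma harn_nb (cx : Cx Ω V ε) (hc : IsPreconnected Ω) {x0 x : ES N} (hx0 : x0 ∈ Ω) (hx : x ∈ Ω) :
    ∃ C s : ℝ, 0 < C ∧ 0 < s ∧ ball x s ⊆ Ω ∧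
      ∀ u, NiceAll Ω V ε u → ∀ w ∈ ball x s, u w ≤ C * u x0 ∧ u x0 ≤ C * u w := by
  obtain ⟨C, hC, h⟩ := harn_glob cx hc hx0 hx
  have hR := cx.Rpos hx
  have hCH := CH_pos (N := N) (K := 34) (by norm_num)
  have hxb : x ∈ ball x (RR Ω ε x / 64) := mem_ball_self (by positivity)
  refine ⟨C * CH N 34, RR Ω ε x / 64, by positivity, by positivity, ?_, ?_⟩
  · exact (ball_subset_ball (by linarith)).trans (ball_subset_closedBall.trans (cx.cb1 hx))
  · intro u hu w hw
    have a1 := mul_le_mul_of_nonneg_left (h u hu).2 hCH.le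
    have a2 := mul_le_mul_of_nonneg_left (harn_loc cx hx hu hxb hw) hC.le
    have a3 := harn_loc cx hx hu hw hxb
    have a4 := (h u hu).1
    constructor <;> nlinarith

/-! ### kernels -/

structure Ker (Ω : Set (ES N)) (V : ES N → ℝ) (x0 : ES N) (k : ES N → ES N → ℝ) : Prop where
  harm : ∀ y ∈ frontier Ω, LVHarmonic Ω V (k y)
  meas : ∀ y, Measurable (k y)
  pos : ∀ y ∈ frontier Ω, ∀ x ∈ Ω, 0 < k y x
  one : ∀ y ∈ frontier Ω, k y x0 = 1
  van : ∀ y ∈ frontier Ω, ∀ z ∈ frontier Ω, z ≠ y → Tendsto (k y) (𝓝[Ω] z) (𝓝 0)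
  zx : ∀ y x, x ∉ Ω → k y x = 0
  zy : ∀ y x, y ∉ frontier Ω → k y x = 0

lemma Ker.nonneg {x0 : ES N} {k : ES N → ES N → ℝ} (hk : Ker Ω V x0 k) (y x : ES N) : 0 ≤ k y x := by
  by_cases hy : y ∈ frontier Ω
  · by_cases hx : x ∈ Ω
    · exact (hk.pos y hy x hx).le
    · exact (hk.zx y x hx).ge
  · exact (hk.zy y x hy).ge

lemma Ker.good {x0 : ES N} {k : ES N → ES N → ℝ} (hk : Ker Ω V x0 k) (ho : IsOpen Ω) {y : ES N}
    (hy : y ∈ frontier Ω) : Good Ω (k y) := Good.of_cont (hk.harm y hy).1 (hk.meas y) ho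

lemma Ker.nice {x0 : ES N} {k : ES N → ES N → ℝ} (hk : Ker Ω V x0 k) (cx : Cx Ω V ε) {y : ES N}
    (hy : y ∈ frontier Ω) : NiceAll Ω V ε (k y) :=
  ⟨hk.good cx.op hy, fun x hx => harm_nice cx (hk.harm y hy) (hk.meas y) hx fun w _ => hk.nonneg y w⟩

set_option maxHeartbeats 1000000 in
/-- Hölder type continuity in the pole -/
lemma osc (cx : Cx Ω V ε) (P : Patch Ω y0 e H Λ r1) (hε : 32 * Λ ^ 2 * ε ^ 2 ≤ k1 N)
    {x0 : ES N} (hx0 : x0 ∈ Ω) {k : ES N → ES N → ℝ} (hk : Ker Ω V x0 k) :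
    ∃ C θ : ℝ, 1 ≤ C ∧ 0 < θ ∧ ∀ y1 ∈ frontier Ω, ∀ (n : ℕ) (t : ℝ), 0 < t → dist y1 y0 ≤ θ * t →
      8 * Λ * ((2 / θ) ^ n * t) ≤ r1 → (2 / θ) ^ n * t ≤ dist x0 y0 →
      ∃ α β : ℝ, α ≤ 1 ∧ 1 ≤ β ∧ β - α ≤ C * (1 - 1 / C) ^ n ∧
        ∀ x ∈ Ω, (2 / θ) ^ n * t ≤ dist x y0 → α * k y0 x ≤ k y1 x ∧ k y1 x ≤ β * k y0 x := by
  have hΛ := P.L1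
  have he := cx.e0
  have he1 := cx.e1
  have hκ : 0 < 1 / (400 * Λ ^ 2) := by positivity
  obtain ⟨C, hC, hG⟩ := GBHP cx P hε hκ le_rfl
  set κ := 1 / (400 * Λ ^ 2) with hκd
  have hC0 : 0 < C := by linarith
  set θ := κ / (4 * Λ) with hθ
  have hθ0 : 0 < θ := by positivity
  have hθ1 : θ ≤ 1 / 2 := by
    have : κ ≤ 1 := by rw [hκd, div_le_one (by positivity)]; nlinarith
    rw [hθ, div_le_iff₀ (by positivity)]; nlinarith
  have hθe : ∀ ϱ, κ * ϱ / (4 * Λ) = θ * ϱ := fun ϱ => by rw [hθ]; ring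
  have hy0 : y0 ∈ frontier Ω := (P.fr y0 (mem_ball_self P.r0)).2 P.H0
  refine ⟨C, θ, hC, hθ0, ?_⟩
  intro y1 hy1 n t ht hd
  have hone : k y0 x0 = 1 := hk.one y0 hy0
  have hone1 : k y1 x0 = 1 := hk.one y1 hy1
  have hg0 := hk.good cx.op hy0
  have hg1 := hk.good cx.op hy1
  have hpos0 := hk.pos y0 hy0
  have hpos1 := hk.pos y1 hy1
  have hb1 : 1 ≤ 2 / θ := by rw [le_div_iff₀ hθ0]; linarith
  have van0 : ∀ w ∈ frontier Ω, θ * t < dist w y0 → Tendsto (k y0) (𝓝[Ω] w) (𝓝 0) := fun w hw hwd =>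
    hk.van y0 hy0 w hw (by rintro rfl; rw [dist_self] at hwd; nlinarith)
  have van1 : ∀ w ∈ frontier Ω, θ * t < dist w y0 → Tendsto (k y1) (𝓝[Ω] w) (𝓝 0) := fun w hw hwd =>
    hk.van y1 hy1 w hw (by rintro rfl; linarith)
  induction n with
  | zero =>
    simp only [pow_zero, one_mul, mul_one]
    intro h1 h2
    have hsub : ball y0 (8 * Λ * t) ⊆ ball y0 r1 := ball_subset_ball h1
    have a1 := hG (k y1) (k y0) y0 t x0 hg1 hg0 ht P.H0 hsub (fun x hx _ => (hk.nice cx hy1).2 x hx)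
      (by rw [hθe]; exact van1) (fun x hx _ => (hk.nice cx hy0).2 x hx)
      (by rw [hθe]; exact van0) hpos0 hx0 h2
    have a2 := hG (k y0) (k y1) y0 t x0 hg0 hg1 ht P.H0 hsub (fun x hx _ => (hk.nice cx hy0).2 x hx)
      (by rw [hθe]; exact van0) (fun x hx _ => (hk.nice cx hy1).2 x hx)
      (by rw [hθe]; exact van1) hpos1 hx0 h2
    refine ⟨1 / C, C, by rw [div_le_one hC0]; exact hC, hC, ?_, ?_⟩
    · have : 0 < 1 / C := by positivity
      linarith
    · intro x hx hxd
      have b1 := a1 x hx hxd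
      have b2 := a2 x hx hxd
      rw [hone, hone1] at b1 b2
      constructor
      · rw [div_mul_eq_mul_div, div_le_iff₀ hC0]; linarith
      · linarith
  | succ n ih =>
    intro h1 h2
    set b := 2 / θ with hb
    have hbθ : θ * b = 2 := by rw [hb]; field_simp
    have hbn : 0 < b ^ n * t := by positivity
    have hbs : b ^ (n + 1) * t = b * (b ^ n * t) := by rw [pow_succ]; ring
    have hle : b ^ n * t ≤ b ^ (n + 1) * t := by rw [hbs]; nlinarith
    have htn : t ≤ b ^ n * t := by have := one_le_pow₀ hb1 (n := n); nlinarith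
    obtain ⟨α, β, hα, hβ, hαβ, hcmp⟩ := ih (by nlinarith) (hle.trans h2)
    set ϱ := b ^ (n + 1) * t with hϱ
    have hϱ0 : 0 < ϱ := by positivity
    have hexc : κ * ϱ / (4 * Λ) = 2 * (b ^ n * t) := by rw [hθe, hbs, ← mul_assoc, hbθ]
    have hcb : ∀ x ∈ Ω, κ * ϱ / (4 * Λ) ≤ dist x y0 → ∀ w ∈ closedBall x (RR Ω ε x),
        w ∈ Ω ∧ b ^ n * t ≤ dist w y0 := by
      intro x hx hxd w hw
      refine ⟨cx.cb1 hx hw, ?_⟩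
      rw [hexc] at hxd
      rw [mem_closedBall] at hw
      have h1 := dista_le_dist_fr cx.op (x := x) hy0
      have h2 : RR Ω ε x ≤ dist x y0 / 16 := by
        unfold RR
        have := dista_nonneg (Ω := Ω) x
        nlinarith
      have h3 := dist_triangle x w y0
      rw [dist_comm x w] at h3
      linarith
    have hexc2 : θ * t ≤ κ * ϱ / (4 * Λ) := by rw [hexc]; nlinarith
    have hsub : ball y0 (8 * Λ * ϱ) ⊆ ball y0 r1 := ball_subset_ball h1
    have comb : ∀ a c : ℝ, (∀ x ∈ Ω, b ^ n * t ≤ dist x y0 → 0 ≤ a * k y1 x + c * k y0 x) →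
        ∀ x ∈ Ω, ϱ ≤ dist x y0 → k y0 x * (a + c) ≤ C * (a * k y1 x + c * k y0 x) := by
      intro a c hac x hx hxd
      have hh := (hk.harm y1 hy1).comb (hk.harm y0 hy0) a c
      have := hG (fun x => a * k y1 x + c * k y0 x) (k y0) y0 ϱ x0 ((hg1.cmul a).add (hg0.cmul c)) hg0 hϱ0
        P.H0 hsub
        (fun x hx hxd => harm_nice cx hh (((hk.meas y1).const_mul a).add ((hk.meas y0).const_mul c)) hx
          fun w hw => hac w (hcb x hx hxd w hw).1 (hcb x hx hxd w hw).2)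
        (by
          intro w hw hwd
          have l1 := (van1 w hw (by linarith)).const_mul a
          have l2 := (van0 w hw (by linarith)).const_mul c
          have l3 := l1.add l2
          simpa using l3)
        (fun x hx _ => (hk.nice cx hy0).2 x hx) (fun w hw hwd => van0 w hw (by linarith)) hpos0 hx0 h2 x hx hxd
      rw [hone, hone1, mul_one, mul_one] at this
      simpa only [mul_one] using this
    have c1 := comb 1 (-α) (fun x hx hxd => by have := (hcmp x hx hxd).1; linarith)
    have c2 := comb (-1) β (fun x hx hxd => by have := (hcmp x hx hxd).2; linarith)
    have hCi : 1 / C ≤ 1 := by rw [div_le_one hC0]; exact hC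
    have hCi0 : 0 < 1 / C := by positivity
    refine ⟨α + (1 - α) / C, β - (β - 1) / C, ?_, ?_, ?_, ?_⟩
    · have : (1 - α) / C ≤ 1 - α := div_le_self (by linarith) hC
      linarith
    · have : (β - 1) / C ≤ β - 1 := div_le_self (by linarith) hC
      linarith
    · have : β - (β - 1) / C - (α + (1 - α) / C) = (β - α) * (1 - 1 / C) := by ring
      rw [this, pow_succ, ← mul_assoc]
      exact mul_le_mul_of_nonneg_right hαβ (by linarith)
    · intro x hx hxd
      have d1 := c1 x hx hxd
      have d2 := c2 x hx hxd
      constructor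
      · have : k y0 x * (1 + -α) / C ≤ 1 * k y1 x + -α * k y0 x := by
          rw [div_le_iff₀ hC0]; linarith
        have e1 : (α + (1 - α) / C) * k y0 x = α * k y0 x + k y0 x * (1 + -α) / C := by ring
        rw [e1]; linarith
      · have : k y0 x * (-1 + β) / C ≤ -1 * k y1 x + β * k y0 x := by
          rw [div_le_iff₀ hC0]; linarith
        have e1 : (β - (β - 1) / C) * k y0 x = β * k y0 x - k y0 x * (-1 + β) / C := by ring
        rw [e1]; linarith

lemma ker_cont_at (cx : Cx Ω V ε) (P : Patch Ω y0 e H Λ r1) (hε : 32 * Λ ^ 2 * ε ^ 2 ≤ k1 N)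
    {x0 : ES N} (hx0 : x0 ∈ Ω) {k : ES N → ES N → ℝ} (hk : Ker Ω V x0 k) {x : ES N} (hx : x ∈ Ω) :
    ContinuousWithinAt (fun y => k y x) (frontier Ω) y0 := by
  have hΛ := P.L1
  obtain ⟨C, θ, hC, hθ, h⟩ := osc cx P hε hx0 hk
  have hy0 : y0 ∈ frontier Ω := (P.fr y0 (mem_ball_self P.r0)).2 P.H0
  have hC0 : 0 < C := by linarith
  have hnot : ∀ z ∈ Ω, 0 < dist z y0 := fun z hz =>
    lt_of_lt_of_le (cx.dpos hz) (dista_le_dist_fr cx.op hy0)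
  set m := min (r1 / (8 * Λ)) (min (dist x0 y0) (dist x y0)) with hm
  have hm0 : 0 < m := lt_min (div_pos P.r0 (by positivity)) (lt_min (hnot x0 hx0) (hnot x hx))
  have hv := hk.pos y0 hy0 x hx
  rw [Metric.continuousWithinAt_iff]
  intro η hη
  have hγ0 : 0 ≤ 1 - 1 / C := by
    have : 1 / C ≤ 1 := by rw [div_le_one hC0]; exact hC
    linarith
  have hγ1 : 1 - 1 / C < 1 := by
    have : 0 < 1 / C := by positivity
    linarith
  obtain ⟨n, hn⟩ := exists_pow_lt_of_lt_one (div_pos hη (mul_pos hC0 hv)) hγ1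
  rw [lt_div_iff₀ (mul_pos hC0 hv)] at hn
  set b := (2 / θ) ^ n with hb
  have hb0 : 0 < b := by positivity
  have hbm : b * (m / b) = m := by field_simp
  refine ⟨θ * (m / b), by positivity, ?_⟩
  intro y1 hy1 hyd
  obtain ⟨α, β, hα, hβ, hαβ, hcmp⟩ := h y1 hy1 n (m / b) (by positivity) hyd.le
    (by
      rw [hbm]
      have : m ≤ r1 / (8 * Λ) := min_le_left _ _
      rw [le_div_iff₀ (by positivity)] at this; linarith)
    (by rw [hbm]; exact (min_le_right _ _).trans (min_le_left _ _))
  obtain ⟨h1, h2⟩ := hcmp x hx (by rw [hbm]; exact (min_le_right _ _).trans (min_le_right _ _))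
  have h3 : (β - α) * k y0 x ≤ C * (1 - 1 / C) ^ n * k y0 x := mul_le_mul_of_nonneg_right hαβ hv.le
  have h4 : α * k y0 x ≤ k y0 x := mul_le_of_le_one_left hv.le hα
  have h5 : k y0 x ≤ β * k y0 x := le_mul_of_one_le_left hv.le hβ
  rw [Real.dist_eq, abs_lt]
  constructor <;> nlinarith

end


section


set_option linter.unusedVariables false

variable {N : ℕ} {Ω : Set (ES N)} {V : ES N → ℝ} {ε : ℝ}
variable {y0 e : ES N} {H : ES N → ℝ} {Λ r1 : ℝ}

structure Dom (Ω : Set (ES N)) (V : ES N → ℝ) (a : ℝ) (x0 : ES N) : Prop where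
  lip : IsLipschitzDomain Ω
  bd : Bornology.IsBounded Ω
  ne : (Ωᶜ).Nonempty
  a0 : 0 < a
  V : VClass Ω a V
  x0 : x0 ∈ Ω

variable {a : ℝ} {x0 : ES N} {k : ES N → ES N → ℝ}

lemma Dom.zero (D : Dom Ω V a x0) : Dom Ω (fun _ => 0) a x0 :=
  ⟨D.lip, D.bd, D.ne, D.a0, ⟨measurable_const, fun x _ => ⟨le_rfl, by rw [zero_mul]; exact D.a0.le⟩⟩, D.x0⟩

lemma Dom.cx (D : Dom Ω V a x0) (hΛ : 1 ≤ Λ) : ∃ ε, Cx Ω V ε ∧ 32 * Λ ^ 2 * ε ^ 2 ≤ k1 N := by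
  have ha := D.a0
  have hk := k1_pos (N := N)
  set ε := min (1 / 16) (min (1 / (4 * (a + 1))) (k1 N / (32 * Λ ^ 2))) with hε
  have h0 : 0 < ε := lt_min (by norm_num) (lt_min (by positivity) (by positivity))
  have h1 : ε ≤ 1 / 16 := min_le_left _ _
  have h2 : ε ≤ 1 / (4 * (a + 1)) := (min_le_right _ _).trans (min_le_left _ _)
  have h3 : ε ≤ k1 N / (32 * Λ ^ 2) := (min_le_right _ _).trans (min_le_right _ _)
  rw [le_div_iff₀ (by positivity)] at h2 h3
  have h4 : ε ^ 2 ≤ ε := by nlinarith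
  refine ⟨ε, ⟨D.lip.1, D.bd, D.ne, h0, h1, D.V.1, fun x hx => (D.V.2 x hx).1, fun x hx => ?_⟩, ?_⟩
  · have h5 := (D.V.2 x hx).2
    have h6 : V x * dista Ω x ^ 2 * ε ^ 2 ≤ a * ε ^ 2 := mul_le_mul_of_nonneg_right h5 (by positivity)
    nlinarith
  · have : 32 * Λ ^ 2 * ε ^ 2 ≤ 32 * Λ ^ 2 * ε := mul_le_mul_of_nonneg_left h4 (by positivity)
    linarith

lemma Dom.cx1 (D : Dom Ω V a x0) : ∃ ε, Cx Ω V ε := by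
  obtain ⟨ε, h, _⟩ := D.cx (Λ := 1) le_rfl
  exact ⟨ε, h⟩

lemma Ker.contOn (D : Dom Ω V a x0) (hk : Ker Ω V x0 k) (x : ES N) :
    ContinuousOn (fun y => k y x) (frontier Ω) := by
  by_cases hx : x ∈ Ω
  · intro y0 hy0
    obtain ⟨e, H, Λ, r1, P⟩ := exists_patch D.lip D.ne hy0
    obtain ⟨ε, cx, hε⟩ := D.cx P.L1
    exact ker_cont_at cx P hε D.x0 hk hx
  · have : (fun y => k y x) = fun _ => 0 := by ext y; exact hk.zx y x hx
    rw [this]; exact continuousOn_const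

lemma Ker.jm (D : Dom Ω V a x0) (hk : Ker Ω V x0 k) : Measurable (fun p : ES N × ES N => k p.1 p.2) := by
  have hfr : MeasurableSet (frontier Ω) := isClosed_frontier.measurableSet
  have h1 : StronglyMeasurable (Function.uncurry fun (y : frontier Ω) (x : ES N) => k y x) := by
    refine stronglyMeasurable_uncurry_of_continuous_of_stronglyMeasurable ?_ ?_
    · intro x
      exact continuousOn_iff_continuous_domRestrict.1 (hk.contOn D x)
    · intro y; exact (hk.meas y).stronglyMeasurable
  set S : Set (ES N × ES N) := Prod.fst ⁻¹' (frontier Ω) with hS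
  have hSm : MeasurableSet S := measurable_fst hfr
  refine measurable_of_restrict_of_restrict_compl hSm ?_ ?_
  · have h2 : Measurable (fun p : S => ((⟨p.1.1, p.2⟩ : frontier Ω), p.1.2)) := by
      refine Measurable.prodMk ?_ ?_
      · exact Measurable.subtype_mk (measurable_fst.comp measurable_subtype_coe)
      · exact measurable_snd.comp measurable_subtype_coe
    exact h1.measurable.comp h2
  · have : Sᶜ.domRestrict (fun p : ES N × ES N => k p.1 p.2) = fun _ => 0 := by
      ext p; exact hk.zy _ _ p.2
    rw [this]; exact measurable_const

lemma Ker.bound (D : Dom Ω V a x0) (hk : Ker Ω V x0 k) {x : ES N} (hx : x ∈ Ω) :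
    ∃ C s : ℝ, 0 < C ∧ 0 < s ∧ ball x s ⊆ Ω ∧ ∀ y, ∀ w ∈ ball x s, k y w ≤ C ∧
      (y ∈ frontier Ω → 1 ≤ C * k y w) := by
  obtain ⟨ε, cx⟩ := D.cx1
  obtain ⟨C, s, hC, hs, hb, h⟩ := harn_nb cx D.lip.2.1.isPreconnected D.x0 hx
  refine ⟨C, s, hC, hs, hb, fun y w hw => ?_⟩
  by_cases hy : y ∈ frontier Ω
  · have := h _ (hk.nice cx hy) w hw
    rw [hk.one y hy, mul_one] at this
    exact ⟨this.1, fun _ => this.2⟩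
  · rw [hk.zy y w hy]
    exact ⟨hC.le, fun h => absurd h hy⟩

lemma Ker.boundc (D : Dom Ω V a x0) (hk : Ker Ω V x0 k) {S : Set (ES N)} (hS : IsCompact S) (hSΩ : S ⊆ Ω) :
    ∃ C, ∀ y, ∀ w ∈ S, k y w ≤ C := by
  refine hS.induction_on (p := fun s => ∃ C, ∀ y, ∀ w ∈ s, k y w ≤ C) ⟨0, by simp⟩ ?_ ?_ ?_
  · rintro s t hst ⟨C, hC⟩; exact ⟨C, fun y x hx => hC y x (hst hx)⟩
  · rintro s t ⟨C, hC⟩ ⟨D, hD⟩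
    refine ⟨max C D, ?_⟩
    rintro y x (hx | hx)
    · exact (hC y x hx).trans (le_max_left _ _)
    · exact (hD y x hx).trans (le_max_right _ _)
  · intro x hx
    obtain ⟨C, s, hC, hs, hb, h⟩ := hk.bound D (hSΩ hx)
    exact ⟨ball x s, mem_nhdsWithin_of_mem_nhds (ball_mem_nhds _ hs), C, fun y w hw => (h y w hw).1⟩

/-- potential of a measure -/
def hh (k : ES N → ES N → ℝ) (ν : Measure (ES N)) (x : ES N) : ℝ := ∫ y, k y x ∂ν

variable {ν : Measure (ES N)} [IsFiniteMeasure ν]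

lemma Ker.my (D : Dom Ω V a x0) (hk : Ker Ω V x0 k) (x : ES N) : Measurable (fun y => k y x) :=
  (hk.jm D).comp measurable_prodMk_right

lemma Ker.int (D : Dom Ω V a x0) (hk : Ker Ω V x0 k) (x : ES N) : Integrable (fun y => k y x) ν := by
  by_cases hx : x ∈ Ω
  · obtain ⟨C, s, hC, hs, hb, h⟩ := hk.bound D hx
    refine (integrable_const C).mono' (hk.my D x).aestronglyMeasurable (Eventually.of_forall fun y => ?_)
    rw [Real.norm_of_nonneg (hk.nonneg y x)]
    exact (h y x (mem_ball_self hs)).1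
  · have : (fun y => k y x) = fun _ => 0 := by ext y; exact hk.zx y x hx
    rw [this]; exact integrable_const _

lemma hh_nonneg (hk : Ker Ω V x0 k) (x : ES N) : 0 ≤ hh k ν x := integral_nonneg fun y => hk.nonneg y x

lemma hh_le {C : ℝ} {x : ES N} (D : Dom Ω V a x0) (hk : Ker Ω V x0 k) (h : ∀ y, k y x ≤ C) :
    hh k ν x ≤ C * ν.real univ := by
  have := integral_mono (μ := ν) (hk.int D x) (integrable_const C) h
  rw [integral_const, smul_eq_mul, mul_comm] at this
  exact this

lemma hh_good (D : Dom Ω V a x0) (hk : Ker Ω V x0 k) : Good Ω (hh k ν) := by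
  refine ⟨?_, fun x hx => ?_⟩
  · have h : StronglyMeasurable (fun p : ES N × ES N => k p.2 p.1) :=
      ((hk.jm D).comp measurable_swap).stronglyMeasurable
    exact h.integral_prod_right'.measurable
  · obtain ⟨C, s, hC, hs, hb, h⟩ := hk.bound D hx
    refine ⟨C * ν.real univ, ?_⟩
    filter_upwards [ball_mem_nhds x hs] with w hw
    rw [abs_of_nonneg (hh_nonneg hk w)]
    exact hh_le D hk fun y => (h y w hw).1

lemma hh_TT (D : Dom Ω V a x0) (hk : Ker Ω V x0 k) (cx : Cx Ω V ε) {z : ES N} (hz : z ∈ Ω) :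
    TT Ω V ε (hh k ν) z = hh k ν z := by
  obtain ⟨C, hC⟩ := hk.boundc D (isCompact_closedBall z (RR Ω ε z)) (cx.cb1 hz)
  have hm : Measurable (fun p : (ℝ × ES N) × ES N => kk Ω V ε z p.1 * k p.2 (ZZ Ω ε z p.1)) := by
    refine ((kk_meas cx.Vm).comp measurable_fst).mul ?_
    exact (hk.jm D).comp (measurable_snd.prodMk (ZZ_meas.comp measurable_fst))
  have hI : Integrable (fun p : (ℝ × ES N) × ES N => kk Ω V ε z p.1 * k p.2 (ZZ Ω ε z p.1)) ((mm N).prod ν) := by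
    refine (integrable_const C).mono' hm.aestronglyMeasurable ?_
    have h1 : ∀ᵐ p ∂((mm N).prod ν), (0 ≤ RR Ω ε z → ZZ Ω ε z p.1 ∈ closedBall z (RR Ω ε z)) :=
      Measure.quasiMeasurePreserving_fst.ae (ZZ_mem (N := N))
    filter_upwards [h1] with p hp
    have h2 := hC p.2 _ (hp (cx.Rpos hz).le)
    have h3 := hk.nonneg p.2 (ZZ Ω ε z p.1)
    have h4 := kk_ge (Ω := Ω) (V := V) (ε := ε) (z := z) p.1
    rw [Real.norm_of_nonneg (mul_nonneg (by linarith) h3)]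
    exact (mul_le_of_le_one_left h3 (kk_le _)).trans h2
  unfold TT hh
  have e1 : ∀ ω, kk Ω V ε z ω * ∫ y, k y (ZZ Ω ε z ω) ∂ν = ∫ y, kk Ω V ε z ω * k y (ZZ Ω ε z ω) ∂ν :=
    fun ω => (integral_const_mul _ _).symm
  simp only [e1]
  rw [integral_integral_swap hI]
  refine integral_congr_ae (Eventually.of_forall fun y => ?_)
  by_cases hy : y ∈ frontier Ω
  · exact ((hk.nice cx hy).2 z hz).2.1.symm
  · simp [hk.zy y _ hy]

lemma hh_vanish (D : Dom Ω V a x0) (hk : Ker Ω V x0 k) {S : Set (ES N)} (hS : IsClosed S)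
    (hν : ν Sᶜ = 0) {w : ES N} (hw : w ∈ frontier Ω) (hwS : w ∉ S) :
    Tendsto (hh k ν) (𝓝[Ω] w) (𝓝 0) := by
  obtain ⟨e, H, Λ, r1, P⟩ := exists_patch D.lip D.ne hw
  obtain ⟨ε, cx, hε⟩ := D.cx P.L1
  have hΛ := P.L1
  obtain ⟨C, hC, hcar⟩ := carleson cx P hε
  obtain ⟨d, hd, hdS⟩ := Metric.isOpen_iff.1 hS.isOpen_compl w hwS
  set ρ := min d r1 / (40 * Λ ^ 2) with hρ
  have hm : 0 < min d r1 := lt_min hd P.r0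
  have hρ0 : 0 < ρ := by positivity
  have hρe : 40 * Λ ^ 2 * ρ = min d r1 := by rw [hρ]; field_simp
  have hAin : w + ρ • e ∈ ball w r1 := by
    rw [mem_ball, P.de w hρ0.le]
    have h3 : min d r1 ≤ r1 := min_le_right _ _
    have h4 : 1 ≤ Λ ^ 2 := by nlinarith
    have h5 : ρ < 40 * Λ ^ 2 * ρ := by nlinarith
    linarith
  have hAΩ : w + ρ • e ∈ Ω := (P.mem _ hAin).2 (by rw [P.tr, P.H0, zero_add]; exact hρ0)
  obtain ⟨B, s, hB, hs, hb, hbd⟩ := hk.bound D hAΩ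
  have hae : ∀ᵐ y ∂ν, y ∈ S := by
    rw [ae_iff]; exact hν
  have h0 : (0 : ℝ) = ∫ y, (0 : ℝ) ∂ν := by simp
  rw [h0]
  refine tendsto_integral_filter_of_dominated_convergence (fun _ => C * B)
    (Eventually.of_forall fun x => (hk.my D x).aestronglyMeasurable) ?_ (integrable_const _) ?_
  · have hball : ∀ᶠ x in 𝓝[Ω] w, x ∈ ball w ρ := mem_nhdsWithin_of_mem_nhds (ball_mem_nhds _ hρ0)
    filter_upwards [hball, self_mem_nhdsWithin] with x hx hxΩ
    filter_upwards [hae] with y hy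
    rw [Real.norm_of_nonneg (hk.nonneg y x)]
    by_cases hyf : y ∈ frontier Ω
    · refine (hcar (k y) w ρ (hk.good cx.op hyf) hρ0 P.H0 ?_ (fun x hx _ => (hk.nice cx hyf).2 x hx) ?_ x hxΩ hx).trans ?_
      · rw [hρe]; exact ball_subset_ball (min_le_right _ _)
      · intro z hz hzb
        refine hk.van y hyf z hz ?_
        rintro rfl
        rw [hρe] at hzb
        exact hdS (ball_subset_ball (min_le_left _ _) hzb) hy
      · exact mul_le_mul_of_nonneg_left (hbd y _ (mem_ball_self hs)).1 (by linarith)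
    · rw [hk.zy y x hyf]; positivity
  · filter_upwards [hae] with y hy
    by_cases hyf : y ∈ frontier Ω
    · exact hk.van y hyf w hw (by rintro rfl; exact hwS hy)
    · have : (fun x => k y x) = fun _ => 0 := by ext x; exact hk.zy y x hyf
      rw [this]; exact tendsto_const_nhds

end


section


set_option linter.unusedVariables false
set_option linter.unusedSectionVars false

variable {N : ℕ} {Ω : Set (ES N)} {V : ES N → ℝ} {ε : ℝ}
variable {y0 e : ES N} {H : ES N → ℝ} {Λ r1 : ℝ}

open Classical in
/-- iterates for the reduced function of 1 on B -/
def rd (Ω : Set (ES N)) (V : ES N → ℝ) (ε : ℝ) (B : Set (ES N)) : ℕ → ES N → ℝ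
  | 0 => B.indicator fun _ => 1
  | n + 1 => fun x => if x ∈ B then 1 else if x ∈ Ω then TT Ω V ε (rd Ω V ε B n) x else 0

def rdp (Ω : Set (ES N)) (V : ES N → ℝ) (ε : ℝ) (B : Set (ES N)) (x : ES N) : ℝ := ⨆ n, rd Ω V ε B n x

variable {B : Set (ES N)}

lemma rd_B (n : ℕ) {x : ES N} (hx : x ∈ B) : rd Ω V ε B n x = 1 := by
  cases n <;> simp [rd, hx]

lemma rd_succ (n : ℕ) {x : ES N} (hx : x ∉ B) (hxΩ : x ∈ Ω) :
    rd Ω V ε B (n + 1) x = TT Ω V ε (rd Ω V ε B n) x := by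
  simp [rd, hx, hxΩ]

lemma rd_out (hB : B ⊆ Ω) (n : ℕ) {x : ES N} (hx : x ∉ Ω) : rd Ω V ε B n x = 0 := by
  have h : x ∉ B := fun h => hx (hB h)
  cases n <;> simp [rd, hx, h]

lemma rd_meas (cx : Cx Ω V ε) (hBm : MeasurableSet B) (n : ℕ) : Measurable (rd Ω V ε B n) := by
  induction n with
  | zero => exact measurable_const.indicator hBm
  | succ n ih =>
    exact Measurable.ite hBm measurable_const
      (Measurable.ite cx.op.measurableSet (TT_meas cx ih) measurable_const)

lemma TT_one (cx : Cx Ω V ε) {z : ES N} (hz : z ∈ Ω) : TT Ω V ε (fun _ => 1) z ≤ 1 := by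
  have := TT_le_Ev cx hz (Good.const 1) (fun _ _ => zero_le_one)
  rwa [Ev_const] at this

lemma good01 {f : ES N → ℝ} (hf : Measurable f) (h : ∀ x, 0 ≤ f x ∧ f x ≤ 1) : Good Ω f :=
  ⟨hf, fun x _ => ⟨1, Eventually.of_forall fun w => by rw [abs_of_nonneg (h w).1]; exact (h w).2⟩⟩

lemma rd_01 (cx : Cx Ω V ε) (hBm : MeasurableSet B) (hB : B ⊆ Ω) (n : ℕ) :
    ∀ x, 0 ≤ rd Ω V ε B n x ∧ rd Ω V ε B n x ≤ 1 := by
  induction n with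
  | zero => intro x; by_cases hx : x ∈ B <;> simp [rd, hx]
  | succ n ih =>
    intro x
    by_cases hx : x ∈ B
    · rw [rd_B _ hx]; norm_num
    by_cases hxΩ : x ∈ Ω
    · rw [rd_succ n hx hxΩ]
      refine ⟨TT_nonneg cx hxΩ fun w _ => (ih w).1, ?_⟩
      exact (TT_mono cx hxΩ (good01 (rd_meas cx hBm n) ih) (Good.const 1) fun w _ => (ih w).2).trans (TT_one cx hxΩ)
    · rw [rd_out hB _ hxΩ]; norm_num

lemma rd_good (cx : Cx Ω V ε) (hBm : MeasurableSet B) (hB : B ⊆ Ω) (n : ℕ) : Good Ω (rd Ω V ε B n) :=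
  good01 (rd_meas cx hBm n) (rd_01 cx hBm hB n)

lemma rd_step (cx : Cx Ω V ε) (hBm : MeasurableSet B) (hB : B ⊆ Ω) (n : ℕ) :
    ∀ x, rd Ω V ε B n x ≤ rd Ω V ε B (n + 1) x := by
  induction n with
  | zero =>
    intro x
    by_cases hx : x ∈ B
    · rw [rd_B _ hx, rd_B _ hx]
    · have : rd Ω V ε B 0 x = 0 := by simp [rd, hx]
      rw [this]; exact (rd_01 cx hBm hB _ x).1
  | succ n ih =>
    intro x
    by_cases hx : x ∈ B
    · rw [rd_B _ hx, rd_B _ hx]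
    by_cases hxΩ : x ∈ Ω
    · rw [rd_succ n hx hxΩ, rd_succ (n + 1) hx hxΩ]
      exact TT_mono cx hxΩ (rd_good cx hBm hB n) (rd_good cx hBm hB _) fun w _ => ih w
    · rw [rd_out hB _ hxΩ, rd_out hB _ hxΩ]

lemma rd_tendsto (cx : Cx Ω V ε) (hBm : MeasurableSet B) (hB : B ⊆ Ω) (x : ES N) :
    Tendsto (fun n => rd Ω V ε B n x) atTop (𝓝 (rdp Ω V ε B x)) :=
  tendsto_atTop_ciSup (monotone_nat_of_le_succ fun n => rd_step cx hBm hB n x)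
    ⟨1, by rintro _ ⟨n, rfl⟩; exact (rd_01 cx hBm hB n x).2⟩

lemma rd_le_rdp (cx : Cx Ω V ε) (hBm : MeasurableSet B) (hB : B ⊆ Ω) (n : ℕ) (x : ES N) :
    rd Ω V ε B n x ≤ rdp Ω V ε B x :=
  le_ciSup (f := fun n => rd Ω V ε B n x) ⟨1, by rintro _ ⟨n, rfl⟩; exact (rd_01 cx hBm hB n x).2⟩ n

lemma rdp_01 (cx : Cx Ω V ε) (hBm : MeasurableSet B) (hB : B ⊆ Ω) (x : ES N) :
    0 ≤ rdp Ω V ε B x ∧ rdp Ω V ε B x ≤ 1 :=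
  ⟨((rd_01 cx hBm hB 0 x).1).trans (rd_le_rdp cx hBm hB 0 x),
    ciSup_le fun n => (rd_01 cx hBm hB n x).2⟩

lemma rdp_good (cx : Cx Ω V ε) (hBm : MeasurableSet B) (hB : B ⊆ Ω) : Good Ω (rdp Ω V ε B) := by
  refine good01 ?_ (rdp_01 cx hBm hB)
  exact measurable_of_tendsto_metrizable (fun n => rd_meas cx hBm n)
    (tendsto_pi_nhds.2 fun x => rd_tendsto cx hBm hB x)

lemma rdp_B (cx : Cx Ω V ε) (hBm : MeasurableSet B) (hB : B ⊆ Ω) {x : ES N} (hx : x ∈ B) :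
    1 ≤ rdp Ω V ε B x := by
  have := rd_le_rdp cx hBm hB 0 x
  rwa [rd_B _ hx] at this

lemma rdp_sup (cx : Cx Ω V ε) (hBm : MeasurableSet B) (hB : B ⊆ Ω) {x : ES N} (hx : x ∈ Ω) :
    SupAt Ω V ε (rdp Ω V ε B) x := by
  refine ⟨fun w _ => (rdp_01 cx hBm hB w).1, ?_⟩
  by_cases hxB : x ∈ B
  · refine le_trans ?_ (rdp_B cx hBm hB hxB)
    exact (TT_mono cx hx (rdp_good cx hBm hB) (Good.const 1) fun w _ => (rdp_01 cx hBm hB w).2).trans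
      (TT_one cx hx)
  · have h : Tendsto (fun n => TT Ω V ε (rd Ω V ε B n) x) atTop (𝓝 (TT Ω V ε (rdp Ω V ε B) x)) := by
      unfold TT
      refine tendsto_integral_of_dominated_convergence (fun _ => 1) ?_ (integrable_const _) ?_ ?_
      · intro n
        exact ((kk_meas cx.Vm).mul ((rd_meas cx hBm n).comp ZZ_meas)).aestronglyMeasurable
      · intro n
        refine Eventually.of_forall fun ω => ?_
        have h1 := kk_ge (Ω := Ω) (V := V) (ε := ε) (z := x) ω
        have h2 := kk_le (Ω := Ω) (V := V) (ε := ε) (z := x) ω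
        have h3 := rd_01 cx hBm hB n (ZZ Ω ε x ω)
        rw [Real.norm_of_nonneg (mul_nonneg (by linarith) h3.1)]
        exact mul_le_one₀ h2 h3.1 h3.2
      · exact Eventually.of_forall fun ω => (rd_tendsto cx hBm hB _).const_mul _
    refine le_of_tendsto h (Eventually.of_forall fun n => ?_)
    rw [← rd_succ n hxB hx]
    exact rd_le_rdp cx hBm hB _ x

lemma rd_le (cx : Cx Ω V ε) (hBm : MeasurableSet B) (hB : B ⊆ Ω) {v : ES N → ℝ} (hv : Good Ω v)
    (hs : ∀ x ∈ Ω, SupAt Ω V ε v x) {lam : ℝ} (h : ∀ w ∈ B, lam ≤ v w) (n : ℕ) :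
    ∀ x ∈ Ω, lam * rd Ω V ε B n x ≤ v x := by
  induction n with
  | zero =>
    intro x hx
    by_cases hxB : x ∈ B
    · rw [rd_B _ hxB, mul_one]; exact h x hxB
    · have : rd Ω V ε B 0 x = 0 := by simp [rd, hxB]
      rw [this, mul_zero]; exact (hs x hx).nonneg cx hx
  | succ n ih =>
    intro x hx
    by_cases hxB : x ∈ B
    · rw [rd_B _ hxB, mul_one]; exact h x hxB
    · rw [rd_succ n hxB hx, ← TT_cmul]
      exact (TT_mono cx hx ((rd_good cx hBm hB n).cmul lam) hv fun w hw => ih w (cx.cb1 hx hw)).trans (hs x hx).2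

lemma TT_sum (cx : Cx Ω V ε) {z : ES N} (hz : z ∈ Ω) {ι : Type*} (t : Finset ι) {f : ι → ES N → ℝ}
    (lam : ι → ℝ) (hf : ∀ i ∈ t, Good Ω (f i)) :
    Good Ω (fun x => ∑ i ∈ t, lam i * f i x) ∧
    TT Ω V ε (fun x => ∑ i ∈ t, lam i * f i x) z = ∑ i ∈ t, lam i * TT Ω V ε (f i) z := by
  classical
  induction t using Finset.induction_on with
  | empty =>
    refine ⟨by simpa using Good.const (Ω := Ω) 0, ?_⟩
    simp [TT]
  | insert j t hj ih =>
    obtain ⟨h1, h2⟩ := ih fun i hi => hf i (Finset.mem_insert_of_mem hi)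
    have h3 := (hf j (Finset.mem_insert_self _ _)).cmul (lam j)
    have e1 : (fun x => ∑ i ∈ insert j t, lam i * f i x) = fun x => lam j * f j x + ∑ i ∈ t, lam i * f i x := by
      ext x; rw [Finset.sum_insert hj]
    rw [e1]
    refine ⟨h3.add h1, ?_⟩
    rw [TT_add cx hz h3 h1, TT_cmul, h2, Finset.sum_insert hj]

lemma rd_sum (cx : Cx Ω V ε) {ι : Type*} (t : Finset ι) (lam : ι → ℝ) {Bi : ι → Set (ES N)}
    (hBm : ∀ i ∈ t, MeasurableSet (Bi i)) (hB : ∀ i ∈ t, Bi i ⊆ Ω)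
    {W : ES N → ℝ} (hW : Good Ω W) (hs : ∀ x ∈ Ω, SupAt Ω V ε W x)
    (h : ∀ j ∈ t, ∀ w ∈ Bi j, ∀ n, ∑ i ∈ t, lam i * rd Ω V ε (Bi i) n w ≤ W w) (n : ℕ) :
    ∀ x ∈ Ω, ∑ i ∈ t, lam i * rd Ω V ε (Bi i) n x ≤ W x := by
  induction n with
  | zero =>
    intro x hx
    by_cases hxB : ∃ j ∈ t, x ∈ Bi j
    · obtain ⟨j, hj, hxj⟩ := hxB; exact h j hj x hxj 0
    · push Not at hxB
      rw [Finset.sum_eq_zero]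
      · exact (hs x hx).nonneg cx hx
      · intro i hi; simp [rd, hxB i hi]
  | succ n ih =>
    intro x hx
    by_cases hxB : ∃ j ∈ t, x ∈ Bi j
    · obtain ⟨j, hj, hxj⟩ := hxB; exact h j hj x hxj _
    · push Not at hxB
      have e1 : ∑ i ∈ t, lam i * rd Ω V ε (Bi i) (n + 1) x = ∑ i ∈ t, lam i * TT Ω V ε (rd Ω V ε (Bi i) n) x :=
        Finset.sum_congr rfl fun i hi => by rw [rd_succ n (hxB i hi) hx]
      obtain ⟨g1, g2⟩ := TT_sum cx hx t lam (f := fun i => rd Ω V ε (Bi i) n)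
        fun i hi => rd_good cx (hBm i hi) (hB i hi) n
      rw [e1, ← g2]
      exact (TT_mono cx hx g1 hW fun w hw => ih w (cx.cb1 hx hw)).trans (hs x hx).2

lemma rdp_sum (cx : Cx Ω V ε) {ι : Type*} (t : Finset ι) (lam : ι → ℝ) {Bi : ι → Set (ES N)}
    (hBm : ∀ i ∈ t, MeasurableSet (Bi i)) (hB : ∀ i ∈ t, Bi i ⊆ Ω)
    {W : ES N → ℝ} (hW : Good Ω W) (hs : ∀ x ∈ Ω, SupAt Ω V ε W x)
    (h : ∀ j ∈ t, ∀ w ∈ Bi j, ∀ n, ∑ i ∈ t, lam i * rd Ω V ε (Bi i) n w ≤ W w) :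
    ∀ x ∈ Ω, ∑ i ∈ t, lam i * rdp Ω V ε (Bi i) x ≤ W x := by
  intro x hx
  refine le_of_tendsto (tendsto_finsetSum t fun i hi => (rd_tendsto cx (hBm i hi) (hB i hi) x).const_mul (lam i))
    (Eventually.of_forall fun n => rd_sum cx t lam hBm hB hW hs h n x hx)

/-- disjointification as a decomposition of the restricted measure -/
lemma meas_split (μ : Measure (ES N)) {ι : Type*} [DecidableEq ι] (t : Finset ι) {U : ι → Set (ES N)}
    (hU : ∀ i, MeasurableSet (U i)) : ∀ F : Set (ES N), MeasurableSet F → F ⊆ ⋃ i ∈ t, U i →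
    ∃ A : ι → Set (ES N), (∀ i, MeasurableSet (A i)) ∧ (∀ i, A i ⊆ U i ∩ F) ∧
      μ.restrict F = ∑ i ∈ t, μ.restrict (A i) := by
  induction t using Finset.induction_on with
  | empty =>
    intro F hF hFU
    refine ⟨fun _ => ∅, fun _ => MeasurableSet.empty, fun _ => empty_subset _, ?_⟩
    have : F = ∅ := by simpa using hFU
    rw [this]; simp
  | insert j t hj ih =>
    intro F hF hFU
    obtain ⟨A, h1, h2, h3⟩ := ih (F \ U j) (hF.diff (hU j)) (by
      rintro x ⟨hx, hxj⟩
      have := hFU hx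
      simp only [Finset.mem_insert, iUnion_iUnion_eq_or_left, mem_union] at this
      exact this.resolve_left hxj)
    refine ⟨Function.update A j (F ∩ U j), fun i => ?_, fun i => ?_, ?_⟩
    · by_cases hi : i = j
      · subst hi; simpa using hF.inter (hU i)
      · simpa [hi] using h1 i
    · by_cases hi : i = j
      · subst hi; simp
      · simp only [ne_eq, hi, not_false_eq_true, Function.update_of_ne]
        exact fun x hx => ⟨(h2 i hx).1, (h2 i hx).2.1⟩
    · rw [Finset.sum_insert hj, Function.update_self]
      have : ∑ i ∈ t, μ.restrict (Function.update A j (F ∩ U j) i) = ∑ i ∈ t, μ.restrict (A i) :=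
        Finset.sum_congr rfl fun i hi => by
          rw [Function.update_of_ne]; rintro rfl; exact hj hi
      rw [this, ← h3]
      exact (Measure.restrict_inter_add_diff F (hU j)).symm

end


section


set_option linter.unusedVariables false
set_option linter.unusedSectionVars false

variable {N : ℕ} {Ω : Set (ES N)} {V : ES N → ℝ} {ε : ℝ}
variable {y0 e : ES N} {H : ES N → ℝ} {Λ r1 : ℝ}
variable {a : ℝ} {x0 : ES N} {k kV : ES N → ES N → ℝ}

lemma geo (cx : Cx Ω V ε) (P : Patch Ω y0 e H Λ r1) (hε : 32 * Λ ^ 2 * ε ^ 2 ≤ k1 N) (hk : Ker Ω V x0 kV)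
    {κ : ℝ} (hκ : 0 < κ) (hκ1 : κ ≤ 1 / (400 * Λ ^ 2)) :
    ∃ C, 0 < C ∧ ∀ y x1 ϱ, 0 < ϱ → H y = 0 → ball y (8 * Λ * ϱ) ⊆ ball y0 r1 → x1 ∈ Ω → dist x1 y = ϱ →
      κ * ϱ ≤ H x1 → ball x1 (ε * κ * ϱ / (24 * Λ)) ⊆ Ω →
      ∀ z ∈ frontier Ω, dist z y < κ * ϱ / (4 * Λ) → ∀ x ∈ Ω, ϱ ≤ dist x y →
        kV z x ≤ C * kV z x1 * rdp Ω V ε (ball x1 (ε * κ * ϱ / (24 * Λ))) x := by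
  have hΛ := P.L1
  obtain ⟨C, hC, hsh⟩ := shell cx P hε hκ hκ1
  have hk1 : κ ≤ 1 := hκ1.trans (by rw [div_le_one (by positivity)]; nlinarith)
  have hK0 : 0 < gK Λ κ := by unfold gK; positivity
  have hcc := pow_pos (cc_pos (N := N) hK0) (3 * gn Λ κ ε)
  set q := cc N (gK Λ κ) ^ (3 * gn Λ κ ε) with hq
  have hg := gCt_pos (N := N) (ε := ε) hΛ hκ
  refine ⟨C * gCt N Λ κ ε * q⁻¹, by positivity, ?_⟩
  intro y x1 ϱ hϱ hy hsub hx1 hd hH hB z hz hzy x hx hxy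
  set B := ball x1 (ε * κ * ϱ / (24 * Λ)) with hBd
  have hBm : MeasurableSet B := measurableSet_ball
  have hx1b : x1 ∈ ball y (2 * ϱ) := by rw [mem_ball, hd]; linarith
  have hAb : y + ϱ • e ∈ ball y (2 * ϱ) := by rw [mem_ball, P.de y hϱ.le]; linarith
  have hHA : κ * ϱ ≤ H (y + ϱ • e) := by rw [P.tr, hy, zero_add]; exact mul_le_of_le_one_left hϱ.le hk1
  have hgc := GC cx P (rdp_good cx hBm hB) (lam := 1) hϱ hκ hk1 hy hsub
    (fun w hw _ _ => rdp_sup cx hBm hB hw) hx1b hAb hH hHA zero_le_one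
    (fun w hw => rdp_B cx hBm hB hw)
  have hnice := hk.nice cx hz
  have h1 := hsh (kV z) (fun w => q⁻¹ * rdp Ω V ε B w) y ϱ hnice.1 ((rdp_good cx hBm hB).cmul _) hϱ hy hsub
    (fun w hw _ => hnice.2 w hw)
    (fun w hw hwd => hk.van z hz w hw (by rintro rfl; linarith))
    (fun w hw _ => (rdp_sup cx hBm hB hw).cmul (inv_nonneg.2 hcc.le))
    (fun w hw => by
      have := hgc w hw
      rw [one_mul] at this
      rw [inv_mul_eq_div, le_div_iff₀ hcc, one_mul]
      exact this) x hx hxy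
  have h2 := GH cx P hnice.1 hϱ hκ hk1 hy hsub (fun w hw _ _ => hnice.2 w hw) hAb hx1b hHA hH x1
    (mem_ball_self (by have := cx.e0; positivity))
  have hp := (rdp_01 cx hBm hB x).1
  refine h1.trans ?_
  calc C * kV z (y + ϱ • e) * (q⁻¹ * rdp Ω V ε B x)
      ≤ C * (gCt N Λ κ ε * kV z x1) * (q⁻¹ * rdp Ω V ε B x) := by gcongr
    _ = _ := by ring

variable {μ : Measure (ES N)} [IsFiniteMeasure μ]

lemma hh_mono (D : Dom Ω V a x0) (hk : Ker Ω V x0 k) {x w : ES N} {A : Set (ES N)} (hA : MeasurableSet A)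
    {c : ℝ} (h : ∀ z ∈ A, k z x ≤ c * k z w) : hh k (μ.restrict A) x ≤ c * hh k (μ.restrict A) w := by
  unfold hh
  rw [← integral_const_mul]
  exact setIntegral_mono_on (hk.int D x).integrableOn ((hk.int D w).const_mul c).integrableOn hA h

lemma hh_mono' (D : Dom Ω V a x0) (hk : Ker Ω V x0 k) {x w : ES N}
    {c : ℝ} (h : ∀ z, k z x ≤ c * k z w) : hh k μ x ≤ c * hh k μ w := by
  unfold hh
  rw [← integral_const_mul]
  exact integral_mono (hk.int D x) ((hk.int D w).const_mul c) h

lemma hh_res (D : Dom Ω V a x0) (hk : Ker Ω V x0 k) (A : Set (ES N)) (x : ES N) :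
    hh k (μ.restrict A) x ≤ hh k μ x :=
  setIntegral_le_integral (hk.int D x) (Eventually.of_forall fun z => hk.nonneg z x)

lemma hh_sup (D : Dom Ω V a x0) (hk : Ker Ω (fun _ => 0) x0 k) (cx : Cx Ω V ε) {c : ℝ} (hc : 0 ≤ c) {x : ES N}
    (hx : x ∈ Ω) : SupAt Ω V ε (fun w => c * hh k μ w) x := by
  have hg := (hh_good (ν := μ) D.zero hk).cmul c
  refine ⟨fun w _ => mul_nonneg hc (hh_nonneg hk w), (TT_le_Ev cx hx hg fun w _ => mul_nonneg hc (hh_nonneg hk w)).trans ?_⟩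
  rw [Ev_cmul, ← TT_zero, hh_TT D.zero hk cx.zero hx]

lemma cover (D : Dom Ω V a x0) (cx : Cx Ω V ε) (P : Patch Ω y0 e H Λ r1) (hε : 32 * Λ ^ 2 * ε ^ 2 ≤ k1 N)
    (hkV : Ker Ω V x0 kV) (hk : Ker Ω (fun _ => 0) x0 k) {κ' M : ℝ} (hκ' : 0 < κ') (hM : 0 ≤ M) :
    ∃ C, 0 ≤ C ∧ ∀ F : Set (ES N), IsCompact F → F ⊆ frontier Ω → F ⊆ ball y0 (r1 / 2) →
      (∀ y ∈ F, ∀ η > 0, ∃ x ∈ Ω, dist x y < κ' * dista Ω x ∧ dist x y < η ∧ hh kV μ x ≤ M * hh k μ x) →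
      ∀ x ∈ Ω, hh kV (μ.restrict F) x ≤ C * hh k μ x := by
  classical
  have hΛ := P.L1
  have he := cx.e0
  set κ := min (1 / (3 * κ')) (1 / (400 * Λ ^ 2)) with hκd
  have hκ : 0 < κ := lt_min (by positivity) (by positivity)
  have hκ1 : κ ≤ 1 / (400 * Λ ^ 2) := min_le_right _ _
  have hκ2 : κ ≤ 1 / (3 * κ') := min_le_left _ _
  obtain ⟨C, hC, hgeo⟩ := geo cx P hε hkV hκ hκ1
  have hCH := CH_pos (N := N) (K := 34) (by norm_num)
  set c := CH N 34 with hc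
  refine ⟨C * (c * c * M * c), by positivity, ?_⟩
  intro F hF hFf hFb hNT x hx
  set d := min (dista Ω x) (r1 / (16 * Λ)) with hd
  have hr0 := P.r0
  have hd0 : 0 < d := lt_min (cx.dpos hx) (by positivity)
  have hNT' : ∀ y, ∃ w, y ∈ F → w ∈ Ω ∧ dist w y < κ' * dista Ω w ∧ dist w y < d ∧ hh kV μ w ≤ M * hh k μ w := by
    intro y
    by_cases hy : y ∈ F
    · obtain ⟨w, a, b⟩ := hNT y hy d hd0; exact ⟨w, fun _ => ⟨a, b⟩⟩
    · exact ⟨0, fun h => absurd h hy⟩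
  choose X hX using hNT'
  set ϱ : ES N → ℝ := fun y => dist (X y) y with hϱ
  have hϱ0 : ∀ y ∈ F, 0 < ϱ y := by
    intro y hy
    refine dist_pos.2 fun h => ?_
    have h1 := (hX y hy).1
    rw [h] at h1
    have h2 := hFf hy
    rw [cx.op.frontier_eq] at h2
    exact h2.2 h1
  set U : ES N → Set (ES N) := fun y => ball y (κ * ϱ y / (4 * Λ)) with hU
  obtain ⟨t, htF, htU⟩ := hF.elim_nhds_subcover U fun y hy =>
    ball_mem_nhds y (by have := hϱ0 y hy; positivity)
  obtain ⟨A, hAm, hAU, hAs⟩ := meas_split μ t (U := U) (fun _ => measurableSet_ball) F hF.measurableSet htU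
  set Bi : ES N → Set (ES N) := fun y => ball (X y) (ε * κ * ϱ y / (24 * Λ)) with hBi
  have hκδ : ∀ y ∈ F, 3 * (κ * ϱ y) ≤ dista Ω (X y) := by
    intro y hy
    have h1 := (hX y hy).2.1
    have h2 := mul_le_mul_of_nonneg_right hκ2 (hϱ0 y hy).le
    have h3 : 1 / (3 * κ') * ϱ y ≤ 1 / (3 * κ') * (κ' * dista Ω (X y)) := by
      gcongr
    have h4 : 1 / (3 * κ') * (κ' * dista Ω (X y)) = dista Ω (X y) / 3 := by field_simp
    linarith
  have hBsub : ∀ y ∈ F, Bi y ⊆ ball (X y) (RR Ω ε (X y) / 64) := by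
    intro y hy
    refine ball_subset_ball ?_
    have h1 := hκδ y hy
    have h5 := hϱ0 y hy
    rw [div_le_div_iff₀ (by positivity) (by norm_num), RR]
    have h6 : ε * (3 * (κ * ϱ y)) ≤ ε * dista Ω (X y) := by gcongr
    have h7 : 0 ≤ ε * dista Ω (X y) := mul_nonneg he.le (dista_nonneg _)
    nlinarith
  have hBΩ : ∀ y ∈ F, Bi y ⊆ Ω := by
    intro y hy
    have hR := cx.Rpos (hX y hy).1
    exact ((hBsub y hy).trans (ball_subset_closedBall.trans (closedBall_subset_closedBall (by linarith)))).trans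
      (cx.cb1 (hX y hy).1)
  have hharn : ∀ y ∈ F, ∀ w ∈ Bi y, ∀ w' ∈ Bi y, ∀ z, kV z w ≤ c * kV z w' ∧ k z w ≤ c * k z w' := by
    intro y hy w hw w' hw' z
    by_cases hz : z ∈ frontier Ω
    · exact ⟨harn_loc cx (hX y hy).1 (hkV.nice cx hz) (hBsub y hy hw) (hBsub y hy hw'),
        harn_loc cx.zero (hX y hy).1 (hk.nice cx.zero hz) (hBsub y hy hw) (hBsub y hy hw')⟩
    · simp [hkV.zy z _ hz, hk.zy z _ hz]
  have hXB : ∀ y ∈ F, X y ∈ Bi y := fun y hy => mem_ball_self (by have := hϱ0 y hy; positivity)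
  set lam : ES N → ℝ := fun y => hh kV (μ.restrict (A y)) (X y) with hlam
  have hsum : ∀ w, hh kV (μ.restrict F) w = ∑ y ∈ t, hh kV (μ.restrict (A y)) w := by
    intro w
    unfold hh
    rw [hAs, integral_finsetSum_measure]
    intro i _; exact (hkV.int D w)
  have hlow : ∀ w ∈ Ω, ∀ n, ∑ y ∈ t, lam y * rd Ω V ε (Bi y) n w ≤ c * hh kV μ w := by
    intro w hw n
    refine le_trans ?_ (mul_le_mul_of_nonneg_left (hh_res D hkV F w) hCH.le)
    rw [hsum w, Finset.mul_sum]
    refine Finset.sum_le_sum fun y hy => ?_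
    have hyF := htF y hy
    have hr := rd_01 cx (measurableSet_ball) (hBΩ y hyF) n w
    have : ∀ z ∈ A y, rd Ω V ε (Bi y) n w * kV z (X y) ≤ c * kV z w := by
      intro z hz
      have hzf : z ∈ frontier Ω := hFf (hAU y hz).2
      have hn := hkV.nice cx hzf
      have := rd_le cx measurableSet_ball (hBΩ y hyF) (hn.1.cmul c)
        (fun v hv => ((hn.2 v hv).sup).cmul hCH.le) (lam := kV z (X y))
        (fun v hv => (hharn y hyF _ (hXB y hyF) v hv z).1) n w hw
      linarith
    simp only [hlam]
    unfold hh
    rw [mul_comm, ← integral_const_mul, ← integral_const_mul]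
    exact setIntegral_mono_on ((hkV.int D _).const_mul _).integrableOn ((hkV.int D w).const_mul c).integrableOn
      (hAm y) this
  have hWg := (hh_good (ν := μ) D.zero hk).cmul (c * c * M * c)
  have hfin := rdp_sum cx t lam (Bi := Bi) (fun _ _ => measurableSet_ball) (fun y hy => hBΩ y (htF y hy)) hWg
    (fun w hw => hh_sup D hk cx (by positivity) hw) (by
      intro y hy w hw n
      have hyF := htF y hy
      refine (hlow w (hBΩ y hyF hw) n).trans ?_
      have a1 : hh kV μ w ≤ c * hh kV μ (X y) := hh_mono' D hkV fun z => (hharn y hyF w hw _ (hXB y hyF) z).1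
      have a2 := (hX y hyF).2.2.2
      have a3 : hh k μ (X y) ≤ c * hh k μ w := hh_mono' D.zero hk fun z => (hharn y hyF _ (hXB y hyF) w hw z).2
      calc c * hh kV μ w ≤ c * (c * (M * (c * hh k μ w))) := by
            gcongr
            exact a1.trans (mul_le_mul_of_nonneg_left (a2.trans (mul_le_mul_of_nonneg_left a3 hM)) hCH.le)
        _ = _ := by ring) x hx
  rw [hsum x, mul_assoc C]
  refine le_trans ?_ (mul_le_mul_of_nonneg_left hfin hC.le)
  rw [Finset.mul_sum]
  refine Finset.sum_le_sum fun y hy => ?_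
  have hyF := htF y hy
  have hdd := (hX y hyF).2.2.1
  have hϱd : ϱ y < r1 / (16 * Λ) := hdd.trans_le (min_le_right _ _)
  have hyy : dist y y0 < r1 / 2 := hFb hyF
  have h8 : ball y (8 * Λ * ϱ y) ⊆ ball y0 r1 := by
    refine ball_subset_ball' ?_
    rw [lt_div_iff₀ (by positivity)] at hϱd
    linarith
  have hXb : X y ∈ ball y0 r1 := h8 (by
    rw [mem_ball]; have := hϱ0 y hyF
    change ϱ y < _
    nlinarith)
  have hyb : y ∈ ball y0 r1 := by rw [mem_ball]; linarith
  have hHX : κ * ϱ y ≤ H (X y) := by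
    have := P.du _ hXb (hX y hyF).1
    have := hκδ y hyF
    have := mul_pos hκ (hϱ0 y hyF)
    linarith
  have h9 : ϱ y ≤ dist x y :=
    (hdd.le.trans (min_le_left _ _)).trans (dista_le_dist_fr cx.op (hFf hyF))
  have h10 := hh_mono (μ := μ) D hkV (hAm y) (x := x) (w := X y) (c := C * rdp Ω V ε (Bi y) x) (by
    intro z hz
    have := hgeo y (X y) (ϱ y) (hϱ0 y hyF) ((P.fr y hyb).1 (hFf hyF)) h8 (hX y hyF).1 rfl hHX (hBΩ y hyF)
      z (hFf (hAU y hz).2) (hAU y hz).1 x hx h9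
    linarith)
  simp only [hlam]
  linarith

end


section


set_option linter.unusedVariables false
set_option linter.unusedSectionVars false

variable {N : ℕ} {Ω : Set (ES N)} {V : ES N → ℝ} {ε : ℝ}
variable {y0 e : ES N} {H : ES N → ℝ} {Λ r1 : ℝ}
variable {a : ℝ} {x0 : ES N} {k kV : ES N → ES N → ℝ}
variable {μ : Measure (ES N)} [IsFiniteMeasure μ]

lemma hh_split (D : Dom Ω V a x0) (hk : Ker Ω V x0 k) {A : Set (ES N)} (hA : MeasurableSet A) (x : ES N) :
    hh k (μ.restrict A) x + hh k (μ.restrict Aᶜ) x = hh k μ x :=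
  integral_add_compl hA (hk.int D x)

lemma hh_sub (D : Dom Ω V a x0) (hk : Ker Ω V x0 k) {A F : Set (ES N)} (hA : MeasurableSet A) (h : A ⊆ F) (x : ES N) :
    hh k (μ.restrict A) x ≤ hh k (μ.restrict F) x := by
  have h1 := hh_res (μ := μ.restrict F) D hk A x
  rwa [Measure.restrict_restrict hA, inter_eq_left.2 h] at h1

lemma loc (D : Dom Ω V a x0) (hkV : Ker Ω V x0 kV) (hk : Ker Ω (fun _ => 0) x0 k) {C : ℝ} (hC : 0 ≤ C)
    {F : Set (ES N)} (hF : IsCompact F) (h : ∀ x ∈ Ω, hh kV (μ.restrict F) x ≤ C * hh k μ x) :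
    ∀ x ∈ Ω, hh kV (μ.restrict F) x ≤ C * hh k (μ.restrict F) x := by
  intro x hx
  obtain ⟨ε, cx⟩ := D.cx1
  obtain ⟨B, s, hB, hs, -, hbd⟩ := hk.bound D.zero hx
  refine le_of_forall_pos_le_add fun η hη => ?_
  obtain ⟨F1, hF1s, hF1c, hF1m⟩ := hF.isClosed.isOpen_compl.measurableSet.exists_isClosed_diff_lt
    (μ := μ) (measure_ne_top _ _) (ε := ENNReal.ofReal (η / (C * B + 1))) (by
      rw [ne_eq, ENNReal.ofReal_eq_zero, not_le]; positivity)
  set E := Fᶜ \ F1 with hE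
  have hFm := hF.measurableSet
  have hEm : MeasurableSet E := hFm.compl.diff hF1c.measurableSet
  have hdec : ∀ w, hh k μ w = hh k (μ.restrict F) w + hh k (μ.restrict F1) w + hh k (μ.restrict E) w := by
    intro w
    have h1 := hh_split (μ := μ) D.zero hk hFm w
    have h2 := hh_split (μ := μ.restrict Fᶜ) D.zero hk hF1c.measurableSet w
    rw [Measure.restrict_restrict hF1c.measurableSet, inter_eq_left.2 hF1s,
      Measure.restrict_restrict hF1c.measurableSet.compl] at h2
    have h3 : F1ᶜ ∩ Fᶜ = E := by ext z; simp [hE, and_comm]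
    rw [h3] at h2
    linarith
  set g : ES N → ℝ := fun w => hh kV (μ.restrict F) w - (C * hh k (μ.restrict F) w + C * hh k (μ.restrict E) w) with hg
  have g1 := hh_good (ν := μ.restrict F) D hkV
  have g2 := (hh_good (ν := μ.restrict F) D.zero hk).cmul C
  have g3 := (hh_good (ν := μ.restrict E) D.zero hk).cmul C
  have gg : Good Ω g := g1.sub (g2.add g3)
  have hq := MP cx (gg.max0 cx.op) (fun _ _ => le_max_right _ _) (by
    intro z hz hpos
    have hgz : max (g z) 0 = g z := max_eq_left (by
      by_contra hcon
      push Not at hcon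
      rw [max_eq_right hcon.le] at hpos
      exact lt_irrefl _ hpos)
    rw [hgz]
    refine le_trans ?_ (Ev_mono cx hz gg (gg.max0 cx.op) fun w _ => le_max_left _ _)
    simp only [hg]
    rw [Ev_sub cx hz g1 (g2.add g3), Ev_add cx hz g2 g3, Ev_cmul, Ev_cmul, ← TT_zero (f := hh k _),
      ← TT_zero (f := hh k _), hh_TT D.zero hk cx.zero hz, hh_TT D.zero hk cx.zero hz]
    have := TT_le_Ev cx hz g1 fun w _ => hh_nonneg hkV w
    rw [hh_TT D hkV cx hz] at this
    linarith) (by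
    intro w hw
    by_cases hwF : w ∈ F
    · have hv := (hh_vanish (ν := μ.restrict F1) D.zero hk hF1c
        (by rw [Measure.restrict_apply hF1c.measurableSet.compl]; simp) hw (fun h => hF1s h hwF)).const_mul C
      rw [mul_zero] at hv
      refine tendsto_of_tendsto_of_tendsto_of_le_of_le' tendsto_const_nhds hv
        (Eventually.of_forall fun _ => le_max_right _ _) ?_
      filter_upwards [self_mem_nhdsWithin] with v hv
      refine max_le ?_ (mul_nonneg hC (hh_nonneg hk v))
      have := h v hv
      rw [hdec v] at this
      simp only [hg]; linarith
    · have hv := (hh_vanish (ν := μ.restrict F) D hkV hF.isClosed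
        (by rw [Measure.restrict_apply hFm.compl]; simp) hw hwF)
      refine tendsto_of_tendsto_of_tendsto_of_le_of_le' tendsto_const_nhds hv
        (Eventually.of_forall fun _ => le_max_right _ _) (Eventually.of_forall fun v => ?_)
      refine max_le ?_ (hh_nonneg hkV v)
      have a1 := mul_nonneg hC (hh_nonneg (ν := μ.restrict F) hk v)
      have a2 := mul_nonneg hC (hh_nonneg (ν := μ.restrict E) hk v)
      simp only [hg]; linarith) x hx
  have hgx : g x ≤ 0 := (le_max_left _ _).trans hq
  have hEb : hh k (μ.restrict E) x ≤ B * (η / (C * B + 1)) := by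
    refine (hh_le D.zero hk fun z => (hbd z x (mem_ball_self hs)).1).trans ?_
    refine mul_le_mul_of_nonneg_left ?_ hB.le
    rw [Measure.real, Measure.restrict_apply_univ]
    refine ENNReal.toReal_le_of_le_ofReal (by positivity) hF1m.le
  have hCB : C * (B * (η / (C * B + 1))) ≤ η := by
    rw [← mul_assoc, ← mul_div_assoc, div_le_iff₀ (by positivity)]
    nlinarith
  have := mul_le_mul_of_nonneg_left hEb hC
  simp only [hg] at hgx
  linarith

lemma shrink (D : Dom Ω V a x0) (hkV : Ker Ω V x0 kV) (hk : Ker Ω (fun _ => 0) x0 k) {C : ℝ} (hC : 0 ≤ C)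
    {F : Set (ES N)} (hF : IsCompact F) (hFf : F ⊆ frontier Ω)
    (h : ∀ x ∈ Ω, hh kV (μ.restrict F) x ≤ C * hh k μ x) {y : ES N} (hy : y ∈ F)
    (hpos : ∀ r > 0, μ (F ∩ closedBall y r) ≠ 0) : ∀ x ∈ Ω, kV y x ≤ C * k y x := by
  intro x hx
  refine le_of_forall_pos_le_add fun η hη => ?_
  set η' := η / (1 + C) with hη'
  have hη0 : 0 < η' := by positivity
  have hee : η' * (1 + C) = η := by rw [hη']; field_simp
  obtain ⟨r2, hr2, h2⟩ := Metric.continuousWithinAt_iff.1 (hkV.contOn D x y (hFf hy)) η' hη0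
  obtain ⟨r3, hr3, h3⟩ := Metric.continuousWithinAt_iff.1 (hk.contOn D.zero x y (hFf hy)) η' hη0
  set r := min r2 r3 / 2 with hr
  have hm : 0 < min r2 r3 := lt_min hr2 hr3
  have hr0 : 0 < r := by positivity
  set A := F ∩ closedBall y r with hA
  have hAc : IsCompact A := hF.inter_right isClosed_closedBall
  have hAm := hAc.measurableSet
  have hl := loc (μ := μ) D hkV hk hC hAc (fun w hw => (hh_sub D hkV hAm inter_subset_left w).trans (h w hw)) x hx
  have hcl : ∀ z ∈ A, kV y x - η' ≤ kV z x ∧ k z x ≤ k y x + η' := by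
    rintro z ⟨hzF, hz⟩
    rw [mem_closedBall] at hz
    have a2 := h2 (hFf hzF) (by linarith [min_le_left r2 r3] : dist z y < r2)
    have a3 := h3 (hFf hzF) (by linarith [min_le_right r2 r3] : dist z y < r3)
    rw [Real.dist_eq, abs_lt] at a2 a3
    constructor <;> linarith
  have hm0 : 0 < μ.real A := ENNReal.toReal_pos (hpos r hr0) (measure_ne_top _ _)
  have b1 : (kV y x - η') * μ.real A ≤ hh kV (μ.restrict A) x := by
    have := setIntegral_mono_on (μ := μ) (s := A) (f := fun _ => kV y x - η') (g := fun z => kV z x)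
      (integrable_const _).integrableOn (hkV.int D x).integrableOn hAm (fun z hz => (hcl z hz).1)
    rw [setIntegral_const, smul_eq_mul, mul_comm] at this
    exact this
  have b2 : hh k (μ.restrict A) x ≤ (k y x + η') * μ.real A := by
    have := setIntegral_mono_on (μ := μ) (s := A) (g := fun _ => k y x + η') (f := fun z => k z x)
      (hk.int D.zero x).integrableOn (integrable_const _).integrableOn hAm (fun z hz => (hcl z hz).2)
    rw [setIntegral_const, smul_eq_mul, mul_comm (μ.real A)] at this
    exact this
  have b3 := mul_le_mul_of_nonneg_left b2 hC
  have b4 : (kV y x - η') * μ.real A ≤ (C * (k y x + η')) * μ.real A := by linarith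
  have b5 := le_of_mul_le_mul_right b4 hm0
  linarith

end


section


set_option linter.unusedVariables false
set_option linter.unusedSectionVars false

variable {N : ℕ} {Ω : Set (ES N)} {V : ES N → ℝ} {ε : ℝ}
variable {y0 e : ES N} {H : ES N → ℝ} {Λ r1 : ℝ}
variable {a : ℝ} {x0 : ES N} {k kV : ES N → ES N → ℝ}
variable {μ : Measure (ES N)} [IsFiniteMeasure μ]

/-- points at which the ratio is at most M along a nontangential sequence -/
def GG (Ω : Set (ES N)) (h w : ES N → ℝ) (κ M : ℝ) : Set (ES N) :=
  {y | ∀ n : ℕ, ∃ x ∈ Ω, dist x y < κ * dista Ω x ∧ dist x y < 1 / (n + 1 : ℝ) ∧ h x ≤ M * w x}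

lemma GG_meas {h w : ES N → ℝ} {κ M : ℝ} : MeasurableSet (GG Ω h w κ M) := by
  have : GG Ω h w κ M = ⋂ n : ℕ, ⋃ x ∈ {x | x ∈ Ω ∧ h x ≤ M * w x},
      (ball x (κ * dista Ω x) ∩ ball x (1 / (n + 1 : ℝ))) := by
    ext y
    simp only [GG, mem_ofPred_eq, mem_iInter, mem_iUnion, mem_inter_iff, mem_ball, dist_comm y, exists_prop]
    constructor
    · intro hy n
      obtain ⟨x, h1, h2, h3, h4⟩ := hy n
      exact ⟨x, ⟨h1, h4⟩, h2, h3⟩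
    · intro hy n
      obtain ⟨x, ⟨h1, h4⟩, h2, h3⟩ := hy n
      exact ⟨x, h1, h2, h3, h4⟩
  rw [this]
  refine MeasurableSet.iInter fun n => IsOpen.measurableSet ?_
  exact isOpen_biUnion fun x _ => isOpen_ball.inter isOpen_ball

def Zb (Ω : Set (ES N)) (k kV : ES N → ES N → ℝ) : Set (ES N) :=
  {y | ∀ C, 0 ≤ C → ¬ ∀ x ∈ Ω, kV y x ≤ C * k y x}

lemma null_loc (D : Dom Ω V a x0) (hkV : Ker Ω V x0 kV) (hk : Ker Ω (fun _ => 0) x0 k) {κ M : ℝ} (hκ : 0 < κ)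
    (hM : 0 ≤ M) : μ (GG Ω (hh kV μ) (hh k μ) κ M ∩ frontier Ω ∩ Zb Ω k kV) = 0 := by
  refine measure_null_of_locally_null _ fun y0 hy0 => ?_
  obtain ⟨e, H, Λ, r1, P⟩ := exists_patch D.lip D.ne hy0.1.2
  obtain ⟨ε, cx, hε⟩ := D.cx P.L1
  have hr0 := P.r0
  set T := GG Ω (hh kV μ) (hh k μ) κ M ∩ frontier Ω ∩ ball y0 (r1 / 2) with hT
  have hTm : MeasurableSet T := (GG_meas.inter isClosed_frontier.measurableSet).inter measurableSet_ball
  refine ⟨(GG Ω (hh kV μ) (hh k μ) κ M ∩ frontier Ω ∩ Zb Ω k kV) ∩ ball y0 (r1 / 2),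
    inter_mem_nhdsWithin _ (ball_mem_nhds _ (by positivity)), ?_⟩
  obtain ⟨C, hC, hcov⟩ := cover (μ := μ) D cx P hε hkV hk hκ hM
  have hF0 : ∀ F, IsCompact F → F ⊆ T → μ (F ∩ Zb Ω k kV) = 0 := by
    intro F hF hFT
    have hFf : F ⊆ frontier Ω := fun y hy => (hFT hy).1.2
    have hc1 := hcov F hF hFf (fun y hy => (hFT hy).2) (by
      intro y hy η hη
      obtain ⟨n, hn⟩ := exists_nat_one_div_lt hη
      obtain ⟨x, h1, h2, h3, h4⟩ := (hFT hy).1.1 n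
      exact ⟨x, h1, h2, h3.trans hn, h4⟩)
    refine measure_null_of_locally_null _ fun y hy => ?_
    have : ∃ r > 0, μ (F ∩ closedBall y r) = 0 := by
      by_contra hcon
      push Not at hcon
      exact hy.2 C hC (shrink D hkV hk hC hF hFf hc1 hy.1 hcon)
    obtain ⟨r, hr, hr0⟩ := this
    refine ⟨(F ∩ Zb Ω k kV) ∩ closedBall y r, inter_mem_nhdsWithin _ (closedBall_mem_nhds _ hr), ?_⟩
    exact measure_mono_null (t := F ∩ closedBall y r) (fun z hz => ⟨hz.1.1, hz.2⟩) hr0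
  refine le_antisymm (le_of_forall_pos_le_add fun η hη => ?_) zero_le
  obtain ⟨F, hFT, hFc, hFm⟩ := hTm.exists_isCompact_sdiff_lt (μ := μ) (measure_ne_top _ _) hη.ne'
  rw [zero_add]
  calc μ _ ≤ μ ((F ∩ Zb Ω k kV) ∪ (T \ F)) := by
        refine measure_mono fun z hz => ?_
        by_cases hzF : z ∈ F
        · exact Or.inl ⟨hzF, hz.1.2⟩
        · exact Or.inr ⟨⟨hz.1.1, hz.2⟩, hzF⟩
    _ ≤ μ (F ∩ Zb Ω k kV) + μ (T \ F) := measure_union_le _ _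
    _ ≤ η := by rw [hF0 F hFc hFT, zero_add]; exact hFm.le

open Classical in
def cut (Ω : Set (ES N)) (K : ES N → ES N → ℝ) (y x : ES N) : ℝ :=
  if y ∈ frontier Ω ∧ x ∈ Ω then K y x else 0

lemma cut_eq {K : ES N → ES N → ℝ} {y x : ES N} (hy : y ∈ frontier Ω) (hx : x ∈ Ω) : cut Ω K y x = K y x := by
  simp [cut, hy, hx]

lemma cut_ker {K : ES N → ES N → ℝ} (ho : IsOpen Ω) (hx0 : x0 ∈ Ω)
    (hK : ∀ y ∈ frontier Ω, IsMartinKernel Ω V x0 y (K y)) : Ker Ω V x0 (cut Ω K) := by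
  classical
  refine ⟨fun y hy => ?_, fun y => ?_, fun y hy x hx => ?_, fun y hy => ?_, fun y hy z hz hzy => ?_, ?_, ?_⟩
  · exact (hK y hy).1.congr ho fun x hx => (cut_eq hy hx).symm
  · by_cases hy : y ∈ frontier Ω
    · have h1 := (hK y hy).1.1
      have h2 := h1.measurable_piecewise (g := fun _ => (0 : ℝ)) continuousOn_const ho.measurableSet
      have : cut Ω K y = fun x => Ω.piecewise (K y) (fun _ => 0) x := by
        ext x
        by_cases hx : x ∈ Ω <;> simp [cut, hy, hx]
      rw [this]; exact h2
    · have : cut Ω K y = fun _ => 0 := by ext x; simp [cut, hy]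
      rw [this]; exact measurable_const
  · rw [cut_eq hy hx]; exact (hK y hy).2.1 x hx
  · rw [cut_eq hy hx0]; exact (hK y hy).2.2.1
  · refine ((hK y hy).2.2.2 z hz hzy).congr' ?_
    filter_upwards [self_mem_nhdsWithin] with x hx
    exact (cut_eq hy hx).symm
  · intro y x hx; simp [cut, hx]
  · intro y x hy; simp [cut, hy]

lemma cut_int {K : ES N → ES N → ℝ} (hμs : μ (frontier Ω)ᶜ = 0) {x : ES N} (hx : x ∈ Ω) :
    ∫ z, K z x ∂μ = hh (cut Ω K) μ x := by
  have hae : ∀ᵐ y ∂μ, y ∈ frontier Ω := by rw [ae_iff]; exact hμs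
  refine integral_congr_ae ?_
  filter_upwards [hae] with y hy
  exact (cut_eq hy hx).symm

lemma hh_pos (D : Dom Ω V a x0) (hk : Ker Ω V x0 k) (hμs : μ (frontier Ω)ᶜ = 0) (hμ : μ ≠ 0) {x : ES N}
    (hx : x ∈ Ω) : 0 < hh k μ x := by
  have hae : ∀ᵐ y ∂μ, y ∈ frontier Ω := by rw [ae_iff]; exact hμs
  obtain ⟨C, s, hC, hs, -, h⟩ := hk.bound D hx
  have h1 : ∫ _, (1 : ℝ) ∂μ ≤ ∫ y, C * k y x ∂μ := by
    refine integral_mono_ae (integrable_const _) ((hk.int D x).const_mul C) ?_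
    filter_upwards [hae] with y hy
    exact (h y x (mem_ball_self hs)).2 hy
  rw [integral_const, integral_const_mul, smul_eq_mul, mul_one] at h1
  have h2 : 0 < μ.real univ := ENNReal.toReal_pos (by simpa using hμ) (measure_ne_top _ _)
  exact pos_of_mul_pos_right (h2.trans_le h1) hC.le

theorem ratio_tendsto (hN : 2 ≤ N) (Ω : Set (ES N))
    (hΩ : IsLipschitzDomain Ω) (hbd : Bornology.IsBounded Ω)
    (x₀ : ES N) (hx₀ : x₀ ∈ Ω) (a : ℝ) (ha : 0 < a)
    (V : ES N → ℝ) (hV : VClass Ω a V)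
    (K KV : ES N → ES N → ℝ) (c : ES N → ℝ)
    (hK : ∀ y ∈ frontier Ω, IsMartinKernel Ω (fun _ => 0) x₀ y (K y))
    (hKV : ∀ y ∈ frontier Ω, IsMartinKernel Ω V x₀ y (KV y))
    (hc : ∀ y ∈ frontier Ω, 0 ≤ c y ∧ c y ≤ 1 ∧
      IsGreatestLVHarmMinorant Ω V (K y) (fun x => c y * KV y x))
    (μ : Measure (ES N)) [IsFiniteMeasure μ] (hμs : μ (frontier Ω)ᶜ = 0) :
    ∀ᵐ y ∂μ, c y = 0 →
      TendstoNT Ω (fun x => (∫ z, KV z x ∂μ) / ∫ z, K z x ∂μ) y atTop := by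
  by_cases hμ : μ = 0
  · subst hμ; simp
  have hne : (Ωᶜ).Nonempty := by
    have : Nonempty (Fin N) := ⟨⟨0, by omega⟩⟩
    rw [nonempty_compl]
    rintro rfl
    exact NormedSpace.unbounded_univ ℝ (ES N) hbd
  have D : Dom Ω V a x₀ := ⟨hΩ, hbd, hne, ha, hV, hx₀⟩
  obtain ⟨_, cx⟩ := D.cx1
  have hk := cut_ker hΩ.1 hx₀ hK
  have hkV := cut_ker hΩ.1 hx₀ hKV
  have hnull : μ (⋃ κ : ℕ, ⋃ M : ℕ, GG Ω (hh (cut Ω KV) μ) (hh (cut Ω K) μ) (κ + 1 : ℝ) M ∩ frontier Ω ∩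
      Zb Ω (cut Ω K) (cut Ω KV)) = 0 :=
    measure_iUnion_null fun κ => measure_iUnion_null fun M =>
      null_loc D hkV hk (by positivity) (by positivity)
  have hae : ∀ᵐ y ∂μ, y ∈ frontier Ω := by rw [ae_iff]; exact hμs
  have hae2 := measure_eq_zero_iff_ae_notMem.1 hnull
  filter_upwards [hae, hae2] with y hy hy2 hcy
  by_contra hcon
  refine hy2 ?_
  have hZ : y ∈ Zb Ω (cut Ω K) (cut Ω KV) := by
    intro C hC hle
    have hC1 : 0 < C + 1 := by positivity
    have hg : LVHarmonic Ω V (fun x => (C + 1)⁻¹ * KV y x + 0 * KV y x) := (hKV y hy).1.comb (hKV y hy).1 _ _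
    have h1 := (hc y hy).2.2.2.2 _ hg (by
      intro x hx
      have h2 := hle x hx
      rw [cut_eq hy hx, cut_eq hy hx] at h2
      have h3 := (hKV y hy).2.1 x hx
      have h4 := (hK y hy).2.1 x hx
      rw [zero_mul, add_zero]
      refine ⟨by positivity, ?_⟩
      rw [inv_mul_le_iff₀ hC1]
      linarith) x₀ hx₀
    simp only [hcy, zero_mul, add_zero, (hKV y hy).2.2.1, mul_one] at h1
    exact absurd h1 (not_le.2 (by positivity))
  simp only [TendstoNT, not_forall] at hcon
  obtain ⟨κ, hκ, hT⟩ := hcon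
  rw [Filter.tendsto_atTop] at hT
  push Not at hT
  obtain ⟨M, hM⟩ := hT
  obtain ⟨n, hn⟩ := exists_nat_ge κ
  obtain ⟨m, hm⟩ := exists_nat_ge M
  simp only [mem_iUnion]
  refine ⟨n, m, ⟨?_, hy⟩, hZ⟩
  intro j
  have hball : ∀ᶠ x in 𝓝[ntRegion Ω y κ] y, dist x y < 1 / (j + 1 : ℝ) :=
    mem_nhdsWithin_of_mem_nhds (ball_mem_nhds _ (by positivity))
  obtain ⟨x, hx1, hx2, hx3, hx4⟩ := (hM.and_eventually (hball.and self_mem_nhdsWithin)).exists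
  have hd := cx.dpos hx3
  refine ⟨x, hx3, ?_, hx2, ?_⟩
  · refine hx4.trans_lt ?_
    have : κ < n + 1 := by linarith
    gcongr
  · have hp := hh_pos D.zero hk hμs hμ hx3
    rw [cut_int hμs hx3, cut_int hμs hx3, div_lt_iff₀ hp] at hx1
    exact hx1.le.trans (mul_le_mul_of_nonneg_right hm hp.le)

end

/-- Proposition `propA6`. For any finite positive measure `μ` on
`∂Ω` and `μ`-a.e. finely irregular point `y ∈ Sing_V(Ω)` (i.e. `c(y) = 0`), the
ratio `K_μ^V/K_μ → +∞` nontangentially at `y`. -/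
theorem statement9 {N : ℕ} (hN : 2 ≤ N) (Ω : Set (ES N))
    (hΩ : IsLipschitzDomain Ω) (hbd : Bornology.IsBounded Ω)
    (x₀ : ES N) (hx₀ : x₀ ∈ Ω) (a : ℝ) (ha : 0 < a)
    (V : ES N → ℝ) (hV : VClass Ω a V)
    (K KV : ES N → ES N → ℝ) (c : ES N → ℝ)
    (hK : ∀ y ∈ frontier Ω, IsMartinKernel Ω (fun _ => 0) x₀ y (K y))
    (hKV : ∀ y ∈ frontier Ω, IsMartinKernel Ω V x₀ y (KV y))
    (hc : ∀ y ∈ frontier Ω, 0 ≤ c y ∧ c y ≤ 1 ∧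
      IsGreatestLVHarmMinorant Ω V (K y) (fun x => c y * KV y x))
    (μ : Measure (ES N)) [IsFiniteMeasure μ] (hμs : μ (frontier Ω)ᶜ = 0) :
    ∀ᵐ y ∂μ, c y = 0 →
      TendstoNT Ω (fun x => (∫ z, KV z x ∂μ) / ∫ z, K z x ∂μ) y atTop := by
  exact ratio_tendsto hN Ω hΩ hbd x₀ hx₀ a ha V hV K KV c hK hKV hc μ hμs
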